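/- Let R be a commutative Noetherian ring of finite Krull dimension which is virtually Gorenstein (GP^⊥ = ^⊥GI). Then every GP-pure injective R-module is Gorenstein injective, and conversely every Gorenstein injective R-module is GP-pure injective. -/

import Mathlib

open CategoryTheory Opposite Limits MonoidalCategory

universe u

variable {R : Type u} [CommRing R]

/-- `Q` is a Gorenstein projective module: it is the cokernel `Coker (P₁ → P₀)` of a totally
acyclic complex of projective modules, i.e. an exact complex of projectives which stays exact
under `Hom(-, P)` for every projective `P`. -/
def IsGorensteinProjective (Q : ModuleCat.{u} R) : Prop :=
  ∃ C : ChainComplex (ModuleCat.{u} R) ℤ,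
    (∀ i, Projective (C.X i)) ∧
    (∀ i, C.ExactAt i) ∧
    Nonempty (Q ≅ cokernel (C.d 1 0)) ∧
    ∀ P : ModuleCat.{u} R, Projective P →
      ∀ (i : ℤ) (f : C.X i ⟶ P), C.d (i + 1) i ≫ f = 0 →
        ∃ g : C.X (i - 1) ⟶ P, f = C.d i (i - 1) ≫ g

/-- `E` is a Gorenstein injective module: it is the kernel `Ker (I⁰ → I¹)` of a totally acyclic
complex of injective modules, i.e. an exact complex of injectives which stays exact under
`Hom(I, -)` for every injective `I`. -/
def IsGorensteinInjective (E : ModuleCat.{u} R) : Prop :=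
  ∃ C : CochainComplex (ModuleCat.{u} R) ℤ,
    (∀ i, Injective (C.X i)) ∧
    (∀ i, C.ExactAt i) ∧
    Nonempty (E ≅ kernel (C.d 0 1)) ∧
    ∀ I : ModuleCat.{u} R, Injective I →
      ∀ (i : ℤ) (f : I ⟶ C.X i), f ≫ C.d i (i + 1) = 0 →
        ∃ g : I ⟶ C.X (i - 1), f = g ≫ C.d (i - 1) i

/-- `M` is a Gorenstein flat module: it is a cokernel in an exact complex of flat modules which
remains exact after tensoring with any injective module. -/
def IsGorensteinFlat (M : ModuleCat.{u} R) : Prop :=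
  ∃ C : ChainComplex (ModuleCat.{u} R) ℤ,
    (∀ i, Module.Flat R (C.X i)) ∧
    (∀ i, C.ExactAt i) ∧
    Nonempty (M ≅ cokernel (C.d 1 0)) ∧
    ∀ I : ModuleCat.{u} R, Injective I → ∀ i : ℤ,
      (((tensorLeft I).mapHomologicalComplex (ComplexShape.down ℤ)).obj C).ExactAt i

/-- A short exact sequence `0 → X₁ → X₂ → X₃ → 0` is `𝒳`-pure exact if
`Hom(U, X₂) → Hom(U, X₃)` is surjective for every `U ∈ 𝒳`. -/
def XPureExact (𝒳 : ModuleCat.{u} R → Prop) (S : ShortComplex (ModuleCat.{u} R)) : Prop :=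
  ∀ U : ModuleCat.{u} R, 𝒳 U → ∀ φ : U ⟶ S.X₃, ∃ ψ : U ⟶ S.X₂, ψ ≫ S.g = φ

/-- A short exact sequence `0 → X₁ → X₂ → X₃ → 0` is `𝒳`-copure exact if
`Hom(X₂, V) → Hom(X₁, V)` is surjective for every `V ∈ 𝒳`. -/
def XCopureExact (𝒳 : ModuleCat.{u} R → Prop) (S : ShortComplex (ModuleCat.{u} R)) : Prop :=
  ∀ V : ModuleCat.{u} R, 𝒳 V → ∀ φ : S.X₁ ⟶ V, ∃ ψ : S.X₂ ⟶ V, S.f ≫ ψ = φ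

/-- `M` is `𝒳`-pure flat: `M ⊗ -` leaves every `𝒳`-pure exact short exact sequence exact. -/
def XPureFlat (𝒳 : ModuleCat.{u} R → Prop) (M : ModuleCat.{u} R) : Prop :=
  ∀ S : ShortComplex (ModuleCat.{u} R), S.ShortExact → XPureExact 𝒳 S →
    Function.Injective ((tensorLeft M).map S.f)

/-- `N` is `𝒳`-pure injective: `Hom(-, N)` leaves every `𝒳`-pure exact short exact
sequence exact. -/
def XPureInjective (𝒳 : ModuleCat.{u} R → Prop) (N : ModuleCat.{u} R) : Prop :=
  ∀ S : ShortComplex (ModuleCat.{u} R), S.ShortExact → XPureExact 𝒳 S →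
    ∀ φ : S.X₁ ⟶ N, ∃ ψ : S.X₂ ⟶ N, S.f ≫ ψ = φ

/-- `M` is `𝒳`-pure projective: `Hom(M, -)` leaves every `𝒳`-pure exact short exact
sequence exact. -/
def XPureProjective (𝒳 : ModuleCat.{u} R → Prop) (M : ModuleCat.{u} R) : Prop :=
  ∀ S : ShortComplex (ModuleCat.{u} R), S.ShortExact → XPureExact 𝒳 S →
    ∀ φ : M ⟶ S.X₃, ∃ ψ : M ⟶ S.X₂, ψ ≫ S.g = φ

/-- `GP`-pure exactness: `Hom(Q, -)` leaves the sequence exact for all Gorenstein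
projective `Q`. -/
abbrev GPPureExact (S : ShortComplex (ModuleCat.{u} R)) : Prop :=
  XPureExact IsGorensteinProjective S

/-- `GI`-copure exactness: `Hom(-, E)` leaves the sequence exact for all Gorenstein
injective `E`. -/
abbrev GICopureExact (S : ShortComplex (ModuleCat.{u} R)) : Prop :=
  XCopureExact IsGorensteinInjective S

abbrev GPPureProjective (M : ModuleCat.{u} R) : Prop :=
  XPureProjective IsGorensteinProjective M

abbrev GPPureInjective (M : ModuleCat.{u} R) : Prop :=
  XPureInjective IsGorensteinProjective M

abbrev GPPureFlat (M : ModuleCat.{u} R) : Prop :=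
  XPureFlat IsGorensteinProjective M

/-- `Ext^n_R(M, N)` vanishes. -/
abbrev extVanish (n : ℕ) (M N : ModuleCat.{u} R) : Prop :=
  Subsingleton (((Ext R (ModuleCat.{u} R) n).obj (op M)).obj N)

/-- `M` belongs to `GP^⊥`. -/
abbrev MemGPperp (M : ModuleCat.{u} R) : Prop :=
  ∀ Q : ModuleCat.{u} R, IsGorensteinProjective Q → extVanish 1 Q M

/-- `M` belongs to `^⊥GI`. -/
abbrev MemPerpGI (M : ModuleCat.{u} R) : Prop :=
  ∀ E : ModuleCat.{u} R, IsGorensteinInjective E → extVanish 1 M E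

/-- Gorenstein projective dimension of `M` is at most `n`: there is a resolution
`0 → G_n → ⋯ → G_0 → M → 0` by Gorenstein projective modules. -/
def GpdLE : ℕ → ModuleCat.{u} R → Prop
  | 0, M => IsGorensteinProjective M
  | n + 1, M =>
    ∃ S : ShortComplex (ModuleCat.{u} R), S.ShortExact ∧ Nonempty (S.X₃ ≅ M) ∧
      IsGorensteinProjective S.X₂ ∧ GpdLE n S.X₁

/-- Gorenstein injective dimension of `M` is at most `n`: there is a coresolution
`0 → M → E⁰ → ⋯ → Eⁿ → 0` by Gorenstein injective modules. -/
def GidLE : ℕ → ModuleCat.{u} R → Prop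
  | 0, M => IsGorensteinInjective M
  | n + 1, M =>
    ∃ S : ShortComplex (ModuleCat.{u} R), S.ShortExact ∧ Nonempty (S.X₁ ≅ M) ∧
      IsGorensteinInjective S.X₂ ∧ GidLE n S.X₃

/-- Gorenstein flat dimension of `M` is at most `n`. -/
def GfdLE : ℕ → ModuleCat.{u} R → Prop
  | 0, M => IsGorensteinFlat M
  | n + 1, M =>
    ∃ S : ShortComplex (ModuleCat.{u} R), S.ShortExact ∧ Nonempty (S.X₃ ≅ M) ∧
      IsGorensteinFlat S.X₂ ∧ GfdLE n S.X₁

/-- The Pontryagin dual `M⁺ = Hom_ℤ(M, ℚ/ℤ)` as an `R`-module. -/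
noncomputable def characterDual (M : ModuleCat.{u} R) : ModuleCat.{u} R :=
  ModuleCat.of R (CharacterModule M)

/-- `R` is a coherent ring: every finitely generated ideal is finitely presented. -/
def IsCoherentRing (R : Type u) [CommRing R] : Prop :=
  ∀ I : Ideal R, I.FG → Module.FinitePresentation R I

/-- `φ : G → M` is a Gorenstein projective precover. -/
def IsGPPrecover {G M : ModuleCat.{u} R} (φ : G ⟶ M) : Prop :=
  IsGorensteinProjective G ∧
    ∀ G' : ModuleCat.{u} R, IsGorensteinProjective G' →
      ∀ ψ : G' ⟶ M, ∃ χ : G' ⟶ G, χ ≫ φ = ψ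

/-- The short exact sequence `0 → Im d_{i+1} → X_i → Im d_i → 0` extracted from a complex. -/
noncomputable def imagesShortComplex (C : ChainComplex (ModuleCat.{u} R) ℤ) (i : ℤ) :
    ShortComplex (ModuleCat.{u} R) :=
  ShortComplex.mk (image.ι (C.d (i + 1) i)) (factorThruImage (C.d i (i - 1)))
    (by
      rw [← cancel_epi (factorThruImage (C.d (i + 1) i)),
        ← cancel_mono (image.ι (C.d i (i - 1)))]
      simp)

namespace GorensteinPure

open Function TensorProduct

section Factor

variable {A B X Y Z : Type*} [AddCommGroup A] [Module R A] [AddCommGroup B] [Module R B]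
  [AddCommGroup X] [Module R X] [AddCommGroup Y] [Module R Y] [AddCommGroup Z] [Module R Z]

theorem exists_comp_eq_of_surjective (p : A →ₗ[R] B) (hp : Surjective p) (q : A →ₗ[R] X)
    (h : ∀ a, p a = 0 → q a = 0) : ∃ r : B →ₗ[R] X, r ∘ₗ p = q := by
  refine ⟨(LinearMap.ker p).liftQ q (fun a ha => h a ha) ∘ₗ
    (p.quotKerEquivOfSurjective hp).symm.toLinearMap, ?_⟩
  ext a
  have : (p.quotKerEquivOfSurjective hp).symm (p a) = (LinearMap.ker p).mkQ a := by
    rw [LinearEquiv.symm_apply_eq]; rfl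
  rw [LinearMap.comp_apply, LinearMap.comp_apply, LinearEquiv.coe_coe, this]
  rfl

theorem exists_comp_eq_of_injective (i : A →ₗ[R] B) (hi : Injective i) (q : X →ₗ[R] B)
    (h : ∀ x, ∃ a, i a = q x) : ∃ r : X →ₗ[R] A, i ∘ₗ r = q := by
  refine ⟨(LinearEquiv.ofInjective i hi).symm.toLinearMap ∘ₗ q.codRestrict _ (fun x => h x), ?_⟩
  ext x
  have := LinearEquiv.apply_symm_apply (LinearEquiv.ofInjective i hi)
    (q.codRestrict (LinearMap.range i) (fun x => h x) x)
  exact congrArg Subtype.val this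

/-- `HE d X` says that `Hom(-, X)` keeps the periodic complex `(C, d)` exact. -/
def HE (d : B →ₗ[R] B) (X : Type*) [AddCommGroup X] [Module R X] : Prop :=
  ∀ f : B →ₗ[R] X, f ∘ₗ d = 0 → ∃ g : B →ₗ[R] X, f = g ∘ₗ d

theorem HE.of_retract {d : B →ₗ[R] B} (h : HE d Y) (i : X →ₗ[R] Y) (r : Y →ₗ[R] X)
    (hr : r ∘ₗ i = LinearMap.id) : HE d X := by
  intro f hf
  obtain ⟨g, hg⟩ := h (i ∘ₗ f) (by rw [LinearMap.comp_assoc, hf, LinearMap.comp_zero])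
  refine ⟨r ∘ₗ g, ?_⟩
  rw [LinearMap.comp_assoc, ← hg, ← LinearMap.comp_assoc, hr, LinearMap.id_comp]

theorem HE.congr_equiv {d : B →ₗ[R] B} (h : HE d Y) (e : X ≃ₗ[R] Y) : HE d X :=
  h.of_retract e.toLinearMap e.symm.toLinearMap (by ext; simp)

section TwoOfThree

variable [Module.Projective R B] {d : B →ₗ[R] B} (hd : d ∘ₗ d = 0)
  (i : X →ₗ[R] Y) (p : Y →ₗ[R] Z) (hi : Injective i) (hip : Exact i p) (hp : Surjective p)
include hd hi hip hp

theorem HE.mid (hX : HE d X) (hZ : HE d Z) : HE d Y := by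
  intro f hf
  obtain ⟨g, hg⟩ := hZ (p ∘ₗ f) (by rw [LinearMap.comp_assoc, hf, LinearMap.comp_zero])
  obtain ⟨g', rfl⟩ := Module.projective_lifting_property p g hp
  obtain ⟨x, hx⟩ := exists_comp_eq_of_injective i hi (f - g' ∘ₗ d) (fun c => (hip _).1 (by
    simpa [sub_eq_zero] using LinearMap.congr_fun hg c))
  obtain ⟨h, hh⟩ := hX x (by
    refine LinearMap.ext fun c => hi ?_
    have h1 := LinearMap.congr_fun hx (d c)
    have h2 := LinearMap.congr_fun hf c
    have h3 := LinearMap.congr_fun hd c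
    simp at h1 h2 h3 ⊢
    simp [h1, h2, h3])
  refine ⟨g' + i ∘ₗ h, ?_⟩
  rw [LinearMap.add_comp, LinearMap.comp_assoc, ← hh, hx]
  abel

theorem HE.right (hY : HE d Y) (hX : HE d X) : HE d Z := by
  intro f hf
  obtain ⟨f', rfl⟩ := Module.projective_lifting_property p f hp
  obtain ⟨x, hx⟩ := exists_comp_eq_of_injective i hi (f' ∘ₗ d) (fun c => (hip _).1 (by
    simpa using LinearMap.congr_fun hf c))
  obtain ⟨g, hg⟩ := hX x (by
    refine LinearMap.ext fun c => hi ?_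
    have h1 := LinearMap.congr_fun hx (d c)
    have h3 := LinearMap.congr_fun hd c
    simp at h1 h3 ⊢
    simp [h1, h3])
  obtain ⟨h, hh⟩ := hY (f' - i ∘ₗ g) (by
    rw [LinearMap.sub_comp, LinearMap.comp_assoc, ← hg, hx, sub_self])
  refine ⟨p ∘ₗ h, ?_⟩
  rw [LinearMap.comp_assoc, ← hh, LinearMap.comp_sub, ← LinearMap.comp_assoc,
    hip.linearMap_comp_eq_zero, LinearMap.zero_comp, sub_zero]

theorem HE.left (hY : HE d Y) (hZ : HE d Z) : HE d X := by
  intro f hf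
  obtain ⟨g, hg⟩ := hY (i ∘ₗ f) (by rw [LinearMap.comp_assoc, hf, LinearMap.comp_zero])
  obtain ⟨h, hh⟩ := hZ (p ∘ₗ g) (by
    rw [LinearMap.comp_assoc, ← hg, ← LinearMap.comp_assoc,
      hip.linearMap_comp_eq_zero, LinearMap.zero_comp])
  obtain ⟨h', rfl⟩ := Module.projective_lifting_property p h hp
  obtain ⟨k, hk⟩ := exists_comp_eq_of_injective i hi (g - h' ∘ₗ d) (fun c => (hip _).1 (by
    simpa [sub_eq_zero] using LinearMap.congr_fun hh c))
  refine ⟨k, LinearMap.ext fun c => hi ?_⟩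
  have h1 := LinearMap.congr_fun hk (d c)
  have h2 := LinearMap.congr_fun hg c
  have h3 := LinearMap.congr_fun hd c
  simp at h1 h2 h3 ⊢
  simp [h1, h2, h3]

end TwoOfThree

theorem exists_character_of_notMem {X : Type*} [AddCommGroup X] [Module R X] (K : Submodule R X)
    (x : X) (hx : x ∉ K) :
    ∃ χ : CharacterModule X, (∀ k ∈ K, χ k = 0) ∧ χ x ≠ 0 := by
  obtain ⟨χ, hχ⟩ := CharacterModule.exists_character_apply_ne_zero_of_ne_zero
    (a := K.mkQ x) (by simpa using hx)
  refine ⟨χ.comp K.mkQ.toAddMonoidHom, fun k hk => ?_, hχ⟩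
  have : K.mkQ k = 0 := by simpa using hk
  change χ (K.mkQ k) = 0
  rw [this, map_zero]

theorem HE_character_iff (d : B →ₗ[R] B) (hd : d ∘ₗ d = 0) (N : Type*) [AddCommGroup N]
    [Module R N] : HE d (CharacterModule N) ↔ Exact (d.rTensor N) (d.rTensor N) := by
  have key : ∀ f : B →ₗ[R] CharacterModule N,
      CharacterModule.homEquiv (f ∘ₗ d) = CharacterModule.dual (d.rTensor N)
        (CharacterModule.homEquiv f) := by
    intro f
    refine DFunLike.ext _ _ fun x => ?_
    induction x with
    | zero => simp only [map_zero]
    | tmul b n => rfl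
    | add x y hx hy => simp only [map_add, hx, hy]
  have dd : (d.rTensor N) ∘ₗ (d.rTensor N) = 0 := by
    rw [← LinearMap.rTensor_comp, hd, LinearMap.rTensor_zero]
  constructor
  · intro h x
    refine ⟨fun hx => ?_, ?_⟩
    · by_contra hx'
      obtain ⟨χ, h0, h1⟩ := exists_character_of_notMem (LinearMap.range (d.rTensor N)) x hx'
      obtain ⟨f, rfl⟩ := (CharacterModule.homEquiv (R := R)).surjective χ
      have hf : f ∘ₗ d = 0 := by
        apply (CharacterModule.homEquiv (R := R)).injective
        rw [key]
        refine DFunLike.ext _ _ fun y => ?_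
        rw [map_zero]
        exact h0 _ ⟨y, rfl⟩
      obtain ⟨g, rfl⟩ := h f hf
      rw [key] at h1
      apply h1
      change (CharacterModule.homEquiv g) (d.rTensor N x) = 0
      rw [hx, map_zero]
    · rintro ⟨y, rfl⟩
      exact LinearMap.congr_fun dd y
  · intro h f hf
    have h0 : ∀ x, CharacterModule.homEquiv f (d.rTensor N x) = 0 := by
      intro x
      have := DFunLike.congr_fun (key f) x
      rw [hf, map_zero] at this
      exact this.symm
    let D := d.rTensor N
    obtain ⟨r, hr⟩ : ∃ r : CharacterModule (LinearMap.range D),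
        CharacterModule.homEquiv f = CharacterModule.dual D.rangeRestrict r := by
      obtain ⟨r, hr⟩ := exists_comp_eq_of_surjective (R := ℤ)
        D.rangeRestrict.toAddMonoidHom.toIntLinearMap D.surjective_rangeRestrict
        (AddMonoidHom.toIntLinearMap (CharacterModule.homEquiv f)) (fun x hx => by
          obtain ⟨y, rfl⟩ := (h x).1 (congrArg Subtype.val hx)
          exact h0 y)
      exact ⟨r.toAddMonoidHom, DFunLike.ext _ _ fun x => (LinearMap.congr_fun hr x).symm⟩
    obtain ⟨χ, hχ⟩ := CharacterModule.dual_surjective_of_injective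
      (LinearMap.range D).subtype Subtype.val_injective r
    refine ⟨CharacterModule.homEquiv.symm χ, ?_⟩
    apply (CharacterModule.homEquiv (R := R)).injective
    rw [key, LinearEquiv.apply_symm_apply, hr, ← hχ]
    rfl

theorem rTensor_self_exact_iff (d : B →ₗ[R] B) :
    Exact (d.rTensor R) (d.rTensor R) ↔ Exact d d := by
  have key : ∀ x, TensorProduct.rid R B (d.rTensor R x) = d (TensorProduct.rid R B x) := by
    intro x
    induction x with
    | zero => simp
    | tmul b n => simp
    | add x y hx hy => simp only [map_add, hx, hy]
  refine ⟨fun h b => ?_, fun h b => ?_⟩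
  · have := h ((TensorProduct.rid R B).symm b)
    rw [← (TensorProduct.rid R B).injective.eq_iff, key, map_zero,
      LinearEquiv.apply_symm_apply] at this
    rw [this]
    constructor
    · rintro ⟨y, hy⟩
      exact ⟨TensorProduct.rid R B y, by rw [← key, hy, LinearEquiv.apply_symm_apply]⟩
    · rintro ⟨y, rfl⟩
      exact ⟨(TensorProduct.rid R B).symm y, (TensorProduct.rid R B).injective (by simp)⟩
  · rw [← (TensorProduct.rid R B).injective.eq_iff, key, map_zero, h]
    constructor
    · rintro ⟨y, hy⟩
      exact ⟨(TensorProduct.rid R B).symm y, (TensorProduct.rid R B).injective (by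
        simp [hy])⟩
    · rintro ⟨y, rfl⟩
      exact ⟨TensorProduct.rid R B y, by rw [← key]⟩

theorem HE_character_self_iff (d : B →ₗ[R] B) (hd : d ∘ₗ d = 0) :
    HE d (CharacterModule R) ↔ Exact d d := by
  rw [HE_character_iff d hd, rTensor_self_exact_iff]

end Factor

theorem HE.of_injective {B X : Type u} [AddCommGroup B] [Module R B] [AddCommGroup X] [Module R X]
    [Module.Injective R X] {d : B →ₗ[R] B} (hd : Exact d d) : HE d X := by
  intro f hf
  obtain ⟨r, hr⟩ := exists_comp_eq_of_surjective d.rangeRestrict d.surjective_rangeRestrict f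
    (fun a ha => by
      obtain ⟨y, rfl⟩ := (hd a).1 (congrArg Subtype.val ha)
      exact LinearMap.congr_fun hf y)
  obtain ⟨g, hg⟩ := Module.Injective.out (LinearMap.range d).subtype Subtype.val_injective r
  refine ⟨g, ?_⟩
  rw [← hr]
  ext c
  exact (hg (d.rangeRestrict c)).symm

/-- Every map from the first term of a short exact sequence ending in `A` to `E` extends to the
middle term: a module-level form of `Ext¹(A, E) = 0`. -/
def E1 (A E : Type u) [AddCommGroup A] [Module R A] [AddCommGroup E] [Module R E] : Prop :=
  ∀ (P : Type u) [AddCommGroup P] [Module R P] (p : P →ₗ[R] A), Surjective p →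
    ∀ f : LinearMap.ker p →ₗ[R] E, ∃ g : P →ₗ[R] E, g ∘ₗ (LinearMap.ker p).subtype = f

section E1

variable {A B E K P X Y Z : Type u} [AddCommGroup A] [Module R A] [AddCommGroup B] [Module R B]
  [AddCommGroup E] [Module R E] [AddCommGroup K] [Module R K] [AddCommGroup P] [Module R P]
  [AddCommGroup X] [Module R X] [AddCommGroup Y] [Module R Y] [AddCommGroup Z] [Module R Z]

theorem E1.extend (h : E1 (R := R) A E) (i : K →ₗ[R] P) (p : P →ₗ[R] A) (hi : Injective i)
    (hip : Exact i p) (hp : Surjective p) (f : K →ₗ[R] E) : ∃ g : P →ₗ[R] E, g ∘ₗ i = f := by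
  obtain ⟨j, hj⟩ := exists_comp_eq_of_injective i hi (LinearMap.ker p).subtype
    (fun x => (hip _).1 x.2)
  obtain ⟨g, hg⟩ := h P p hp (f ∘ₗ j)
  refine ⟨g, LinearMap.ext fun k => ?_⟩
  have h1 := LinearMap.congr_fun hg ⟨i k, (hip _).2 ⟨k, rfl⟩⟩
  have h2 := LinearMap.congr_fun hj ⟨i k, (hip _).2 ⟨k, rfl⟩⟩
  have h3 : j ⟨i k, (hip _).2 ⟨k, rfl⟩⟩ = k := hi h2
  simp only [LinearMap.comp_apply, h3] at h1
  exact h1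

/-- Maps on a presentation of `A` and on the kernel of `q : X → A` glue to a map on `X`. -/
theorem exists_glue (p : P →ₗ[R] A) (hp : Surjective p) (q : X →ₗ[R] A) (l : P →ₗ[R] X)
    (hl : q ∘ₗ l = p) (f : LinearMap.ker q →ₗ[R] E) (g : P →ₗ[R] E)
    (hfg : ∀ (k : P) (hk : p k = 0),
      g k = f ⟨l k, by rw [LinearMap.mem_ker, ← LinearMap.comp_apply, hl, hk]⟩) :
    ∃ h : X →ₗ[R] E, h ∘ₗ (LinearMap.ker q).subtype = f ∧ h ∘ₗ l = g := by
  have hl' : ∀ x, q (l x) = p x := LinearMap.congr_fun hl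
  obtain ⟨h, hh⟩ := exists_comp_eq_of_surjective (l.coprod (LinearMap.ker q).subtype) (fun x => by
    obtain ⟨y, hy⟩ := hp (q x)
    exact ⟨(y, ⟨x - l y, by simp [hl', hy]⟩), by simp⟩) (g.coprod f) (by
    rintro ⟨y, k⟩ hy
    simp only [LinearMap.coprod_apply, Submodule.subtype_apply] at hy ⊢
    have hy' : p y = 0 := by
      have := congrArg q hy
      simpa [hl'] using this
    rw [hfg y hy', ← map_add]
    convert map_zero f
    exact Subtype.ext hy)
  refine ⟨h, ?_, ?_⟩
  · ext k
    simpa using LinearMap.congr_fun hh (0, k)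
  · ext k
    simpa using LinearMap.congr_fun hh (k, 0)

theorem E1.of_presentation [Module.Projective R P] (p : P →ₗ[R] A) (hp : Surjective p)
    (h : ∀ f : LinearMap.ker p →ₗ[R] E, ∃ g : P →ₗ[R] E, g ∘ₗ (LinearMap.ker p).subtype = f) :
    E1 (R := R) A E := by
  intro X _ _ q hq f
  obtain ⟨l, hl⟩ := Module.projective_lifting_property q p hq
  have hl' : ∀ x, q (l x) = p x := LinearMap.congr_fun hl
  obtain ⟨g, hg⟩ := h (f ∘ₗ (l.restrict (p := LinearMap.ker p) (q := LinearMap.ker q)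
    (fun x hx => by simpa [hl'] using hx)))
  obtain ⟨k, hk, -⟩ := exists_glue p hp q l hl f g (fun k hk => LinearMap.congr_fun hg ⟨k, hk⟩)
  exact ⟨k, hk⟩

theorem E1.lift (h : E1 (R := R) A E) (i : E →ₗ[R] X) (q : X →ₗ[R] B) (hi : Injective i)
    (hiq : Exact i q) (hq : Surjective q) (f : A →ₗ[R] B) : ∃ g : A →ₗ[R] X, q ∘ₗ g = f := by
  let T := LinearMap.ker (f.coprod (-q))
  have hT : ∀ t : T, f t.1.1 = q t.1.2 := fun t => add_neg_eq_zero.1 t.2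
  have hqi : ∀ e, q (i e) = 0 := fun e => (hiq _).2 ⟨e, rfl⟩
  obtain ⟨r, hr⟩ := h.extend
    ((LinearMap.inr R A X ∘ₗ i).codRestrict T (fun e => by simp [T, hqi]))
    (LinearMap.fst R A X ∘ₗ T.subtype)
    (fun e e' he => hi (congrArg (fun t : T => t.1.2) he))
    (fun t => by
      constructor
      · intro ht
        obtain ⟨e, he⟩ := (hiq t.1.2).1 (by rw [← hT]; simpa using congrArg f ht)
        exact ⟨e, Subtype.ext (Prod.ext (Eq.symm ht) he)⟩
      · rintro ⟨e, rfl⟩; rfl)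
    (fun a => by
      obtain ⟨x, hx⟩ := hq (f a)
      exact ⟨⟨(a, x), by simp [T, hx]⟩, rfl⟩) LinearMap.id
  obtain ⟨g, hg⟩ := exists_comp_eq_of_surjective (LinearMap.fst R A X ∘ₗ T.subtype)
    (fun a => by
      obtain ⟨x, hx⟩ := hq (f a)
      exact ⟨⟨(a, x), by simp [T, hx]⟩, rfl⟩)
    (LinearMap.snd R A X ∘ₗ T.subtype - i ∘ₗ r) (fun t ht => by
      obtain ⟨e, he⟩ := (hiq t.1.2).1 (by rw [← hT]; simpa using congrArg f ht)
      have ht' : t = ((LinearMap.inr R A X ∘ₗ i).codRestrict T (fun e => by simp [T, hqi])) e :=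
        Subtype.ext (Prod.ext ht he.symm)
      have := LinearMap.congr_fun hr e
      simp only [LinearMap.comp_apply, ← ht', LinearMap.id_apply] at this
      simp [this, he])
  refine ⟨g, LinearMap.ext fun a => ?_⟩
  obtain ⟨x, hx⟩ := hq (f a)
  have := LinearMap.congr_fun hg ⟨(a, x), by simp [T, hx]⟩
  simp only [LinearMap.comp_apply] at this
  change g a = x - i _ at this
  rw [LinearMap.comp_apply, this, map_sub, hqi, sub_zero, hx]

theorem E1.congr_left (h : E1 (R := R) A E) (e : A ≃ₗ[R] B) : E1 (R := R) B E := by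
  intro P _ _ p hp f
  exact h.extend (LinearMap.ker p).subtype (e.symm.toLinearMap ∘ₗ p) Subtype.val_injective
    (fun x => by simp) (e.symm.surjective.comp hp) f

theorem E1.of_retract_right (h : E1 (R := R) A Y) (i : X →ₗ[R] Y) (r : Y →ₗ[R] X)
    (hr : r ∘ₗ i = LinearMap.id) : E1 (R := R) A X := by
  intro P _ _ p hp f
  obtain ⟨g, hg⟩ := h P p hp (i ∘ₗ f)
  refine ⟨r ∘ₗ g, ?_⟩
  rw [LinearMap.comp_assoc, hg, ← LinearMap.comp_assoc, hr, LinearMap.id_comp]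

theorem E1_iff_HE [Module.Projective R B] {d : B →ₗ[R] B} (hd : Exact d d) (p : B →ₗ[R] A)
    (hp : Surjective p) (hdp : Exact d p) : E1 (R := R) A E ↔ HE d E := by
  constructor
  · intro h f hf
    obtain ⟨r, hr⟩ := exists_comp_eq_of_surjective d.rangeRestrict d.surjective_rangeRestrict f
      (fun a ha => by
        obtain ⟨y, rfl⟩ := (hd a).1 (congrArg Subtype.val ha)
        exact LinearMap.congr_fun hf y)
    obtain ⟨g, hg⟩ := h.extend (LinearMap.range d).subtype p Subtype.val_injective
      (fun x => by rw [hdp x]; simp) hp r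
    refine ⟨g, ?_⟩
    rw [← hr, ← hg]
    rfl
  · intro h
    refine E1.of_presentation p hp fun f => ?_
    let d' : B →ₗ[R] LinearMap.ker p := d.codRestrict _ (fun x => (hdp _).2 ⟨x, rfl⟩)
    obtain ⟨g, hg⟩ := h (f ∘ₗ d') (by
      ext x
      have : d' (d x) = 0 := Subtype.ext ((hd _).2 ⟨x, rfl⟩)
      simp [this])
    refine ⟨g, LinearMap.ext fun x => ?_⟩
    obtain ⟨y, hy⟩ := (hdp _).1 x.2
    obtain rfl : d' y = x := Subtype.ext hy
    exact (LinearMap.congr_fun hg y).symm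

end E1

end GorensteinPure

namespace GorensteinPure

open Function

theorem E1_iff_of_exact {A E X₀ X₁ X₂ : Type u} [AddCommGroup A] [Module R A] [AddCommGroup E]
    [Module R E] [AddCommGroup X₀] [Module R X₀] [AddCommGroup X₁] [Module R X₁] [AddCommGroup X₂]
    [Module R X₂] [Module.Projective R X₀] (d₂ : X₂ →ₗ[R] X₁) (d₁ : X₁ →ₗ[R] X₀)
    (p : X₀ →ₗ[R] A) (h₂ : Exact d₂ d₁) (h₁ : Exact d₁ p) (hp : Surjective p) :
    E1 (R := R) A E ↔ ∀ f : X₁ →ₗ[R] E, f ∘ₗ d₂ = 0 → ∃ g : X₀ →ₗ[R] E, f = g ∘ₗ d₁ := by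
  constructor
  · intro h f hf
    obtain ⟨r, hr⟩ := exists_comp_eq_of_surjective d₁.rangeRestrict d₁.surjective_rangeRestrict f
      (fun a ha => by
        obtain ⟨y, rfl⟩ := (h₂ a).1 (congrArg Subtype.val ha)
        exact LinearMap.congr_fun hf y)
    obtain ⟨g, hg⟩ := h.extend (LinearMap.range d₁).subtype p Subtype.val_injective
      (fun x => by rw [h₁ x]; simp) hp r
    refine ⟨g, ?_⟩
    rw [← hr, ← hg]
    rfl
  · intro h
    refine E1.of_presentation p hp fun f => ?_
    let d' : X₁ →ₗ[R] LinearMap.ker p := d₁.codRestrict _ (fun x => (h₁ _).2 ⟨x, rfl⟩)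
    obtain ⟨g, hg⟩ := h (f ∘ₗ d') (by
      ext x
      have : d' (d₂ x) = 0 := Subtype.ext ((h₂ _).2 ⟨x, rfl⟩)
      simp [this])
    refine ⟨g, LinearMap.ext fun x => ?_⟩
    obtain ⟨y, hy⟩ := (h₁ _).1 x.2
    obtain rfl : d' y = x := Subtype.ext hy
    exact (LinearMap.congr_fun hg y).symm

theorem extVanish_one_iff (A E : ModuleCat.{u} R) : extVanish 1 A E ↔ E1 (R := R) A E := by
  let P := projectiveResolution A
  have hproj : Module.Projective R (P.complex.X 0) :=
    (IsProjective.iff_projective (P := P.complex.X 0)).2 (P.projective 0)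
  let p : P.complex.X 0 →ₗ[R] A := (P.π.f 0).hom
  rw [E1_iff_of_exact (P.complex.d 2 1).hom (P.complex.d 1 0).hom p
    ((ShortComplex.ShortExact.moduleCat_exact_iff_function_exact _).1 (P.exact_succ 0))
    ((ShortComplex.ShortExact.moduleCat_exact_iff_function_exact _).1 P.exact₀)
    ((ModuleCat.epi_iff_surjective _).1 inferInstance)]
  rw [extVanish, ← ModuleCat.isZero_iff_subsingleton, (P.isoExt 1 E).isZero_iff,
    ← HomologicalComplex.exactAt_iff_isZero_homology,
    HomologicalComplex.exactAt_iff' _ 0 1 2 (by simp) (by simp), ShortComplex.moduleCat_exact_iff]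
  constructor
  · intro h f hf
    obtain ⟨g, hg⟩ := h (ModuleCat.ofHom f) (ModuleCat.hom_ext hf)
    exact ⟨ModuleCat.Hom.hom g, (congrArg ModuleCat.Hom.hom hg).symm⟩
  · intro h f hf
    obtain ⟨g, hg⟩ := h (ModuleCat.Hom.hom f) (congrArg ModuleCat.Hom.hom hf)
    exact ⟨ModuleCat.ofHom g, ModuleCat.hom_ext hg.symm⟩

section Total

variable (K : ChainComplex (ModuleCat.{u} R) ℤ)

/-- The total module of a complex. -/
abbrev Tot : Type u := DirectSum ℤ fun i => K.X i

/-- The differential of the total module of a complex. -/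
noncomputable def totD : Tot K →ₗ[R] Tot K :=
  DirectSum.toModule R ℤ _ fun i => DirectSum.lof R ℤ (fun i => K.X i) (i - 1) ∘ₗ (K.d i (i - 1)).hom

theorem totD_lof (i j : ℤ) (h : j + 1 = i) (x : K.X i) :
    totD K (DirectSum.lof R ℤ (fun i => K.X i) i x) =
      DirectSum.lof R ℤ (fun i => K.X i) j (K.d i j x) := by
  obtain rfl : j = i - 1 := by omega
  simp [totD]

theorem totD_apply (x : Tot K) (i : ℤ) : totD K x i = K.d (i + 1) i (x (i + 1)) := by
  have : DirectSum.component R ℤ (fun i => K.X i) i ∘ₗ totD K =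
      (K.d (i + 1) i).hom ∘ₗ DirectSum.component R ℤ (fun i => K.X i) (i + 1) := by
    refine DirectSum.linearMap_ext (R := R) (fun k => ?_)
    ext x
    simp only [LinearMap.comp_apply]
    rw [totD_lof K k (k - 1) (by omega)]
    by_cases hk : k = i + 1
    · subst hk
      have : ∀ j, j = i → DirectSum.component R ℤ (fun i => K.X i) i
          (DirectSum.lof R ℤ (fun i => K.X i) j (K.d (i + 1) j x)) = K.d (i + 1) i x := by
        rintro j rfl
        rw [DirectSum.component.lof_self]
      rw [this _ (by omega), DirectSum.component.lof_self]
    · rw [DirectSum.component.of, DirectSum.component.of, dif_neg (by omega), dif_neg hk, map_zero]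
  exact LinearMap.congr_fun this x

theorem totD_comp : totD K ∘ₗ totD K = 0 := by
  refine LinearMap.ext fun x => DFinsupp.ext fun i => ?_
  rw [LinearMap.comp_apply, totD_apply, totD_apply, ← ModuleCat.comp_apply, K.d_comp_d]
  rfl

theorem HE_totD_iff (X : Type*) [AddCommGroup X] [Module R X] :
    HE (totD K) X ↔ ∀ (i : ℤ) (f : K.X i →ₗ[R] X), f ∘ₗ (K.d (i + 1) i).hom = 0 →
      ∃ g : K.X (i - 1) →ₗ[R] X, f = g ∘ₗ (K.d i (i - 1)).hom := by
  constructor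
  · intro h i f hf
    obtain ⟨G, hG⟩ := h (f ∘ₗ DirectSum.component R ℤ (fun i => K.X i) i)
      (LinearMap.ext fun x => by
        have := LinearMap.congr_fun hf (x (i + 1))
        change f (totD K x i) = 0
        rw [totD_apply]
        exact this)
    refine ⟨G ∘ₗ DirectSum.lof R ℤ (fun i => K.X i) (i - 1), LinearMap.ext fun x => ?_⟩
    have := LinearMap.congr_fun hG (DirectSum.lof R ℤ (fun i => K.X i) i x)
    simp only [LinearMap.comp_apply, DirectSum.component.lof_self] at this
    rw [this, totD_lof K i (i - 1) (by omega)]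
    rfl
  · intro h F hF
    have key : ∀ j, ∃ g : K.X j →ₗ[R] X,
        F ∘ₗ DirectSum.lof R ℤ (fun i => K.X i) (j + 1) = g ∘ₗ (K.d (j + 1) j).hom := by
      have : ∀ i j, j + 1 = i → ∃ g : K.X j →ₗ[R] X,
          F ∘ₗ DirectSum.lof R ℤ (fun i => K.X i) i = g ∘ₗ (K.d i j).hom := by
        intro i j hij
        obtain rfl : j = i - 1 := by omega
        refine h i _ (LinearMap.ext fun x => ?_)
        have := LinearMap.congr_fun hF (DirectSum.lof R ℤ (fun i => K.X i) (i + 1) x)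
        rw [LinearMap.comp_apply, totD_lof K (i + 1) i rfl] at this
        exact this
      exact fun j => this _ j rfl
    choose g hg using key
    refine ⟨DirectSum.toModule R ℤ _ g, DirectSum.linearMap_ext (R := R) fun i => ?_⟩
    obtain ⟨j, rfl⟩ : ∃ j, j + 1 = i := ⟨i - 1, by omega⟩
    rw [hg j]
    ext x
    rw [LinearMap.comp_apply, LinearMap.comp_apply, LinearMap.comp_apply, totD_lof K (j + 1) j rfl,
      DirectSum.toModule_lof]

theorem exactAt_iff (i : ℤ) :
    K.ExactAt i ↔ Exact (K.d (i + 1) i).hom (K.d i (i - 1)).hom := by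
  rw [HomologicalComplex.exactAt_iff' K (i + 1) i (i - 1) (by simp) (by simp),
    ShortComplex.ShortExact.moduleCat_exact_iff_function_exact]
  rfl

theorem exact_of_exactAt {j : ℤ} (h : K.ExactAt j) (i k : ℤ) (hi : j + 1 = i) (hk : k + 1 = j) :
    Exact (K.d i j).hom (K.d j k).hom := by
  obtain rfl : k = j - 1 := by omega
  subst hi
  exact (exactAt_iff K j).1 h

variable {K} in
theorem HE.graded {X : Type*} [AddCommGroup X] [Module R X] (h : HE (totD K) X) (i j : ℤ)
    (hij : j + 1 = i) (f : K.X i →ₗ[R] X) (hf : f ∘ₗ (K.d (i + 1) i).hom = 0) :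
    ∃ g : K.X j →ₗ[R] X, f = g ∘ₗ (K.d i j).hom := by
  obtain rfl : j = i - 1 := by omega
  exact (HE_totD_iff K X).1 h i f hf

theorem exact_totD (h : ∀ i, K.ExactAt i) : Exact (totD K) (totD K) := by
  have hi : Module.Injective R (CharacterModule R) :=
    (Module.Flat.iff_characterModule_injective (R := R) (M := R)).1 inferInstance
  rw [← HE_character_self_iff _ (totD_comp K), HE_totD_iff]
  intro i f hf
  obtain ⟨r, hr⟩ := exists_comp_eq_of_surjective (K.d i (i - 1)).hom.rangeRestrict
    (K.d i (i - 1)).hom.surjective_rangeRestrict f (fun a ha => by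
      obtain ⟨y, rfl⟩ := ((exactAt_iff K i).1 (h i) a).1 (congrArg Subtype.val ha)
      exact LinearMap.congr_fun hf y)
  obtain ⟨g, hg⟩ := Module.Injective.out (LinearMap.range (K.d i (i - 1)).hom).subtype
    Subtype.val_injective r
  refine ⟨g, ?_⟩
  rw [← hr]
  refine LinearMap.ext fun c => ?_
  exact (hg ((K.d i (i - 1)).hom.rangeRestrict c)).symm

end Total

/-- A totally acyclic periodic complex of projective modules. -/
structure TA {C : Type u} [AddCommGroup C] [Module R C] (d : C →ₗ[R] C) : Prop where
  projective : Module.Projective R C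
  exact : Exact d d
  he : ∀ (P : Type u) [AddCommGroup P] [Module R P] [Module.Projective R P], HE d P

section Bridge

theorem isGorensteinProjective_of_totD (K : ChainComplex (ModuleCat.{u} R) ℤ)
    (hK : ∀ i, Projective (K.X i)) (he : ∀ i, K.ExactAt i)
    (hP : ∀ (P : Type u) [AddCommGroup P] [Module R P] [Module.Projective R P], HE (totD K) P)
    (Q : ModuleCat.{u} R) (e : Q ≅ cokernel (K.d 1 0)) : IsGorensteinProjective Q := by
  refine ⟨K, hK, he, ⟨e⟩, fun P hPP i f hf => ?_⟩
  have := (IsProjective.iff_projective (P := P)).2 hPP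
  obtain ⟨g, hg⟩ := (HE_totD_iff K P).1 (hP P) i f.hom (congrArg ModuleCat.Hom.hom hf)
  exact ⟨ModuleCat.ofHom g, ModuleCat.hom_ext hg⟩

theorem exists_totD_of_isGorensteinProjective {Q : ModuleCat.{u} R}
    (hQ : IsGorensteinProjective Q) :
    ∃ K : ChainComplex (ModuleCat.{u} R) ℤ, TA (totD K) ∧ ∃ p : K.X 0 →ₗ[R] Q,
      Surjective p ∧ Exact (K.d 1 0).hom p ∧ (∀ i, Module.Projective R (K.X i)) ∧
      ∀ i, K.ExactAt i := by
  obtain ⟨K, hK, he, ⟨e⟩, hP⟩ := hQ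
  have hK' : ∀ i, Module.Projective R (K.X i) := fun i =>
    (IsProjective.iff_projective (P := K.X i)).2 (hK i)
  refine ⟨K, ⟨inferInstance, exact_totD K he, fun P _ _ _ => ?_⟩,
    (cokernel.π (K.d 1 0) ≫ e.inv).hom, ?_, ?_, hK', he⟩
  · rw [HE_totD_iff]
    intro i f hf
    obtain ⟨g, hg⟩ := hP (ModuleCat.of R P) ((IsProjective.iff_projective (P := P)).1 ‹_›) i
      (ModuleCat.ofHom f) (ModuleCat.hom_ext hf)
    exact ⟨g.hom, congrArg ModuleCat.Hom.hom hg⟩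
  · exact (ModuleCat.epi_iff_surjective _).1 inferInstance
  · have h1 := (ShortComplex.ShortExact.moduleCat_exact_iff_function_exact _).1
      (ShortComplex.exact_cokernel (K.d 1 0))
    intro x
    have h2 : Injective e.inv.hom := (ModuleCat.mono_iff_injective _).1 inferInstance
    rw [← h1 x, ModuleCat.hom_comp, LinearMap.comp_apply, map_eq_zero_iff _ h2]

theorem E1_of_HE_totD {Q : Type u} [AddCommGroup Q] [Module R Q]
    {K : ChainComplex (ModuleCat.{u} R) ℤ} (hK : Module.Projective R (K.X 0))
    (he : ∀ i, K.ExactAt i) (p : K.X 0 →ₗ[R] Q) (hp : Surjective p)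
    (hdp : Exact (K.d 1 0).hom p) {X : Type u} [AddCommGroup X] [Module R X]
    (h : HE (totD K) X) : E1 (R := R) Q X := by
  rw [E1_iff_of_exact (K.d 2 1).hom (K.d 1 0).hom p (exact_of_exactAt K (he 1) 2 0 rfl rfl) hdp hp]
  exact h.graded 1 0 rfl

variable {C : Type u} [AddCommGroup C] [Module R C]

/-- The constant complex on a periodic complex. -/
noncomputable def constComplex (d : C →ₗ[R] C) (hd : d ∘ₗ d = 0) :
    ChainComplex (ModuleCat.{u} R) ℤ :=
  ChainComplex.of (fun _ => ModuleCat.of R C) (fun _ => ModuleCat.ofHom d)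
    (fun _ => ModuleCat.hom_ext hd)

theorem constComplex_d (d : C →ₗ[R] C) (hd : d ∘ₗ d = 0) (i j : ℤ) (h : j + 1 = i) :
    (constComplex d hd).d i j = ModuleCat.ofHom d := by
  subst h
  exact ChainComplex.of_d (fun _ => ModuleCat.of R C) (fun _ => ModuleCat.ofHom d) j

theorem TA.isGorensteinProjective {d : C →ₗ[R] C} (h : TA d) (Q : ModuleCat.{u} R)
    (p : C →ₗ[R] Q) (hp : Surjective p) (hdp : Exact d p) : IsGorensteinProjective Q := by
  have hd := h.exact.linearMap_comp_eq_zero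
  have := h.projective
  refine isGorensteinProjective_of_totD (constComplex d hd)
    (fun i => (IsProjective.iff_projective (P := C)).1 this) (fun i => ?_) (fun P _ _ _ => ?_) Q ?_
  · rw [exactAt_iff, constComplex_d d hd _ _ rfl, constComplex_d d hd _ _ (by omega)]
    exact h.exact
  · rw [HE_totD_iff]
    intro i f hf
    rw [constComplex_d d hd _ _ rfl] at hf
    obtain ⟨g, hg⟩ := h.he P f hf
    refine ⟨g, ?_⟩
    rw [constComplex_d d hd _ _ (by omega)]
    exact hg
  · rw [constComplex_d d hd 1 0 rfl]
    let S : ShortComplex (ModuleCat.{u} R) := ShortComplex.mk (ModuleCat.ofHom d)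
      (ModuleCat.ofHom p) (ModuleCat.hom_ext hdp.linearMap_comp_eq_zero)
    have hS : S.Exact := (ShortComplex.ShortExact.moduleCat_exact_iff_function_exact _).2 hdp
    have : Epi S.g := (ModuleCat.epi_iff_surjective _).2 hp
    exact hS.gIsCokernel.coconePointUniqueUpToIso (colimit.isColimit _)

theorem memGPperp_iff (M : ModuleCat.{u} R) : MemGPperp M ↔
    ∀ (C : Type u) [AddCommGroup C] [Module R C] (d : C →ₗ[R] C), TA d → HE d M := by
  constructor
  · intro h C _ _ d hd
    have hQ := hd.isGorensteinProjective (ModuleCat.of R (C ⧸ LinearMap.range d))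
      (LinearMap.range d).mkQ (Submodule.mkQ_surjective _) (fun x => by simp)
    have := hd.projective
    have := (extVanish_one_iff _ _).1 (h _ hQ)
    exact (E1_iff_HE hd.exact (LinearMap.range d).mkQ (Submodule.mkQ_surjective _)
      (fun x => by simp)).1 this
  · intro h Q hQ
    obtain ⟨K, hK, p, hp, hdp, hproj, he⟩ := exists_totD_of_isGorensteinProjective hQ
    exact (extVanish_one_iff _ _).2 (E1_of_HE_totD (hproj 0) he p hp hdp (h _ _ hK))

end Bridge

end GorensteinPure

namespace GorensteinPure

open Function Cardinal

section Closure

variable {B : Type u} (c : Finset B → Set B)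

/-- Closedness of a subset under a finitary set-valued operation. -/
def ClosedUnder (X : Set B) : Prop := ∀ s : Finset B, ↑s ⊆ X → c s ⊆ X

/-- The smallest closed subset containing a given one. -/
def clos (X : Set B) : Set B := ⋂₀ {Y | X ⊆ Y ∧ ClosedUnder c Y}

variable {c}

theorem subset_clos (X : Set B) : X ⊆ clos c X := fun _ hx _ hY => hY.1 hx

theorem closedUnder_clos (X : Set B) : ClosedUnder c (clos c X) :=
  fun s hs _ hb Y hY => hY.2 s (fun _ hx => hs hx Y hY) hb

theorem clos_subset {X Y : Set B} (h : X ⊆ Y) (hY : ClosedUnder c Y) : clos c X ⊆ Y :=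
  fun _ hb => hb Y ⟨h, hY⟩

theorem clos_mono {X Y : Set B} (h : X ⊆ Y) : clos c X ⊆ clos c Y :=
  clos_subset (h.trans (subset_clos Y)) (closedUnder_clos Y)

theorem ClosedUnder.sUnion {S : Set (Set B)} (hS : S.Nonempty) (hd : DirectedOn (· ⊆ ·) S)
    (h : ∀ X ∈ S, ClosedUnder c X) : ClosedUnder c (⋃₀ S) := by
  intro s hs
  obtain ⟨X, hX, hsX⟩ : ∃ X ∈ S, ↑s ⊆ X := by
    classical
    induction s using Finset.induction_on with
    | empty => exact ⟨hS.some, hS.some_mem, by simp⟩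
    | insert a s ha ih =>
      rw [Finset.coe_insert, Set.insert_subset_iff] at hs
      obtain ⟨X, hX, hsX⟩ := ih hs.2
      obtain ⟨Y, hY, haY⟩ := hs.1
      obtain ⟨Z, hZ, hXZ, hYZ⟩ := hd X hX Y hY
      exact ⟨Z, hZ, by
        rw [Finset.coe_insert, Set.insert_subset_iff]
        exact ⟨hYZ haY, hsX.trans hXZ⟩⟩
  exact (h X hX s hsX).trans (Set.subset_sUnion_of_mem hX)

theorem mk_finset_le_max (Y : Type u) : #(Finset Y) ≤ max #Y ℵ₀ := by
  cases finite_or_infinite Y with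
  | inl h => exact le_max_of_le_right mk_le_aleph0
  | inr h => rw [mk_finset_of_infinite]; exact le_max_left _ _

theorem mk_clos_le {κ : Cardinal.{u}} (hκ : ℵ₀ ≤ κ) (hc : ∀ s, #(c s) ≤ κ) (X : Set B) :
    #(clos c X) ≤ max #X κ := by
  set μ := max #X κ
  have hμ : ℵ₀ ≤ μ := hκ.trans (le_max_right _ _)
  let step : Set B → Set B := fun Y => Y ∪ ⋃ s : Finset Y, c (s.map (Embedding.subtype _))
  have hstep : ∀ Y : Set B, #Y ≤ μ → #(step Y) ≤ μ := by
    intro Y hY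
    refine (mk_union_le _ _).trans (add_le_of_le hμ hY ((mk_iUnion_le _).trans ?_))
    refine mul_le_of_le hμ ((mk_finset_le_max Y).trans (max_le hY hμ)) ?_
    exact ciSup_le' fun s => (hc _).trans (le_max_right _ _)
  have hit : ∀ n : ℕ, #(step^[n] X) ≤ μ := by
    intro n
    induction n with
    | zero => exact le_max_left _ _
    | succ n ih => rw [iterate_succ_apply']; exact hstep _ ih
  have hmono : Monotone fun n => step^[n] X :=
    monotone_nat_of_le_succ fun n => by
      rw [iterate_succ_apply']; exact Set.subset_union_left
  have hcl : ClosedUnder c (⋃ n, step^[n] X) := by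
    classical
    intro s hs
    obtain ⟨n, hn⟩ := hmono.directed_le.exists_mem_subset_of_finset_subset_biUnion hs
    refine Set.Subset.trans ?_ (Set.subset_iUnion _ (n + 1))
    rw [iterate_succ_apply']
    refine Set.Subset.trans ?_ Set.subset_union_right
    have : c s ⊆ c ((s.subtype (· ∈ step^[n] X)).map (Embedding.subtype _)) := by
      rw [Finset.subtype_map_of_mem (fun x hx => hn hx)]
    exact this.trans (Set.subset_iUnion (fun s : Finset (step^[n] X) =>
      c (s.map (Embedding.subtype _))) _)
  refine (mk_le_mk_of_subset (clos_subset (Set.subset_iUnion (fun n => step^[n] X) 0) hcl)).trans ?_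
  rw [← Equiv.ulift.{u}.surjective.iUnion_comp]
  refine (mk_iUnion_le _).trans (mul_le_of_le hμ ?_ (ciSup_le' fun n => hit _))
  exact mk_le_aleph0.trans hμ

/-- Every set closed under some operation with small values satisfies `p`. -/
def AdmitsClosure (κ : Cardinal.{u}) (p : Set B → Prop) : Prop :=
  ∃ c : Finset B → Set B, (∀ s, #(c s) ≤ κ) ∧ ∀ X, ClosedUnder c X → p X

theorem AdmitsClosure.forall {κ : Cardinal.{u}} (hκ : ℵ₀ ≤ κ) {ι : Type u} (hι : #ι ≤ κ)
    {p : ι → Set B → Prop} (h : ∀ i, AdmitsClosure κ (p i)) :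
    AdmitsClosure κ fun X => ∀ i, p i X := by
  choose c hc h using h
  refine ⟨fun s => ⋃ i, c i s, fun s => (mk_iUnion_le _).trans (mul_le_of_le hκ hι
    (ciSup_le' fun i => hc i s)), fun X hX i => h i X fun s hs =>
    (Set.subset_iUnion (fun i => c i s) i).trans (hX s hs)⟩

theorem AdmitsClosure.and {κ : Cardinal.{u}} (hκ : ℵ₀ ≤ κ) {p q : Set B → Prop}
    (hp : AdmitsClosure κ p) (hq : AdmitsClosure κ q) : AdmitsClosure κ fun X => p X ∧ q X := by
  obtain ⟨c, hc, h⟩ := hp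
  obtain ⟨c', hc', h'⟩ := hq
  refine ⟨fun s => c s ∪ c' s, fun s => (mk_union_le _ _).trans (add_le_of_le hκ (hc s) (hc' s)),
    fun X hX => ⟨h X fun s hs => Set.subset_union_left.trans (hX s hs),
      h' X fun s hs => Set.subset_union_right.trans (hX s hs)⟩⟩

theorem AdmitsClosure.mono {κ : Cardinal.{u}} {p q : Set B → Prop}
    (hp : AdmitsClosure κ p) (h : ∀ X, p X → q X) : AdmitsClosure κ q := by
  obtain ⟨c, hc, h'⟩ := hp
  exact ⟨c, hc, fun X hX => h X (h' X hX)⟩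

end Closure

section Chain

variable {B P Y : Type u} [AddCommGroup P] [Module R P] [AddCommGroup Y] [Module R Y]

/-- Transfinite construction of a linear map along a filtration indexed by closed subsets. -/
theorem exists_linearPMap_of_chain {κ : Cardinal.{u}} (hκ : ℵ₀ ≤ κ) (hB : κ < #B)
    (c : Finset B → Set B) (hc : ∀ s, #(c s) ≤ κ) (D : Set B → Submodule R P) (hD : Monotone D)
    (hDuniv : D Set.univ = ⊤)
    (hDcont : ∀ S : Set (Set B), S.Nonempty → DirectedOn (· ⊆ ·) S →
      ∀ x ∈ D (⋃₀ S), ∃ X ∈ S, x ∈ D X)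
    (Good : (P →ₗ.[R] Y) → Prop)
    (hGood : ∀ (S : Set (P →ₗ.[R] Y)) (hS : DirectedOn (· ≤ ·) S), S.Nonempty →
      (∀ p ∈ S, Good p) → Good (LinearPMap.sSup S hS))
    (base : ∀ X, ClosedUnder c X → #X < #B → ∃ p, Good p ∧ p.domain = D X)
    (step : ∀ X X', ClosedUnder c X → ClosedUnder c X' → X ⊆ X' → #X' < #B →
      ∀ p, Good p → p.domain = D X → ∃ p', Good p' ∧ p ≤ p' ∧ p'.domain = D X') :
    ∃ p : P →ₗ.[R] Y, Good p ∧ p.domain = ⊤ := by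
  obtain ⟨_, _, hord⟩ := exists_ord_eq_type_lt B
  have hsmall : ∀ b : B, #(clos c (Set.Iic b)) < #B := by
    intro b
    refine (mk_clos_le hκ hc _).trans_lt (max_lt ?_ hB)
    have h1 : #(Set.Iio b) < #B := mk_Iio_lt b hord
    rw [← Set.Iio_insert]
    exact (mk_insert_le).trans_lt (add_lt_of_lt (hκ.trans hB.le) h1
      (one_lt_aleph0.trans_le (hκ.trans hB.le)))
  let T : Set (P →ₗ.[R] Y) := {p | Good p ∧ ∃ I : LowerSet B, p.domain = D (clos c I)}
  have hT0 : T.Nonempty := by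
    obtain ⟨p, hp, hp'⟩ := base (clos c ∅) (closedUnder_clos _)
      (((mk_clos_le hκ hc _).trans (by simp)).trans_lt hB)
    exact ⟨p, hp, ⊥, by simpa using hp'⟩
  obtain ⟨p₀, hp₀⟩ := hT0
  have hdir : ∀ J : Set (LowerSet B), DirectedOn (· ⊆ ·) ((fun I : LowerSet B => clos c I) '' J) := by
    rintro J _ ⟨I, hI, rfl⟩ _ ⟨I', hI', rfl⟩
    rcases le_total I I' with h | h
    · exact ⟨_, ⟨I', hI', rfl⟩, clos_mono h, subset_rfl⟩
    · exact ⟨_, ⟨I, hI, rfl⟩, subset_rfl, clos_mono h⟩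
  have hsup : ∀ J : Set (LowerSet B), J.Nonempty →
      D (clos c (⋃ I ∈ J, (I : Set B))) ≤ ⨆ I ∈ J, D (clos c (I : Set B)) := by
    intro J hJ x hx
    have h1 : clos c (⋃ I ∈ J, (I : Set B)) ⊆ ⋃₀ ((fun I : LowerSet B => clos c I) '' J) :=
      clos_subset (Set.iUnion₂_subset fun I hI => (subset_clos _).trans
        (Set.subset_sUnion_of_mem ⟨I, hI, rfl⟩))
        (ClosedUnder.sUnion (hJ.image _) (hdir J) (by
          rintro _ ⟨I, -, rfl⟩; exact closedUnder_clos _))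
    obtain ⟨_, ⟨I, hI, rfl⟩, hx'⟩ := hDcont _ (hJ.image _) (hdir J) x (hD h1 hx)
    exact Submodule.mem_iSup_of_mem I (Submodule.mem_iSup_of_mem hI hx')
  obtain ⟨p, -, hpmax⟩ := zorn_le_nonempty₀ T (by
    intro S hST hS q hq
    have hSd : DirectedOn (· ≤ ·) S := hS.directedOn
    refine ⟨LinearPMap.sSup S hSd, ⟨hGood S hSd ⟨q, hq⟩ fun p hp => (hST hp).1, ?_⟩,
      fun p hp => LinearPMap.le_sSup hSd hp⟩
    let J : Set (LowerSet B) := {I | ∃ p ∈ S, p.domain = D (clos c I)}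
    refine ⟨⨆ I ∈ J, I, ?_⟩
    rw [LinearPMap.domain_sSup]
    apply le_antisymm
    · refine sSup_le ?_
      rintro _ ⟨p, hp, rfl⟩
      obtain ⟨I, hI⟩ := (hST hp).2
      rw [hI]
      exact hD (clos_mono (LowerSet.coe_subset_coe.2 (le_iSup₂_of_le I ⟨p, hp, hI⟩ le_rfl)))
    · obtain ⟨I, hI⟩ := (hST hq).2
      have := hsup J ⟨I, q, hq, hI⟩
      simp only [LowerSet.coe_iSup]
      refine this.trans (iSup₂_le ?_)
      rintro I ⟨p, hp, hI⟩
      rw [← hI]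
      exact le_sSup ⟨p, hp, rfl⟩) p₀ hp₀
  refine ⟨p, hpmax.prop.1, ?_⟩
  let J : Set (LowerSet B) := {I | p.domain = D (clos c I)}
  have hJ : J.Nonempty := hpmax.prop.2
  have hpJ : p.domain = D (clos c (⋃ I ∈ J, (I : Set B))) := by
    apply le_antisymm
    · obtain ⟨I, hI⟩ := hJ
      rw [show p.domain = _ from hI]
      exact hD (clos_mono (Set.subset_iUnion₂_of_subset I hI subset_rfl))
    · refine (hsup J hJ).trans (iSup₂_le ?_)
      rintro I hI
      rw [show p.domain = _ from hI]
  by_cases hu : ∀ b, b ∈ ⋃ I ∈ J, (I : Set B)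
  · rw [hpJ, ← hDuniv]
    exact le_antisymm (hD (Set.subset_univ _)) (hD fun b _ => subset_clos _ (hu b))
  · exfalso
    push Not at hu
    obtain ⟨b, hb⟩ := hu
    have hsub : (⋃ I ∈ J, (I : Set B)) ⊆ Set.Iic b := by
      intro a ha
      by_contra hab
      simp only [Set.mem_iUnion] at ha
      obtain ⟨I, hI, ha⟩ := ha
      exact hb (Set.mem_iUnion₂.2 ⟨I, hI, I.lower (not_le.1 hab).le ha⟩)
    obtain ⟨p', hp', hpp', hdom⟩ := step _ (clos c (Set.Iic b)) (closedUnder_clos _)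
      (closedUnder_clos _) (clos_mono hsub) (hsmall b) p hpmax.prop.1 hpJ
    have hle : p' ≤ p := hpmax.le_of_ge (y := p') ⟨hp', LowerSet.Iic b, by simpa using hdom⟩ hpp'
    have : p.domain = D (clos c (LowerSet.Iic b : Set B)) := by
      rw [le_antisymm hpp' hle]
      simpa using hdom
    exact hb (Set.mem_iUnion₂.2 ⟨LowerSet.Iic b, this, le_refl b⟩)

end Chain

end GorensteinPure

namespace GorensteinPure

open Function TensorProduct

section Coordinates

variable {B : Type u}

/-- The inclusion of the free submodule on a set of basis elements. -/
noncomputable def incl (X : Set B) : (X →₀ R) →ₗ[R] (B →₀ R) :=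
  Finsupp.lmapDomain R R Subtype.val

/-- The projection onto the free submodule on a set of basis elements. -/
noncomputable def proj (X : Set B) : (B →₀ R) →ₗ[R] (X →₀ R) :=
  Finsupp.lsubtypeDomain X

variable (X : Set B)

theorem proj_incl (v : X →₀ R) : proj X (incl X v) = v := by
  ext x
  exact Finsupp.mapDomain_apply Subtype.val_injective v x

theorem incl_injective : Injective (incl (R := R) X) := LeftInverse.injective (proj_incl X)

theorem incl_mem (v : X →₀ R) : incl X v ∈ Finsupp.supported R R X := by
  classical
  intro b hb
  obtain ⟨x, -, rfl⟩ := Finset.mem_image.1 (Finsupp.mapDomain_support hb)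
  exact x.2

theorem incl_proj {v : B →₀ R} (hv : v ∈ Finsupp.supported R R X) : incl X (proj X v) = v := by
  ext b
  by_cases hb : b ∈ X
  · exact Finsupp.mapDomain_apply Subtype.val_injective _ (⟨b, hb⟩ : X)
  · rw [Finsupp.notMem_support_iff.1 fun h => hb (incl_mem X _ h),
      Finsupp.notMem_support_iff.1 fun h => hb (hv h)]

theorem exists_finset_supported (t : Finset (B →₀ R)) :
    ∃ s : Finset B, ∀ x ∈ t, x ∈ Finsupp.supported R R (s : Set B) := by
  classical
  refine ⟨t.biUnion Finsupp.support, fun x hx b hb => ?_⟩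
  exact Finset.mem_biUnion.2 ⟨x, hx, hb⟩

end Coordinates

/-- The inclusion of `K` admits retractions on finite subsets. -/
def LocSplit {F : Type*} [AddCommGroup F] [Module R F] (K : Submodule R F) : Prop :=
  ∀ t : Finset F, (∀ x ∈ t, x ∈ K) → ∃ h : F →ₗ[R] F, (∀ x, h x ∈ K) ∧ ∀ x ∈ t, h x = x

theorem locSplit_of_flat {B : Type u} (K : Submodule R (B →₀ R)) [Module.Flat R ((B →₀ R) ⧸ K)] :
    LocSplit K := by
  intro t ht
  obtain ⟨s, hs⟩ := exists_finset_supported t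
  let X : Set B := s
  have : Finite X := s.finite_toSet
  let T := Submodule.span R (proj X '' (t : Set (B →₀ R)))
  have hfin : Module.Finite R T := Module.Finite.span_of_finite R (t.finite_toSet.image _)
  have hT : (K.mkQ ∘ₗ incl X) ∘ₗ T.subtype = 0 := by
    refine LinearMap.ext fun y => ?_
    have : T ≤ LinearMap.ker (K.mkQ ∘ₗ incl X) := by
      refine Submodule.span_le.2 ?_
      rintro _ ⟨x, hx, rfl⟩
      simp [incl_proj X (hs x hx), ht x hx]
    exact this y.2
  obtain ⟨k, a, y, hya, haT⟩ := Module.Flat.exists_factorization_of_comp_eq_zero_of_free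
    (K := T) hT
  obtain ⟨l, hl⟩ := Module.projective_lifting_property K.mkQ y K.mkQ_surjective
  refine ⟨(incl X - l ∘ₗ a) ∘ₗ proj X, fun x => ?_, fun x hx => ?_⟩
  · rw [← Submodule.ker_mkQ K, LinearMap.mem_ker]
    have h₁ := LinearMap.congr_fun hya (proj X x)
    have h₂ := LinearMap.congr_fun hl (a (proj X x))
    simp only [LinearMap.comp_apply] at h₁ h₂
    simp only [LinearMap.comp_apply, LinearMap.sub_apply, map_sub, h₁, h₂, sub_self]
  · have : a (proj X x) = 0 :=
      LinearMap.congr_fun haT ⟨proj X x, Submodule.subset_span ⟨x, hx, rfl⟩⟩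
    simp [this, incl_proj X (hs x hx)]

theorem LocSplit.exists_fg {B : Type u} {K : Submodule R (B →₀ R)} (hK : LocSplit K)
    (t : Finset (B →₀ R)) (ht : ∀ x ∈ t, x ∈ K) :
    ∃ h : (B →₀ R) →ₗ[R] (B →₀ R), (∀ x, h x ∈ K) ∧ (∀ x ∈ t, h x = x) ∧
      (LinearMap.range h).FG := by
  obtain ⟨h, hhK, hht⟩ := hK t ht
  obtain ⟨s, hs⟩ := exists_finset_supported t
  have : Finite (s : Set B) := s.finite_toSet
  refine ⟨h ∘ₗ incl (s : Set B) ∘ₗ proj (s : Set B), fun x => hhK _, fun x hx => ?_, ?_⟩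
  · rw [LinearMap.comp_apply, LinearMap.comp_apply, incl_proj _ (hs x hx), hht x hx]
  · rw [← LinearMap.comp_assoc, LinearMap.range_comp_of_range_eq_top _
      (LinearMap.range_eq_top.2 (LeftInverse.surjective (proj_incl _)))]
    exact Module.Finite.iff_fg.1 inferInstance

/-- A linear map out of a free module which sends basis elements into a submodule. -/
theorem apply_mem_of_single {B M : Type*} [AddCommGroup M] [Module R M] (f : (B →₀ R) →ₗ[R] M)
    (K : Submodule R M) (h : ∀ b, f (Finsupp.single b 1) ∈ K) (v : B →₀ R) : f v ∈ K := by
  induction v using Finsupp.induction_linear with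
  | zero => simp
  | add v w hv hw => rw [map_add]; exact K.add_mem hv hw
  | single b r =>
    rw [← mul_one r, ← smul_eq_mul, ← Finsupp.smul_single, map_smul]
    exact K.smul_mem r (h b)

section Noetherian

variable [IsNoetherianRing R] {B : Type u}

theorem fg_inf_supported (K : Submodule R (B →₀ R)) (s : Finset B) :
    ∃ G : Finset (B →₀ R), K ⊓ Finsupp.supported R R (s : Set B) = Submodule.span R G := by
  have : Finite (s : Set B) := s.finite_toSet
  obtain ⟨G, hG⟩ := (IsNoetherian.noetherian (K.comap (incl (R := R) (s : Set B)))).map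
    (incl (s : Set B))
  refine ⟨G, ?_⟩
  rw [hG, Submodule.map_comap_eq, inf_comm]
  congr 1
  ext v
  exact ⟨fun hv => ⟨_, incl_proj _ hv⟩, by rintro ⟨w, rfl⟩; exact incl_mem _ w⟩

theorem LocSplit.exists_fix {K : Submodule R (B →₀ R)} (hK : LocSplit K) (s : Finset B) :
    ∃ h : (B →₀ R) →ₗ[R] (B →₀ R), (∀ x, h x ∈ K) ∧
      ∀ x ∈ K, x ∈ Finsupp.supported R R (s : Set B) → h x = x := by
  obtain ⟨G, hG⟩ := fg_inf_supported K s
  obtain ⟨h, hhK, hh⟩ := hK G fun x hx => ((hG ▸ Submodule.subset_span hx :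
    x ∈ K ⊓ Finsupp.supported R R (s : Set B))).1
  refine ⟨h, hhK, fun x hxK hx => ?_⟩
  have hle : Submodule.span R (G : Set (B →₀ R)) ≤ LinearMap.eqLocus h LinearMap.id :=
    Submodule.span_le.2 hh
  exact hle (hG ▸ (⟨hxK, hx⟩ : x ∈ K ⊓ Finsupp.supported R R (s : Set B)))

theorem LocSplit.admitsClosure {K : Submodule R (B →₀ R)} (hK : LocSplit K) :
    AdmitsClosure Cardinal.aleph0 fun X => LocSplit (K.comap (incl X)) := by
  classical
  choose h hhK hh using hK.exists_fix
  refine ⟨fun s => (s.biUnion fun b => (h s (Finsupp.single b 1)).support : Finset B), fun s =>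
    (Cardinal.mk_le_aleph0_iff.2 (Finset.countable_toSet _).to_subtype), fun X hX t ht => ?_⟩
  obtain ⟨s, hs⟩ := exists_finset_supported (t.image (incl X))
  have hsX : (s.filter (· ∈ X) : Set B) ⊆ X := by
    intro b hb
    simp only [Finset.coe_filter, Set.mem_ofPred_eq] at hb
    exact hb.2
  set s' := s.filter (· ∈ X)
  have hmem : ∀ v, h s' (incl (s' : Set B) v) ∈ Finsupp.supported R R X := by
    refine apply_mem_of_single (h s' ∘ₗ incl (s' : Set B)) _ fun b => ?_
    have hb : incl (R := R) (s' : Set B) (Finsupp.single b 1) = Finsupp.single b.1 1 :=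
      Finsupp.mapDomain_single
    rw [LinearMap.comp_apply, hb]
    exact fun x hx => hX s' (by simpa using hsX) (Finset.mem_coe.2
      (Finset.mem_biUnion.2 ⟨b.1, b.2, hx⟩))
  refine ⟨proj X ∘ₗ h s' ∘ₗ incl (s' : Set B) ∘ₗ proj (s' : Set B) ∘ₗ incl X, fun x => ?_,
    fun x hx => ?_⟩
  · rw [Submodule.mem_comap]
    simp only [LinearMap.comp_apply]
    rw [incl_proj _ (hmem _)]
    exact hhK _ _
  · have hxs : incl X x ∈ Finsupp.supported R R (s' : Set B) := by
      intro b hb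
      simp only [s', Finset.coe_filter, Set.mem_ofPred_eq]
      exact ⟨hs _ (Finset.mem_image_of_mem _ hx) hb, incl_mem X x hb⟩
    simp only [LinearMap.comp_apply]
    rw [incl_proj _ hxs, hh s' _ (ht x hx) hxs, proj_incl]

theorem exists_seq_span [Countable B] (K : Submodule R (B →₀ R)) :
    ∃ k : ℕ → (B →₀ R), (∀ n, k n ∈ K) ∧ K ≤ Submodule.span R (Set.range k) := by
  choose G hG using fg_inf_supported K
  obtain ⟨k, hk⟩ := (((Set.countable_iUnion fun s => (G s).countable_toSet).insert
    (0 : B →₀ R))).exists_eq_range (Set.insert_nonempty _ _)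
  refine ⟨k, fun n => ?_, fun x hx => ?_⟩
  · have : k n ∈ insert (0 : B →₀ R) (⋃ s, (G s : Set (B →₀ R))) := hk ▸ ⟨n, rfl⟩
    rcases this with h | h
    · rw [h]; exact K.zero_mem
    · obtain ⟨s, hs⟩ := Set.mem_iUnion.1 h
      exact (hG s ▸ Submodule.subset_span hs : k n ∈ K ⊓ Finsupp.supported R R (s : Set B)).1
  · have h : x ∈ K ⊓ Finsupp.supported R R (x.support : Set B) :=
      ⟨hx, Finsupp.mem_supported_support R x⟩
    rw [hG] at h
    rw [← hk]
    exact Submodule.span_mono ((Set.subset_iUnion (fun s => (G s : Set (B →₀ R))) _).trans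
      (Set.subset_insert _ _)) h

theorem LocSplit.exists_seq [Countable B] {K : Submodule R (B →₀ R)} (hK : LocSplit K) :
    ∃ e : ℕ → (B →₀ R) →ₗ[R] (B →₀ R), (∀ n x, e n x ∈ K) ∧
      (∀ n m, n < m → ∀ x, e m (e n x) = e n x) ∧ ∀ x ∈ K, ∃ N, ∀ n ≥ N, e n x = x := by
  classical
  obtain ⟨k, hkK, hk⟩ := exists_seq_span K
  choose h hhK hht hfg using hK.exists_fg
  choose g hg using hfg
  let next : ℕ → {t : Finset (B →₀ R) // ∀ x ∈ t, x ∈ K} → {t : Finset (B →₀ R) // ∀ x ∈ t, x ∈ K} :=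
    fun n t => ⟨insert (k n) (t.1 ∪ g t.1 t.2), by
      intro x hx
      rcases Finset.mem_insert.1 hx with rfl | hx
      · exact hkK n
      rcases Finset.mem_union.1 hx with hx | hx
      · exact t.2 x hx
      · have : x ∈ LinearMap.range (h t.1 t.2) := hg t.1 t.2 ▸ Submodule.subset_span hx
        obtain ⟨y, rfl⟩ := this
        exact hhK _ _ y⟩
  let t : ℕ → {t : Finset (B →₀ R) // ∀ x ∈ t, x ∈ K} := fun n => Nat.rec ⟨∅, by simp⟩ next n
  have hmono : Monotone fun n => (t n).1 := monotone_nat_of_le_succ fun n x hx =>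
    Finset.mem_insert_of_mem (Finset.mem_union_left _ hx)
  have hspan : ∀ n, ∀ x ∈ Submodule.span R ((t n).1 : Set (B →₀ R)), h _ (t n).2 x = x := by
    intro n x hx
    have hle : Submodule.span R ((t n).1 : Set (B →₀ R)) ≤
        LinearMap.eqLocus (h _ (t n).2) LinearMap.id := Submodule.span_le.2 (hht _ (t n).2)
    exact hle hx
  refine ⟨fun n => h _ (t n).2, fun n => hhK _ _, fun n m hnm x => hspan m _ ?_, fun x hx => ?_⟩
  · refine Submodule.span_mono (Finset.coe_subset.2 (hmono (Nat.succ_le_of_lt hnm))) ?_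
    have : h _ (t n).2 x ∈ Submodule.span R (g _ (t n).2 : Set (B →₀ R)) := by
      rw [hg]; exact ⟨x, rfl⟩
    exact Submodule.span_mono (fun y hy => Finset.mem_insert_of_mem
      (Finset.mem_union_right _ hy)) this
  · obtain ⟨N, hN⟩ : ∃ N, x ∈ Submodule.span R ((t N).1 : Set (B →₀ R)) := by
      have hx' := hk hx
      clear hx
      induction hx' using Submodule.span_induction with
      | mem x h =>
        obtain ⟨n, rfl⟩ := h
        exact ⟨n + 1, Submodule.subset_span (Finset.mem_insert_self _ _)⟩
      | zero => exact ⟨0, Submodule.zero_mem _⟩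
      | add x y _ _ hx hy =>
        obtain ⟨N, hN⟩ := hx
        obtain ⟨M, hM⟩ := hy
        exact ⟨max N M, Submodule.add_mem _
          (Submodule.span_mono (hmono (le_max_left _ _)) hN)
          (Submodule.span_mono (hmono (le_max_right _ _)) hM)⟩
      | smul r x _ hx => exact hx.imp fun N hN => Submodule.smul_mem _ r hN
    exact ⟨N, fun n hn => hspan n x (Submodule.span_mono (hmono hn) hN)⟩

theorem LocSplit.projective [Countable B] {K : Submodule R (B →₀ R)} (hK : LocSplit K) :
    Module.Projective R K := by
  obtain ⟨e, heK, hee, hfix⟩ := hK.exists_seq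
  let a : ℕ → (B →₀ R) →ₗ[R] (B →₀ R) := fun n => Nat.casesOn n (e 0) fun n => e (n + 1) - e n
  have hsum : ∀ N x, ∑ n ∈ Finset.range (N + 1), a n x = e N x := by
    intro N x
    induction N with
    | zero => simp [a]
    | succ N ih => rw [Finset.sum_range_succ, ih]; simp [a]
  have ha : ∀ n x, e (n + 1) (a n x) = a n x := by
    intro n x
    cases n with
    | zero => exact hee _ _ (by lia) x
    | succ n =>
      change e (n + 1 + 1) (e (n + 1) x - e n x) = e (n + 1) x - e n x
      rw [map_sub, hee _ _ (by lia), hee _ _ (by lia)]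
  have hfin : ∀ x ∈ K, ∃ N, ∀ n ≥ N, a n x = 0 := by
    intro x hx
    obtain ⟨N, hN⟩ := hfix x hx
    refine ⟨N + 1, fun n hn => ?_⟩
    cases n with
    | zero => lia
    | succ n =>
      change e (n + 1) x - e n x = 0
      rw [hN _ (by lia), hN _ (by lia), sub_self]
  have hsupp : ∀ x : K, (support fun n => a n x).Finite := by
    intro x
    obtain ⟨N, hN⟩ := hfin x x.2
    refine (Set.finite_lt_nat N).subset fun n hn => ?_
    by_contra h
    exact hn (hN n (not_lt.1 h))
  let α : K →ₗ[R] (ℕ →₀ (B →₀ R)) :=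
    { toFun := fun x => Finsupp.ofSupportFinite (fun n => a n x) (hsupp x)
      map_add' := fun x y => Finsupp.ext fun n => map_add (a n) _ _
      map_smul' := fun r x => Finsupp.ext fun n => map_smul (a n) _ _ }
  let β : (ℕ →₀ (B →₀ R)) →ₗ[R] K :=
    Finsupp.lsum R fun n => (e (n + 1)).codRestrict K (heK (n + 1))
  refine Module.Projective.of_split α β (LinearMap.ext fun x => Subtype.ext ?_)
  obtain ⟨N, hN⟩ := hfin x x.2
  obtain ⟨N', hN'⟩ := hfix x x.2
  have hsub : (α x).support ⊆ Finset.range (max N N' + 1) := by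
    intro n hn
    by_contra h
    rw [Finset.mem_range] at h
    exact Finsupp.mem_support_iff.1 hn (hN n (by lia))
  have : ((β (α x) : K) : B →₀ R) = ∑ n ∈ Finset.range (max N N' + 1), a n x := by
    rw [Finsupp.lsum_apply, Finsupp.sum_of_support_subset _ hsub _ (by simp)]
    simp only [AddSubmonoidClass.coe_finsetSum]
    exact Finset.sum_congr rfl fun n _ => ha n x
  rw [LinearMap.comp_apply, this, hsum, hN' _ (le_max_right _ _), LinearMap.id_apply]

end Noetherian

/-- Maps into character modules extend along locally split inclusions. -/
theorem LocSplit.exists_extend {F : Type*} [AddCommGroup F] [Module R F] {K : Submodule R F}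
    (hK : LocSplit K) {N : Type*} [AddCommGroup N] [Module R N] (f : K →ₗ[R] CharacterModule N) :
    ∃ g : F →ₗ[R] CharacterModule N, g ∘ₗ K.subtype = f := by
  classical
  have hinj : Injective (K.subtype.rTensor N) := by
    rw [← LinearMap.ker_eq_bot, LinearMap.ker_eq_bot']
    intro z hz
    obtain ⟨t, ht⟩ : ∃ t : Finset F, (∀ x ∈ t, x ∈ K) ∧ ∀ (h : F →ₗ[R] F) (hh : ∀ x, h x ∈ K),
        (∀ x ∈ t, h x = x) →
        (h.codRestrict K hh).rTensor N (K.subtype.rTensor N z) = z := by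
      clear hz
      induction z with
      | zero => exact ⟨∅, by simp, by simp⟩
      | tmul x n =>
        refine ⟨{x.1}, by simp, fun h hh hx => ?_⟩
        rw [LinearMap.rTensor_tmul, LinearMap.rTensor_tmul]
        congr 1
        exact Subtype.ext (hx _ (Finset.mem_singleton_self _))
      | add z w hz hw =>
        obtain ⟨t, htK, ht⟩ := hz
        obtain ⟨t', htK', ht'⟩ := hw
        refine ⟨t ∪ t', fun x hx => (Finset.mem_union.1 hx).elim (htK x) (htK' x),
          fun h hh hx => ?_⟩
        rw [map_add, map_add, ht h hh fun x h => hx x (Finset.mem_union_left _ h),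
          ht' h hh fun x h => hx x (Finset.mem_union_right _ h)]
    obtain ⟨h, hh, hx⟩ := hK t ht.1
    rw [← ht.2 h hh hx, hz, map_zero]
  obtain ⟨g, hg⟩ := CharacterModule.dual_surjective_of_injective _ hinj
    (CharacterModule.homEquiv f)
  refine ⟨CharacterModule.homEquiv.symm g, ?_⟩
  ext x n
  exact DFunLike.congr_fun hg (x ⊗ₜ n)

/-- If a differential stays exact after tensoring with every module, the cokernel of its image is
flat. -/
theorem flat_quotient_ker {F : Type u} [AddCommGroup F] [Module R F] [Module.Flat R F]
    (d : F →ₗ[R] F) (hd : d ∘ₗ d = 0)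
    (h : ∀ (N : Type u) [AddCommGroup N] [Module R N], Exact (d.rTensor N) (d.rTensor N)) :
    Module.Flat R (F ⧸ LinearMap.ker d) := by
  let D : (F ⧸ LinearMap.ker d) →ₗ[R] F := (LinearMap.ker d).liftQ d le_rfl
  have hD : ∀ (N : Type u) [AddCommGroup N] [Module R N], Injective (D.rTensor N) := by
    intro N _ _
    rw [← LinearMap.ker_eq_bot, LinearMap.ker_eq_bot']
    intro z hz
    obtain ⟨w, rfl⟩ := LinearMap.rTensor_surjective N (Submodule.mkQ_surjective _) z
    rw [← LinearMap.rTensor_comp_apply, Submodule.liftQ_mkQ] at hz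
    obtain ⟨v, rfl⟩ := (h N w).1 hz
    rw [← LinearMap.rTensor_comp_apply, LinearMap.range_le_ker_iff.1, LinearMap.rTensor_zero,
      LinearMap.zero_apply]
    rintro _ ⟨x, rfl⟩
    simpa using LinearMap.congr_fun hd x
  refine Module.Flat.iff_lTensor_preserves_injective_linearMap.2 fun N N' _ _ _ _ f hf => ?_
  have hcomp : (f.lTensor F) ∘ₗ (D.rTensor N) = (D.rTensor N') ∘ₗ f.lTensor _ := by
    rw [LinearMap.lTensor_comp_rTensor, LinearMap.rTensor_comp_lTensor]
  refine Injective.of_comp (f := D.rTensor N') ?_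
  rw [← LinearMap.coe_comp, ← hcomp, LinearMap.coe_comp]
  exact (Module.Flat.lTensor_preserves_injective_linearMap f hf).comp (hD N)

end GorensteinPure

namespace GorensteinPure

open Function Cardinal

/-- Every chain map from the differential module `(C, d)` to `(Y, δ)` is null-homotopic. -/
def NullHtpy {C Y : Type*} [AddCommGroup C] [Module R C] [AddCommGroup Y] [Module R Y]
    (d : C →ₗ[R] C) (δ : Y →ₗ[R] Y) : Prop :=
  ∀ φ : C →ₗ[R] Y, δ ∘ₗ φ = φ ∘ₗ d → ∃ s : C →ₗ[R] Y, φ = δ ∘ₗ s + s ∘ₗ d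

section General

variable {C D E Y T : Type*} [AddCommGroup C] [Module R C] [AddCommGroup D] [Module R D]
  [AddCommGroup E] [Module R E] [AddCommGroup Y] [Module R Y] [AddCommGroup T] [Module R T]
  {d : C →ₗ[R] C} {d' : D →ₗ[R] D} {d'' : E →ₗ[R] E} {δ : Y →ₗ[R] Y}

theorem HE.of_chain_retract (h : HE d' T) (i : C →ₗ[R] D) (r : D →ₗ[R] C)
    (hr : r ∘ₗ i = LinearMap.id) (hi : i ∘ₗ d = d' ∘ₗ i) (hrd : r ∘ₗ d' = d ∘ₗ r) : HE d T := by
  intro f hf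
  obtain ⟨g, hg⟩ := h (f ∘ₗ r) (by
    rw [LinearMap.comp_assoc, hrd, ← LinearMap.comp_assoc, hf, LinearMap.zero_comp])
  refine ⟨g ∘ₗ i, ?_⟩
  rw [LinearMap.comp_assoc, hi, ← LinearMap.comp_assoc, ← hg, LinearMap.comp_assoc, hr,
    LinearMap.comp_id]

theorem NullHtpy.of_chain_retract (h : NullHtpy d' δ) (i : C →ₗ[R] D) (r : D →ₗ[R] C)
    (hr : r ∘ₗ i = LinearMap.id) (hi : i ∘ₗ d = d' ∘ₗ i) (hrd : r ∘ₗ d' = d ∘ₗ r) :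
    NullHtpy d δ := by
  intro φ hφ
  obtain ⟨s, hs⟩ := h (φ ∘ₗ r) (by
    rw [← LinearMap.comp_assoc, hφ, LinearMap.comp_assoc, LinearMap.comp_assoc, hrd])
  refine ⟨s ∘ₗ i, ?_⟩
  rw [LinearMap.comp_assoc, hi, ← LinearMap.comp_assoc, ← LinearMap.comp_assoc,
    ← LinearMap.add_comp, ← hs, LinearMap.comp_assoc, hr, LinearMap.comp_id]

theorem NullHtpy.of_contraction (s : C →ₗ[R] C) (hs : LinearMap.id = d ∘ₗ s + s ∘ₗ d) :
    NullHtpy d δ := by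
  intro φ hφ
  refine ⟨φ ∘ₗ s, ?_⟩
  rw [← LinearMap.comp_assoc, hφ, LinearMap.comp_assoc, LinearMap.comp_assoc,
    ← LinearMap.comp_add, ← hs, LinearMap.comp_id]

variable (i : C →ₗ[R] D) (p : D →ₗ[R] E) (r : D →ₗ[R] C) (hr : r ∘ₗ i = LinearMap.id)
  (hip : Exact i p) (hp : Surjective p) (hi : i ∘ₗ d = d' ∘ₗ i) (hpd : p ∘ₗ d' = d'' ∘ₗ p)

include hr hip hp hi hpd

theorem HE.quotient (h' : HE d' T) (h : HE d T) (hd' : d' ∘ₗ d' = 0) : HE d'' T := by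
  intro f hf
  obtain ⟨g, hg⟩ := h' (f ∘ₗ p) (by
    rw [LinearMap.comp_assoc, hpd, ← LinearMap.comp_assoc, hf, LinearMap.zero_comp])
  obtain ⟨g₂, hg₂⟩ := h (g ∘ₗ i) (by
    rw [LinearMap.comp_assoc, hi, ← LinearMap.comp_assoc, ← hg, LinearMap.comp_assoc,
      hip.linearMap_comp_eq_zero, LinearMap.comp_zero])
  have hri : ∀ x, r (i x) = x := LinearMap.congr_fun hr
  have hi' : ∀ x, d' (i x) = i (d x) := fun x => (LinearMap.congr_fun hi x).symm
  obtain ⟨k, hk⟩ := exists_comp_eq_of_surjective p hp (g - g₂ ∘ₗ r ∘ₗ d') (fun a ha => by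
    obtain ⟨c, rfl⟩ := (hip a).1 ha
    have := LinearMap.congr_fun hg₂ c
    simp only [LinearMap.comp_apply] at this
    simp only [LinearMap.sub_apply, LinearMap.comp_apply, hi', hri, this, sub_self])
  refine ⟨k, LinearMap.ext fun e => ?_⟩
  obtain ⟨x, rfl⟩ := hp e
  have h₁ := LinearMap.congr_fun hg x
  have h₂ := LinearMap.congr_fun hk (d' x)
  have h₃ := LinearMap.congr_fun hd' x
  have h₄ := LinearMap.congr_fun hpd x
  simp only [LinearMap.comp_apply, LinearMap.sub_apply, LinearMap.zero_apply] at h₁ h₂ h₃ h₄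
  rw [h₃, map_zero, map_zero, sub_zero] at h₂
  rw [LinearMap.comp_apply, ← h₄, h₁, h₂]

theorem NullHtpy.exists_extend (h : NullHtpy d'' δ) (hd' : d' ∘ₗ d' = 0) (hδ : δ ∘ₗ δ = 0)
    (φ : D →ₗ[R] Y) (hφ : δ ∘ₗ φ = φ ∘ₗ d') (s : C →ₗ[R] Y)
    (hs : φ ∘ₗ i = δ ∘ₗ s + s ∘ₗ d) :
    ∃ s' : D →ₗ[R] Y, φ = δ ∘ₗ s' + s' ∘ₗ d' ∧ s' ∘ₗ i = s := by
  have hri : ∀ x, r (i x) = x := LinearMap.congr_fun hr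
  have hi' : ∀ x, d' (i x) = i (d x) := fun x => (LinearMap.congr_fun hi x).symm
  have hδ' : ∀ x, δ (δ x) = 0 := LinearMap.congr_fun hδ
  have hd'' : ∀ x, d' (d' x) = 0 := LinearMap.congr_fun hd'
  have hφ' : ∀ x, δ (φ x) = φ (d' x) := LinearMap.congr_fun hφ
  have hp' : ∀ x, p (d' x) = d'' (p x) := LinearMap.congr_fun hpd
  have hs' : ∀ x, φ (i x) = δ (s x) + s (d x) := LinearMap.congr_fun hs
  have hip' : ∀ x, p (i x) = 0 := fun x => (hip _).2 ⟨x, rfl⟩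
  obtain ⟨χ, hχ⟩ := exists_comp_eq_of_surjective p hp (φ - (δ ∘ₗ s ∘ₗ r + s ∘ₗ r ∘ₗ d'))
    (fun a ha => by
      obtain ⟨c, rfl⟩ := (hip a).1 ha
      simp only [LinearMap.sub_apply, LinearMap.add_apply, LinearMap.comp_apply, hi', hri, hs',
        sub_self])
  have hχ' : ∀ x, χ (p x) = φ x - (δ (s (r x)) + s (r (d' x))) := LinearMap.congr_fun hχ
  obtain ⟨t, ht⟩ := h χ (LinearMap.ext fun e => by
    obtain ⟨x, rfl⟩ := hp e
    simp only [LinearMap.comp_apply, ← hp', hχ', map_sub, map_add, hφ', hδ', hd'', map_zero,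
      zero_add, add_zero])
  have ht' : ∀ x, χ x = δ (t x) + t (d'' x) := LinearMap.congr_fun ht
  refine ⟨s ∘ₗ r + t ∘ₗ p, LinearMap.ext fun x => ?_, LinearMap.ext fun x => ?_⟩
  · have h₁ := hχ' x
    rw [ht', ← hp', eq_sub_iff_add_eq] at h₁
    simp only [LinearMap.add_apply, LinearMap.comp_apply, map_add, ← h₁]
    abel
  · simp only [LinearMap.add_apply, LinearMap.comp_apply, hri, hip', map_zero, add_zero]

end General

section Restriction

variable {B : Type u} (d : (B →₀ R) →ₗ[R] (B →₀ R)) (X : Set B)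

/-- The basis elements in `X` span a differential submodule. -/
def Stable : Prop := ∀ v, d (incl X v) ∈ Finsupp.supported R R X

/-- The differential induced on the span of the basis elements in `X`. -/
noncomputable def restr : (X →₀ R) →ₗ[R] (X →₀ R) := proj X ∘ₗ d ∘ₗ incl X

variable {d X}

theorem Stable.incl_restr (h : Stable d X) (v : X →₀ R) : incl X (restr d X v) = d (incl X v) :=
  incl_proj X (h v)

theorem Stable.restr_comp (h : Stable d X) (hd : d ∘ₗ d = 0) : restr d X ∘ₗ restr d X = 0 := by
  refine LinearMap.ext fun v => incl_injective X ?_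
  simp only [LinearMap.comp_apply, h.incl_restr, LinearMap.zero_apply, map_zero]
  exact LinearMap.congr_fun hd _

variable (d)

theorem Stable.admitsClosure : AdmitsClosure ℵ₀ (Stable d) := by
  classical
  refine ⟨fun s => (s.biUnion fun b => (d (Finsupp.single b 1)).support : Finset B), fun s =>
    (Cardinal.mk_le_aleph0_iff.2 (Finset.countable_toSet _).to_subtype), fun X hX => ?_⟩
  refine apply_mem_of_single (d ∘ₗ incl X) _ fun b => ?_
  have hb : incl (R := R) X (Finsupp.single b 1) = Finsupp.single b.1 1 :=
    Finsupp.mapDomain_single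
  rw [LinearMap.comp_apply, hb]
  exact fun x hx => hX {b.1} (by simp) (by simpa using hx)

theorem exact_restr_admitsClosure [IsNoetherianRing R] (hd : Exact d d) :
    AdmitsClosure ℵ₀ fun X => ∀ v, d (incl X v) = 0 → ∃ w, d (incl X w) = incl X v := by
  classical
  choose G hG using fg_inf_supported (LinearMap.ker d)
  have : ∀ v, ∃ w, d v = 0 → d w = v := fun v => by
    by_cases h : d v = 0
    · exact ((hd v).1 h).imp fun w hw _ => hw
    · exact ⟨0, fun h' => absurd h' h⟩
  choose w hw using this
  refine ⟨fun s => ((G s).biUnion fun v => (w v).support : Finset B), fun s =>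
    (Cardinal.mk_le_aleph0_iff.2 (Finset.countable_toSet _).to_subtype), fun X hX v hv => ?_⟩
  have hsub : ((incl X v).support : Set B) ⊆ X := incl_mem X v
  have hmem : incl X v ∈ Submodule.span R (G (incl X v).support : Set (B →₀ R)) :=
    hG _ ▸ ⟨hv, Finsupp.mem_supported_support R _⟩
  have hle : Submodule.span R (G (incl X v).support : Set (B →₀ R)) ≤
      LinearMap.range (d ∘ₗ incl X) := by
    refine Submodule.span_le.2 fun x hx => ?_
    have hx' := (hG _ ▸ Submodule.subset_span hx :
      x ∈ LinearMap.ker d ⊓ Finsupp.supported R R ((incl X v).support : Set B)).1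
    refine ⟨proj X (w x), ?_⟩
    rw [LinearMap.comp_apply, incl_proj, hw x hx']
    exact fun b hb => hX _ hsub (Finset.mem_coe.2 (Finset.mem_biUnion.2 ⟨x, hx, hb⟩))
  exact hle hmem

end Restriction

/-- Null-homotopy of maps out of free differential modules can be tested on small ones. -/
theorem nullHtpy_of_small {κ : Cardinal.{u}} (hκ : ℵ₀ ≤ κ) {ι : Type*} (T : ι → ModuleCat.{u} R)
    {Y : Type u} [AddCommGroup Y] [Module R Y] (δ : Y →ₗ[R] Y) (hδ : δ ∘ₗ δ = 0)
    (hclos : ∀ (B : Type u) (d : (B →₀ R) →ₗ[R] (B →₀ R)), d ∘ₗ d = 0 → (∀ i, HE d (T i)) →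
      AdmitsClosure κ fun X => Stable d X ∧ ∀ i, HE (restr d X) (T i))
    (hsmall : ∀ (B : Type u) (d : (B →₀ R) →ₗ[R] (B →₀ R)), #B ≤ κ → d ∘ₗ d = 0 →
      (∀ i, HE d (T i)) → NullHtpy d δ)
    (B : Type u) (d : (B →₀ R) →ₗ[R] (B →₀ R)) (hd : d ∘ₗ d = 0) (hT : ∀ i, HE d (T i)) :
    NullHtpy d δ := by
  induction hμ : #B using WellFoundedLT.induction generalizing B with
  | ind μ ih =>
  subst hμ
  rcases le_or_gt #B κ with hB | hB
  · exact hsmall B d hB hd hT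
  intro φ hφ
  obtain ⟨c, hc, hX⟩ := hclos B d hd hT
  suffices (∃ p : (B →₀ R) →ₗ.[R] Y, (∀ x : p.domain, ∃ hx : d x ∈ p.domain,
      φ x = δ (p x) + p ⟨d x, hx⟩) ∧ p.domain = ⊤) by
    obtain ⟨p, hp, hpt⟩ := this
    refine ⟨p.toFun ∘ₗ LinearMap.codRestrict p.domain LinearMap.id fun x => hpt ▸ trivial,
      LinearMap.ext fun x => ?_⟩
    exact (hp ⟨x, hpt ▸ trivial⟩).2
  refine exists_linearPMap_of_chain hκ hB c hc (Finsupp.supported R R)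
    (fun _ _ => Finsupp.supported_mono) (Finsupp.supported_univ)
    (fun S hS hdir x hx => hdir.exists_mem_subset_of_finite_of_subset_sUnion hS
      x.support.finite_toSet hx)
    (fun p : (B →₀ R) →ₗ.[R] Y => ∀ x : p.domain, ∃ hx : d x ∈ p.domain,
      φ x = δ (p x) + p ⟨d x, hx⟩) ?_ ?_ ?_
  · intro S hS hne hgood x
    obtain ⟨q, hq, hxq⟩ := (LinearPMap.mem_domain_sSup_iff hne hS).1 x.2
    obtain ⟨h, h'⟩ := hgood q hq ⟨x, hxq⟩
    have hle := LinearPMap.le_sSup hS hq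
    refine ⟨hle.1 h, ?_⟩
    rw [h', hle.2 (x := ⟨x, hxq⟩) (y := x) rfl, hle.2 (x := ⟨d x, h⟩) (y := ⟨d x, hle.1 h⟩) rfl]
  · intro X hXc hXB
    obtain ⟨hst, hXT⟩ := hX X hXc
    obtain ⟨s, hs⟩ := ih #X hXB X (restr d X) (hst.restr_comp hd) hXT rfl (φ ∘ₗ incl X)
      (LinearMap.ext fun v => by
        simp only [LinearMap.comp_apply, hst.incl_restr]
        exact LinearMap.congr_fun hφ _)
    refine ⟨⟨Finsupp.supported R R X, s ∘ₗ proj X ∘ₗ Submodule.subtype _⟩, fun x => ?_, rfl⟩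
    have hx := incl_proj X x.2
    have hdx : d x ∈ Finsupp.supported R R X := hx ▸ hst (proj X x)
    refine ⟨hdx, ?_⟩
    have := LinearMap.congr_fun hs (proj X x)
    simp only [LinearMap.comp_apply, LinearMap.add_apply, hx] at this
    rw [this]
    simp [restr, hx]
  · intro X X' hXc hXc' hXX' hXB p hp hpX
    obtain ⟨hst, hXT⟩ := hX X hXc
    obtain ⟨hst', hXT'⟩ := hX X' hXc'
    have hle : ∀ v, incl X v ∈ Finsupp.supported R R X' := fun v =>
      Finsupp.supported_mono hXX' (incl_mem X v)
    let Q : Set B := X' \ X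
    have hQ : ∀ v, incl Q v ∈ Finsupp.supported R R X' := fun v =>
      Finsupp.supported_mono Set.sdiff_subset (incl_mem Q v)
    let i : (X →₀ R) →ₗ[R] (X' →₀ R) := proj X' ∘ₗ incl X
    let q : (X' →₀ R) →ₗ[R] (Q →₀ R) := proj Q ∘ₗ incl X'
    have hi : ∀ v, incl X' (i v) = incl X v := fun v => incl_proj X' (hle v)
    have hr : (proj X ∘ₗ incl X') ∘ₗ i = LinearMap.id := LinearMap.ext fun v => by
      simp only [LinearMap.comp_apply, hi, proj_incl, LinearMap.id_apply]
    have hq : Surjective q := fun v => ⟨proj X' (incl Q v), by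
      simp only [q, LinearMap.comp_apply, incl_proj X' (hQ v), proj_incl]⟩
    have hproj : ∀ v ∈ Finsupp.supported R R X, proj Q v = 0 := fun v hv => by
      ext b
      exact (Finsupp.notMem_support_iff (f := v) (a := b.1)).1 fun hb => b.2.2 (hv hb)
    have hsupp : ∀ v ∈ Finsupp.supported R R X', proj Q v = 0 → v ∈ Finsupp.supported R R X := by
      intro v hv hv0 b hb
      by_contra hbX
      exact Finsupp.mem_support_iff.1 hb (DFunLike.congr_fun hv0 (⟨b, hv hb, hbX⟩ : Q))
    have hiq : Exact i q := by
      refine fun v => ⟨fun hv => ⟨proj X (incl X' v), incl_injective X' ?_⟩, ?_⟩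
      · rw [hi, incl_proj X (hsupp _ (incl_mem X' v) hv)]
      · rintro ⟨w, rfl⟩
        change proj Q (incl X' (i w)) = 0
        rw [hi, hproj _ (incl_mem X w)]
    have hid : i ∘ₗ restr d X = restr d X' ∘ₗ i := LinearMap.ext fun v => incl_injective X' (by
      simp only [LinearMap.comp_apply, hi, hst.incl_restr, hst'.incl_restr])
    have hqd : q ∘ₗ restr d X' = restr d Q ∘ₗ q := LinearMap.ext fun v => by
      change proj Q (incl X' (restr d X' v)) = proj Q (d (incl Q (proj Q (incl X' v))))
      rw [hst'.incl_restr, ← sub_eq_zero, ← map_sub, ← map_sub]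
      have hmem := hsupp (incl X' v - incl Q (proj Q (incl X' v)))
        (Submodule.sub_mem _ (incl_mem X' v) (hQ _)) (by rw [map_sub, proj_incl, sub_self])
      rw [← incl_proj X hmem]
      exact hproj _ (hst _)
    have hqd' : ∀ v, restr d Q (q v) = q (restr d X' v) := fun v => (LinearMap.congr_fun hqd v).symm
    have hdQ : restr d Q ∘ₗ restr d Q = 0 := LinearMap.ext fun v => by
      obtain ⟨v, rfl⟩ := hq v
      have := LinearMap.congr_fun (hst'.restr_comp hd) v
      simp only [LinearMap.comp_apply, LinearMap.zero_apply] at this ⊢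
      rw [hqd', hqd', this, map_zero]
    have hnull := ih #Q ((mk_le_mk_of_subset Set.sdiff_subset).trans_lt hXB) Q (restr d Q) hdQ
      (fun j => (hXT' j).quotient i q _ hr hiq hq hid hqd (hXT j) (hst'.restr_comp hd)) rfl
    have hpX' : ∀ v, incl X v ∈ p.domain := fun v => hpX ▸ incl_mem X v
    obtain ⟨s, hs, hsi⟩ := hnull.exists_extend i q _ hr hiq hq hid hqd (hst'.restr_comp hd) hδ
      (φ ∘ₗ incl X') (LinearMap.ext fun v => by
        simp only [LinearMap.comp_apply, hst'.incl_restr]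
        exact LinearMap.congr_fun hφ _) (p.toFun ∘ₗ (incl X).codRestrict p.domain hpX')
      (LinearMap.ext fun v => by
        obtain ⟨h, h'⟩ := hp ⟨incl X v, hpX' v⟩
        simp only [LinearMap.comp_apply, hi, LinearMap.add_apply]
        rw [h']
        congr 2
        have : (⟨d (incl X v), h⟩ : p.domain) =
            (incl X).codRestrict p.domain hpX' (restr d X v) :=
          Subtype.ext (hst.incl_restr v).symm
        exact this)
    refine ⟨⟨Finsupp.supported R R X', s ∘ₗ proj X' ∘ₗ Submodule.subtype _⟩, fun x => ?_,
      ⟨?_, fun x y hxy => ?_⟩, rfl⟩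
    · have hx := incl_proj X' x.2
      have hdx : d x ∈ Finsupp.supported R R X' := hx ▸ hst' (proj X' x)
      refine ⟨hdx, ?_⟩
      have := LinearMap.congr_fun hs (proj X' x)
      simp only [LinearMap.comp_apply, LinearMap.add_apply, hx] at this
      rw [this]
      simp [restr, hx]
    · rw [hpX]
      exact Finsupp.supported_mono hXX'
    · have hxX : x.1 ∈ Finsupp.supported R R X := by rw [← hpX]; exact x.2
      have hx := incl_proj X hxX
      have := LinearMap.congr_fun hsi (proj X x)
      simp only [LinearMap.comp_apply, i, hx] at this
      change p x = s (proj X' y)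
      rw [← hxy, this]
      exact congrArg p (Subtype.ext hx.symm)

end GorensteinPure

namespace GorensteinPure

open Function Cardinal

/-- The Eilenberg swindle. -/
theorem exists_free_prod (C : Type u) [AddCommGroup C] [Module R C] [Module.Projective R C] :
    Module.Free R (C × (ℕ →₀ (C →₀ R))) := by
  let ρ : (C →₀ R) →ₗ[R] C := Finsupp.linearCombination R id
  obtain ⟨ι, hι⟩ := Module.projective_lifting_property ρ LinearMap.id
    (Finsupp.linearCombination_surjective R surjective_id)
  have hρ : ∀ c, ρ (ι c) = c := LinearMap.congr_fun hι
  let e : (C →₀ R) →ₗ[R] (C →₀ R) := ι ∘ₗ ρ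
  let e' : (C →₀ R) →ₗ[R] (C →₀ R) := LinearMap.id - e
  let sh : (ℕ →₀ (C →₀ R)) →ₗ[R] (ℕ →₀ (C →₀ R)) := Finsupp.lmapDomain _ R Nat.succ
  let ush : (ℕ →₀ (C →₀ R)) →ₗ[R] (ℕ →₀ (C →₀ R)) :=
    Finsupp.lcomapDomain Nat.succ Nat.succ_injective
  have hsh0 : ∀ v, sh v 0 = 0 := fun v => Finsupp.mapDomain_of_notMem_range _ _ (by simp)
  have hsh : ∀ v n, sh v (n + 1) = v n := fun v n =>
    Finsupp.mapDomain_apply Nat.succ_injective v n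
  have hush : ∀ v n, ush v n = v (n + 1) := fun v n => rfl
  let f : C × (ℕ →₀ (C →₀ R)) →ₗ[R] (ℕ →₀ (C →₀ R)) :=
    (Finsupp.lsingle 0 ∘ₗ ι).coprod (Finsupp.mapRange.linearMap e' + sh ∘ₗ Finsupp.mapRange.linearMap e)
  let g : (ℕ →₀ (C →₀ R)) →ₗ[R] C × (ℕ →₀ (C →₀ R)) :=
    (ρ ∘ₗ Finsupp.lapply 0).prod (Finsupp.mapRange.linearMap e' + ush ∘ₗ Finsupp.mapRange.linearMap e)
  have hf0 : ∀ c v, f (c, v) 0 = ι c + e' (v 0) := fun c v => by simp [f, hsh0]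
  have hf : ∀ c v n, f (c, v) (n + 1) = e' (v (n + 1)) + e (v n) := fun c v n => by simp [f, hsh]
  have hg : ∀ w, (g w).1 = ρ (w 0) := fun w => rfl
  have hg' : ∀ w n, (g w).2 n = e' (w n) + e (w (n + 1)) := fun w n => by simp [g, hush]
  have h₁ : ∀ x, e' (e x) = 0 := fun x => by simp [e', e, hρ]
  have h₂ : ∀ x, e (e' x) = 0 := fun x => by simp [e', e, hρ]
  have h₃ : ∀ x, e (e x) = e x := fun x => by simp [e, hρ]
  have h₄ : ∀ x, e' (e' x) = e' x := fun x => by simp [e', e, hρ]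
  have h₅ : ∀ x, e' x + e x = x := fun x => by simp [e']
  have h₆ : ∀ c, e' (ι c) = 0 := fun x => by simp [e', e, hρ]
  have h₇ : ∀ x, ρ (e' x) = 0 := fun x => by simp [e', e, hρ]
  have h₈ : ∀ x, e x = ι (ρ x) := fun x => rfl
  refine Module.Free.of_equiv (LinearEquiv.ofLinearMap g f (LinearMap.ext fun x => ?_)
    (LinearMap.ext fun w => Finsupp.ext fun n => ?_))
  · obtain ⟨c, v⟩ := x
    refine Prod.ext ?_ (Finsupp.ext fun n => ?_)
    · simp [hg, hf0, hρ, h₇]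
    · simp only [LinearMap.comp_apply, hg', LinearMap.id_apply, hf]
      cases n with
      | zero => simp only [hf0, map_add, h₆, h₄, h₂, h₃, zero_add, h₅]
      | succ n => simp only [hf, map_add, h₁, h₄, h₂, h₃, zero_add, add_zero, h₅]
  · rw [LinearMap.comp_apply, LinearMap.id_apply, show g w = ((g w).1, (g w).2) from rfl]
    cases n with
    | zero => rw [hf0, hg, hg', map_add e', h₄, h₁, add_zero, ← h₈, add_comm, h₅]
    | succ n => simp only [hf, hg', map_add e', map_add e, h₄, h₁, h₂, h₃, zero_add, add_zero, h₅]

/-- A projective differential module is a retract of a free one, without changing the vanishing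
of cohomology of `Hom` into any module. -/
theorem exists_free_retract {C : Type u} [AddCommGroup C] [Module R C] [Module.Projective R C]
    (d : C →ₗ[R] C) (hd : d ∘ₗ d = 0) :
    ∃ (B : Type u) (d' : (B →₀ R) →ₗ[R] (B →₀ R)) (i : C →ₗ[R] (B →₀ R)) (r : (B →₀ R) →ₗ[R] C),
      d' ∘ₗ d' = 0 ∧ r ∘ₗ i = LinearMap.id ∧ i ∘ₗ d = d' ∘ₗ i ∧ r ∘ₗ d' = d ∘ₗ r ∧
      ∀ (T : Type u) [AddCommGroup T] [Module R T], HE d T → HE d' T := by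
  let G := ℕ →₀ (C →₀ R)
  have := exists_free_prod (R := R) C
  have : Module.Free R (C × G × G) :=
    Module.Free.of_equiv (LinearEquiv.prodAssoc R C G G)
  let D : C × G × G →ₗ[R] C × G × G :=
    d.prodMap (LinearMap.inl R G G ∘ₗ LinearMap.snd R G G)
  let e := (Module.Free.chooseBasis R (C × G × G)).repr
  refine ⟨_, e.toLinearMap ∘ₗ D ∘ₗ e.symm.toLinearMap, e.toLinearMap ∘ₗ LinearMap.inl R _ _,
    LinearMap.fst R _ _ ∘ₗ e.symm.toLinearMap, ?_, ?_, ?_, ?_, fun T _ _ hT => ?_⟩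
  · have : D ∘ₗ D = 0 := by
      refine LinearMap.ext fun x => ?_
      have h := LinearMap.congr_fun hd x.1
      simp only [LinearMap.comp_apply, LinearMap.zero_apply] at h
      simp [D, h]
    refine LinearMap.ext fun x => ?_
    have := LinearMap.congr_fun this (e.symm x)
    simp only [LinearMap.comp_apply, LinearMap.zero_apply] at this
    simp [this]
  · ext x; simp
  · ext x; simp [D, Prod.zero_eq_mk]
  · ext x; simp [D]
  · refine HE.of_chain_retract (D := C × G × G) (d' := D) ?_ e.symm.toLinearMap e.toLinearMap
      (LinearMap.ext fun x => by simp) (LinearMap.ext fun x => by simp)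
      (LinearMap.ext fun x => by simp)
    intro f hf
    obtain ⟨g, hg⟩ := hT (f ∘ₗ LinearMap.inl R _ _) (LinearMap.ext fun x => by
      simpa [D, Prod.zero_eq_mk] using LinearMap.congr_fun hf (x, 0))
    refine ⟨g.coprod (f ∘ₗ LinearMap.inr R _ _ ∘ₗ LinearMap.inr R _ _ ∘ₗ LinearMap.fst R _ _),
      LinearMap.ext fun x => ?_⟩
    obtain ⟨c, a, b⟩ := x
    have h₁ := LinearMap.congr_fun hg c
    have h₂ := LinearMap.congr_fun hf (0, 0, a)
    have h₃ : ((c, a, b) : C × G × G) = (c, 0) + D (0, 0, a) + (0, 0, b) := by simp [D]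
    rw [h₃, map_add, map_add, show f (D (0, 0, a)) = 0 from h₂, show f (c, 0) = g (d c) from h₁]
    simp [D]

theorem nullHtpy_of_small_of_projective {κ : Cardinal.{u}} (hκ : ℵ₀ ≤ κ) {ι : Type*}
    (T : ι → ModuleCat.{u} R) {Y : Type u} [AddCommGroup Y] [Module R Y] (δ : Y →ₗ[R] Y)
    (hδ : δ ∘ₗ δ = 0)
    (hclos : ∀ (B : Type u) (d : (B →₀ R) →ₗ[R] (B →₀ R)), d ∘ₗ d = 0 → (∀ i, HE d (T i)) →
      AdmitsClosure κ fun X => Stable d X ∧ ∀ i, HE (restr d X) (T i))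
    (hsmall : ∀ (B : Type u) (d : (B →₀ R) →ₗ[R] (B →₀ R)), #B ≤ κ → d ∘ₗ d = 0 →
      (∀ i, HE d (T i)) → NullHtpy d δ)
    {C : Type u} [AddCommGroup C] [Module R C] [Module.Projective R C] (d : C →ₗ[R] C)
    (hd : d ∘ₗ d = 0) (hT : ∀ i, HE d (T i)) : NullHtpy d δ := by
  obtain ⟨B, d', i, r, hd', hr, hi, hrd, h⟩ := exists_free_retract d hd
  exact (nullHtpy_of_small hκ T δ hδ hclos hsmall B d' hd' fun i => h _ (hT i)).of_chain_retract
    i r hr hi hrd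

theorem exists_contraction_of_projective_ker {F : Type*} [AddCommGroup F] [Module R F]
    {d : F →ₗ[R] F} (hd : Exact d d) [Module.Projective R (LinearMap.ker d)] :
    ∃ s : F →ₗ[R] F, LinearMap.id = d ∘ₗ s + s ∘ₗ d := by
  have hdd : ∀ x, d (d x) = 0 := fun x => hd.apply_apply_eq_zero x
  let D : F →ₗ[R] LinearMap.ker d := d.codRestrict _ hdd
  obtain ⟨σ, hσ⟩ := Module.projective_lifting_property D LinearMap.id fun y =>
    ((hd y).1 y.2).imp fun x hx => Subtype.ext hx
  have hσ' : ∀ y, d (σ y) = y := fun y => congrArg Subtype.val (LinearMap.congr_fun hσ y)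
  have hmem : ∀ x, (LinearMap.id - σ ∘ₗ D : F →ₗ[R] F) x ∈ LinearMap.ker d := fun x => by
    rw [LinearMap.mem_ker, LinearMap.sub_apply, map_sub, LinearMap.comp_apply, hσ']
    exact sub_self _
  refine ⟨σ ∘ₗ (LinearMap.id - σ ∘ₗ D).codRestrict _ hmem, LinearMap.ext fun x => ?_⟩
  have : (LinearMap.id - σ ∘ₗ D).codRestrict _ hmem (d x) = D x := Subtype.ext (by
    change d x - σ (D (d x)) = d x
    rw [show D (d x) = 0 from Subtype.ext (hdd x), map_zero, sub_zero])
  simp only [LinearMap.add_apply, LinearMap.comp_apply, hσ', this]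
  simp

theorem HE.character_of_locSplit {F : Type*} [AddCommGroup F] [Module R F] {d : F →ₗ[R] F}
    (hd : Exact d d) (h : LocSplit (LinearMap.ker d)) (N : Type*) [AddCommGroup N] [Module R N] :
    HE d (CharacterModule N) := by
  intro f hf
  obtain ⟨k, hk⟩ := exists_comp_eq_of_surjective
    (d.codRestrict (LinearMap.ker d) fun x => hd.apply_apply_eq_zero x)
    (fun y => ((hd y).1 y.2).imp fun x hx => Subtype.ext hx) f (fun a ha => by
      obtain ⟨b, rfl⟩ := (hd a).1 (congrArg Subtype.val ha)
      exact LinearMap.congr_fun hf b)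
  obtain ⟨g, rfl⟩ := h.exists_extend k
  exact ⟨g, hk.symm⟩

/-- The Benson-Goodearl theorem: over a Noetherian ring, a pure acyclic differential projective
module is contractible. -/
theorem exists_contraction_of_character [IsNoetherianRing R] {C : Type u} [AddCommGroup C]
    [Module R C] [Module.Projective R C] (d : C →ₗ[R] C) (hd : d ∘ₗ d = 0)
    (h : ∀ (N : Type u) [AddCommGroup N] [Module R N], HE d (CharacterModule N)) :
    ∃ s : C →ₗ[R] C, LinearMap.id = d ∘ₗ s + s ∘ₗ d := by
  have key : ∀ (B : Type u) (d : (B →₀ R) →ₗ[R] (B →₀ R)), d ∘ₗ d = 0 →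
      (∀ N : ModuleCat.{u} R, HE d (ModuleCat.of R (CharacterModule N))) →
      Exact d d ∧ LocSplit (LinearMap.ker d) := fun B d hd h => by
    have := flat_quotient_ker d hd fun N _ _ => (HE_character_iff d hd N).1 (h (.of R N))
    exact ⟨(HE_character_self_iff d hd).1 (h (.of R R)), locSplit_of_flat _⟩
  refine nullHtpy_of_small_of_projective le_rfl
    (fun N : ModuleCat.{u} R => ModuleCat.of R (CharacterModule N)) d hd (fun B d hd h => ?_)
    (fun B d hB hd h => ?_) d hd (fun N => h N) LinearMap.id rfl
  · obtain ⟨hex, hK⟩ := key B d hd h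
    refine (((Stable.admitsClosure d).and le_rfl (exact_restr_admitsClosure d hex)).and le_rfl
      hK.admitsClosure).mono fun X hX => ⟨hX.1.1, fun N => ?_⟩
    obtain ⟨⟨hst, hX⟩, hK⟩ := hX
    have hker : (LinearMap.ker d).comap (incl X) = LinearMap.ker (restr d X) := by
      ext v
      rw [Submodule.mem_comap, LinearMap.mem_ker, LinearMap.mem_ker, ← hst.incl_restr,
        map_eq_zero_iff _ (incl_injective X)]
    refine HE.character_of_locSplit (fun v => ⟨fun hv => ?_, ?_⟩) (hker ▸ hK) N
    · obtain ⟨w, hw⟩ := hX v (by rw [← hst.incl_restr, hv, map_zero])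
      exact ⟨w, incl_injective X (by rw [hst.incl_restr, hw])⟩
    · rintro ⟨w, rfl⟩
      exact LinearMap.congr_fun (hst.restr_comp hd) w
  · obtain ⟨hex, hK⟩ := key B d hd h
    have : Countable B := mk_le_aleph0_iff.1 hB
    have := hK.projective
    obtain ⟨s, hs⟩ := exists_contraction_of_projective_ker hex
    exact NullHtpy.of_contraction s hs

end GorensteinPure

namespace GorensteinPure

open Function Cardinal TensorProduct

theorem exists_character_factor {X Y : Type*} [AddCommGroup X] [Module R X] [AddCommGroup Y]
    [Module R Y] (g : X →ₗ[R] Y) (φ : CharacterModule X) (h : ∀ x, g x = 0 → φ x = 0) :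
    ∃ ψ : CharacterModule Y, ∀ x, ψ (g x) = φ x := by
  obtain ⟨r, hr⟩ := exists_comp_eq_of_surjective (g.toAddMonoidHom.toIntLinearMap.rangeRestrict)
    (LinearMap.surjective_rangeRestrict _) φ.toIntLinearMap
    (fun x hx => h x (congrArg Subtype.val hx))
  obtain ⟨ψ, hψ⟩ := CharacterModule.dual_surjective_of_injective
    (LinearMap.range g.toAddMonoidHom.toIntLinearMap).subtype Subtype.val_injective r.toAddMonoidHom
  exact ⟨ψ, fun x => (DFunLike.congr_fun hψ ⟨g x, x, rfl⟩).trans (LinearMap.congr_fun hr x)⟩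

theorem character_sum_apply {ι X : Type*} [AddCommGroup X] (s : Finset ι)
    (x : ι → CharacterModule X) (e : X) : (∑ i ∈ s, x i) e = ∑ i ∈ s, x i e :=
  AddMonoidHom.finsetSum_apply (fun i => (x i : X →+ AddCircle (1 : ℚ))) s e

/-- Over a Noetherian ring the character module of an injective module is flat. -/
theorem flat_character_of_injective [IsNoetherianRing R] (I : Type u) [AddCommGroup I] [Module R I]
    [Module.Injective R I] : Module.Flat R (CharacterModule I) := by
  rw [Module.Flat.iff_forall_isTrivialRelation]
  intro l f x hx
  let u : (Fin l → R) →ₗ[R] R := Fintype.linearCombination R f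
  have hu : ∀ b, u b = ∑ i, f i * b i := fun b => by
    simp [u, Fintype.linearCombination_apply, mul_comm]
  obtain ⟨k, a, ha⟩ := Submodule.fg_iff_exists_fin_generating_family.1
    (IsNoetherian.noetherian (LinearMap.ker u))
  have ha0 : ∀ j, a j ∈ LinearMap.ker u := fun j => ha ▸ Submodule.subset_span ⟨j, rfl⟩
  let g : (Fin l → I) →ₗ[R] (Fin k → I) :=
    LinearMap.pi fun j => ∑ i, a j i • LinearMap.proj i
  have hg : ∀ e j, g e j = ∑ i, a j i • e i := fun e j => by simp [g]
  let φ : CharacterModule (Fin l → I) := ∑ i, CharacterModule.dual (LinearMap.proj (R := R) i) (x i)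
  have hφ : ∀ e, φ e = ∑ i, x i (e i) := fun e => character_sum_apply _ _ e
  obtain ⟨ψ, hψ⟩ := exists_character_factor g φ (fun e he => by
    have hker : LinearMap.ker u ≤ LinearMap.ker (Fintype.linearCombination R e) := by
      rw [← ha, Submodule.span_le]
      rintro _ ⟨j, rfl⟩
      simpa [Fintype.linearCombination_apply, hg] using congrFun he j
    obtain ⟨r, hr⟩ := exists_comp_eq_of_surjective u.rangeRestrict
      (LinearMap.surjective_rangeRestrict _) (Fintype.linearCombination R e)
      (fun b hb => hker (congrArg Subtype.val hb))
    obtain ⟨s, hs⟩ := Module.Injective.out (LinearMap.range u).subtype Subtype.val_injective r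
    have key : ∀ i, e i = f i • s 1 := fun i => by
      have h1 := LinearMap.congr_fun hr (Pi.single i 1)
      rw [LinearMap.comp_apply, ← hs] at h1
      have h2 : u (Pi.single i 1) = f i := by simp [hu, Pi.single_apply]
      have h3 : Fintype.linearCombination R e (Pi.single i 1) = e i := by
        simp [Fintype.linearCombination_apply, Pi.single_apply]
      rw [← h3, ← h1, ← map_smul, smul_eq_mul, mul_one, ← h2]
      rfl
    have h0 := DFunLike.congr_fun hx (s 1)
    rw [character_sum_apply] at h0
    rw [hφ]
    simp_rw [key]
    exact h0)
  refine ⟨k, fun i j => a j i,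
    fun j => CharacterModule.dual (LinearMap.single R (fun _ => I) j) ψ, fun i => ?_, fun j => ?_⟩
  · ext e
    have h1 := hψ (Pi.single i e)
    rw [hφ, Finset.sum_eq_single i (fun j _ hj => by rw [Pi.single_eq_of_ne hj, map_zero])
      (fun h => absurd (Finset.mem_univ i) h), Pi.single_eq_same] at h1
    rw [← h1, character_sum_apply, ← Finset.univ_sum_single
      (g (Pi.single i e)), map_sum]
    refine Finset.sum_congr rfl fun j _ => ?_
    rw [hg, Finset.sum_eq_single i (fun m _ hm => by rw [Pi.single_eq_of_ne hm, smul_zero])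
      (fun h => absurd (Finset.mem_univ i) h), Pi.single_eq_same]
    rfl
  · rw [← hu]; exact ha0 j

end GorensteinPure

namespace GorensteinPure

open Function Cardinal TensorProduct

section Closure

variable {κ : Cardinal.{u}} {B N T : Type u}

theorem mk_finsupp_le (hκ : ℵ₀ ≤ κ) (hB : #B ≤ κ) (hR : #R ≤ κ) : #(B →₀ R) ≤ κ :=
  (mk_le_of_injective (Finsupp.graph_injective B R)).trans
    ((mk_finset_le_max _).trans (max_le ((mk_prod _ _).trans_le
      (by simpa using mul_le_of_le hκ hB hR)) hκ))

theorem mk_span_le (hκ : ℵ₀ ≤ κ) (hR : #R ≤ κ) [AddCommGroup T] [Module R T] (S : Set T)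
    (hS : #S ≤ κ) : #(Submodule.span R S) ≤ κ := by
  have h : Surjective ((Finsupp.linearCombination R ((↑) : S → T)).rangeRestrict) :=
    LinearMap.surjective_rangeRestrict _
  rw [← Subtype.range_coe (s := S), ← Finsupp.range_linearCombination]
  exact (mk_le_of_surjective h).trans (mk_finsupp_le hκ hS hR)

theorem AdmitsClosure.of_le {κ' : Cardinal.{u}} {p : Set B → Prop} (h : AdmitsClosure κ' p)
    (hκ : κ' ≤ κ) : AdmitsClosure κ p :=
  let ⟨c, hc, h⟩ := h
  ⟨c, fun s => (hc s).trans hκ, h⟩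

theorem AdmitsClosure.of_finitary (hκ : ℵ₀ ≤ κ) (G : Set B → Set T) (hG : Monotone G)
    (hfin : ∀ X, ∀ z ∈ G X, ∃ s : Finset B, ↑s ⊆ X ∧ z ∈ G s) (huniv : G Set.univ = Set.univ)
    (hcard : ∀ s : Finset B, #(G s) ≤ κ) (w : T → T) :
    AdmitsClosure κ fun X => ∀ z ∈ G X, w z ∈ G X := by
  have h : ∀ z, ∃ s : Finset B, z ∈ G s := fun z =>
    let ⟨s, _, hs⟩ := hfin Set.univ z (huniv ▸ Set.mem_univ z)
    ⟨s, hs⟩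
  choose σ hσ using h
  refine ⟨fun s => ⋃ z : G s, (σ (w z) : Set B), fun s => ?_, fun X hX z hz => ?_⟩
  · refine mk_iUnion_le_sum_mk.trans ((sum_le_sum _ (fun _ => κ) fun z => ?_).trans ?_)
    · exact (Set.Countable.le_aleph0 (σ (w z)).countable_toSet).trans hκ
    · rw [sum_const']
      exact mul_le_of_le hκ (hcard s) le_rfl
  · obtain ⟨s, hs, hzs⟩ := hfin X z hz
    exact hG ((Set.subset_iUnion (fun z : G s => (σ (w z) : Set B)) ⟨z, hzs⟩).trans (hX s hs))
      (hσ (w z))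

theorem AdmitsClosure.span_image2 [AddCommGroup T] [Module R T] (hκ : ℵ₀ ≤ κ) (hR : #R ≤ κ)
    (hN : #N ≤ κ) (g : B → N → T)
    (htop : Submodule.span R (Set.image2 g Set.univ Set.univ) = ⊤) (w : T → T) :
    AdmitsClosure κ fun X => ∀ z ∈ Submodule.span R (Set.image2 g X Set.univ),
      w z ∈ Submodule.span R (Set.image2 g X Set.univ) := by
  refine AdmitsClosure.of_finitary hκ
    (fun X => (Submodule.span R (Set.image2 g X Set.univ) : Set T))
    (fun X Y h => Submodule.span_mono (Set.image2_subset_right h)) (fun X z hz => ?_)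
    (by rw [htop]; rfl) (fun s => mk_span_le hκ hR _ ?_) w
  · induction hz using Submodule.span_induction with
    | mem z hz =>
      obtain ⟨b, hb, n, -, rfl⟩ := hz
      exact ⟨{b}, by simpa using hb, Submodule.subset_span ⟨b, by simp, n, trivial, rfl⟩⟩
    | zero => exact ⟨∅, by simp, Submodule.zero_mem _⟩
    | add x y _ _ hx hy =>
      classical
      obtain ⟨s, hs, hx⟩ := hx
      obtain ⟨t, ht, hy⟩ := hy
      refine ⟨s ∪ t, by simp [hs, ht], Submodule.add_mem _ ?_ ?_⟩
      · exact Submodule.span_mono (Set.image2_subset_right (by simp)) hx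
      · exact Submodule.span_mono (Set.image2_subset_right (by simp)) hy
    | smul r x _ hx =>
      obtain ⟨s, hs, hx⟩ := hx
      exact ⟨s, hs, Submodule.smul_mem _ r hx⟩
  · rw [← Set.image_uncurry_prod]
    refine mk_image_le.trans ?_
    rw [mk_setProd, mk_univ]
    exact mul_le_of_le hκ ((Set.Countable.le_aleph0 s.countable_toSet).trans hκ) hN

theorem range_rTensor_eq_span {A M N ι : Type*} [AddCommGroup A] [Module R A] [AddCommGroup M]
    [Module R M] [AddCommGroup N] [Module R N] (i : A →ₗ[R] M) (v : ι → A)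
    (hv : Submodule.span R (Set.range v) = ⊤) :
    LinearMap.range (i.rTensor N) =
      Submodule.span R (Set.range fun x : ι × N => i (v x.1) ⊗ₜ[R] x.2) := by
  apply le_antisymm
  · rintro _ ⟨z, rfl⟩
    induction z with
    | zero => simp
    | add x y hx hy => rw [map_add]; exact Submodule.add_mem _ hx hy
    | tmul a n =>
      rw [LinearMap.rTensor_tmul]
      have ha : a ∈ Submodule.span R (Set.range v) := hv ▸ Submodule.mem_top
      induction ha using Submodule.span_induction with
      | mem a ha =>
        obtain ⟨x, rfl⟩ := ha
        exact Submodule.subset_span ⟨(x, n), rfl⟩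
      | zero => simp
      | add x y _ _ hx hy => rw [map_add, add_tmul]; exact Submodule.add_mem _ hx hy
      | smul r x _ hx => rw [map_smul, ← smul_tmul']; exact Submodule.smul_mem _ r hx
  · rw [Submodule.span_le]
    rintro _ ⟨x, rfl⟩
    exact ⟨v x.1 ⊗ₜ x.2, rfl⟩

theorem range_incl_rTensor [AddCommGroup N] [Module R N] (X : Set B) :
    LinearMap.range ((incl (R := R) X).rTensor N) =
      Submodule.span R (Set.image2 (fun b n => Finsupp.single b (1 : R) ⊗ₜ[R] n) X Set.univ) := by
  rw [range_rTensor_eq_span (incl X) (fun x : X => Finsupp.single x (1 : R))]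
  · congr 1
    ext z
    constructor
    · rintro ⟨⟨x, n⟩, rfl⟩
      exact ⟨x, x.2, n, trivial, by simp [incl]⟩
    · rintro ⟨x, hx, n, -, rfl⟩
      exact ⟨(⟨x, hx⟩, n), by simp [incl]⟩
  · rw [← Finsupp.coe_basisSingleOne, Module.Basis.span_eq]

theorem rTensor_incl_injective (N : Type*) [AddCommGroup N] [Module R N] (X : Set B) :
    Injective ((incl (R := R) X).rTensor N) := by
  refine LeftInverse.injective (g := (proj X).rTensor N) fun z => ?_
  rw [← LinearMap.rTensor_comp_apply, show proj X ∘ₗ incl (R := R) X = LinearMap.id from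
    LinearMap.ext (proj_incl X), LinearMap.rTensor_id_apply]

theorem HE_restr_character_admitsClosure (hκ : ℵ₀ ≤ κ) (hR : #R ≤ κ) (d : (B →₀ R) →ₗ[R] (B →₀ R))
    (hd : d ∘ₗ d = 0) [AddCommGroup N] [Module R N] (hN : #N ≤ κ) (h : HE d (CharacterModule N)) :
    AdmitsClosure κ fun X => Stable d X ∧ HE (restr d X) (CharacterModule N) := by
  rw [HE_character_iff d hd] at h
  have h' : ∀ z, ∃ w, d.rTensor N z = 0 → d.rTensor N w = z := fun z => by
    by_cases hz : d.rTensor N z = 0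
    · obtain ⟨w, hw⟩ := (h z).1 hz
      exact ⟨w, fun _ => hw⟩
    · exact ⟨0, fun h => absurd h hz⟩
  choose w hw using h'
  have htop : Submodule.span R (Set.image2 (fun (b : B) (n : N) =>
      Finsupp.single b (1 : R) ⊗ₜ[R] n) Set.univ Set.univ) = ⊤ := by
    rw [← range_incl_rTensor, LinearMap.range_eq_top]
    exact LinearMap.rTensor_surjective N fun v =>
      ⟨proj Set.univ v, incl_proj _ (by simp)⟩
  obtain ⟨c, hc, hX⟩ := ((Stable.admitsClosure d).of_le hκ).and hκ
    (AdmitsClosure.span_image2 hκ hR hN _ htop w)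
  refine ⟨c, hc, fun X hcX => ?_⟩
  obtain ⟨hS, hX⟩ := hX X hcX
  refine ⟨hS, (HE_character_iff _ (hS.restr_comp hd) N).2 fun z => ⟨fun hz => ?_, ?_⟩⟩
  · have hcomm : ∀ z, (incl X).rTensor N ((restr d X).rTensor N z) =
        d.rTensor N ((incl X).rTensor N z) := fun z => by
      rw [← LinearMap.rTensor_comp_apply, ← LinearMap.rTensor_comp_apply,
        show incl X ∘ₗ restr d X = d ∘ₗ incl X from LinearMap.ext hS.incl_restr]
    have h1 := hw ((incl X).rTensor N z) (by rw [← hcomm, hz, map_zero])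
    have h2 := hX ((incl X).rTensor N z) (by rw [← range_incl_rTensor]; exact ⟨z, rfl⟩)
    rw [← range_incl_rTensor] at h2
    obtain ⟨y, hy⟩ := h2
    refine ⟨y, rTensor_incl_injective N X ?_⟩
    rw [hcomm, hy, h1]
  · rintro ⟨y, rfl⟩
    rw [← LinearMap.rTensor_comp_apply, hS.restr_comp hd, LinearMap.rTensor_zero]
    rfl

end Closure

section Transfinite

variable {B A E : Type u} [AddCommGroup A] [Module R A] [AddCommGroup E] [Module R E]

/-- Eklof's lemma along a filtration indexed by closed subsets. -/
theorem E1.of_filtration {κ : Cardinal.{u}} (hκ : ℵ₀ ≤ κ) (hB : κ < #B)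
    (c : Finset B → Set B) (hc : ∀ s, #(c s) ≤ κ) (A' : Set B → Submodule R A) (hA : Monotone A')
    (hAuniv : A' Set.univ = ⊤)
    (hAcont : ∀ S : Set (Set B), S.Nonempty → DirectedOn (· ⊆ ·) S →
      ∀ x ∈ A' (⋃₀ S), ∃ X ∈ S, x ∈ A' X)
    (base : ∀ X, ClosedUnder c X → #X < #B → E1 (R := R) (A' X) E)
    (step : ∀ X X', ClosedUnder c X → ClosedUnder c X' → X ⊆ X' → #X' < #B →
      E1 (R := R) (A' X' ⧸ (A' X).submoduleOf (A' X')) E) : E1 (R := R) A E := by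
  let p : (A →₀ R) →ₗ[R] A := Finsupp.linearCombination R id
  have hp : Surjective p := Finsupp.linearCombination_surjective R surjective_id
  refine E1.of_presentation p hp fun f => ?_
  obtain ⟨g, hg, hgtop⟩ := exists_linearPMap_of_chain (Y := E) hκ hB c hc
    (fun X => (A' X).comap p) (fun X Y h => Submodule.comap_mono (hA h)) (by simp [hAuniv])
    (fun S hne hdir x hx => hAcont S hne hdir _ hx)
    (fun g => ∀ (k : LinearMap.ker p) (h : k.1 ∈ g.domain), g ⟨k, h⟩ = f k)
    (fun S hS hne hgood k hk => by
      obtain ⟨q, hq, hkq⟩ := (LinearPMap.mem_domain_sSup_iff hne hS).1 hk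
      rw [← hgood q hq k hkq]
      exact ((LinearPMap.le_sSup hS hq).2 rfl).symm)
    (fun X hX hXB => by
      obtain ⟨g, hg⟩ := (base X hX hXB).extend (K := LinearMap.ker p) (P := (A' X).comap p)
        ((LinearMap.ker p).subtype.codRestrict ((A' X).comap p) fun k => by simp)
        (p.restrict (p := (A' X).comap p) (q := A' X) fun _ h => h)
        (fun k k' h => Subtype.ext (congrArg (fun t => t.1) h))
        (fun x => ⟨fun hx => ⟨⟨x, by exact congrArg Subtype.val hx⟩, rfl⟩, by
          rintro ⟨k, rfl⟩
          exact Subtype.ext k.2⟩)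
        (fun a => by
          obtain ⟨x, hx⟩ := hp a
          exact ⟨⟨x, by simp [hx]⟩, Subtype.ext hx⟩) f
      exact ⟨⟨_, g⟩, fun k hk => LinearMap.congr_fun hg k, rfl⟩)
    (fun X X' hX hX' hXX hXB g hg hdom => by
      obtain ⟨D, g⟩ := g
      obtain rfl : D = (A' X).comap p := hdom
      obtain ⟨g', hg'⟩ := (step X X' hX hX' hXX hXB).extend
        (K := (A' X).comap p) (P := (A' X').comap p)
        (Submodule.inclusion (Submodule.comap_mono (f := p) (hA hXX)))
        (Submodule.mkQ _ ∘ₗ p.restrict (p := (A' X').comap p) (q := A' X') fun _ h => h)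
        (Submodule.inclusion_injective _)
        (fun x => by
          rw [LinearMap.comp_apply, Submodule.mkQ_apply, Submodule.Quotient.mk_eq_zero]
          exact ⟨fun hx => ⟨⟨x, hx⟩, rfl⟩, by rintro ⟨k, rfl⟩; exact k.2⟩)
        ((Submodule.mkQ_surjective _).comp fun a => by
          obtain ⟨x, hx⟩ := hp a
          exact ⟨⟨x, by simp [hx]⟩, Subtype.ext hx⟩) g
      have hgg : ∀ x, g' (Submodule.inclusion (Submodule.comap_mono (f := p) (hA hXX)) x) = g x :=
        LinearMap.congr_fun hg'
      refine ⟨⟨_, g'⟩, fun k hk => ?_, ⟨Submodule.comap_mono (hA hXX), fun x y hxy => ?_⟩, rfl⟩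
      · have hk0 : k.1 ∈ (A' X).comap p := by simp
        rw [← hg k hk0]
        exact hgg ⟨k, hk0⟩
      · have : y = Submodule.inclusion (Submodule.comap_mono (f := p) (hA hXX)) x :=
          Subtype.ext hxy.symm
        rw [this]
        exact (hgg x).symm)
  obtain ⟨D, g⟩ := g
  obtain rfl : D = ⊤ := hgtop
  exact ⟨g ∘ₗ Submodule.topEquiv.symm.toLinearMap, LinearMap.ext fun k => hg k trivial⟩

end Transfinite

end GorensteinPure

namespace GorensteinPure

open Function

theorem isGorensteinInjective_of_seq (I : ℤ → ModuleCat.{u} R) (hI : ∀ n, Module.Injective R (I n))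
    (δ : ∀ n, I n →ₗ[R] I (n + 1)) (hδ : ∀ n, Exact (δ n) (δ (n + 1)))
    (h : ∀ (J : Type u) [AddCommGroup J] [Module R J] [Module.Injective R J] (n : ℤ)
      (f : J →ₗ[R] I (n + 1)), δ (n + 1) ∘ₗ f = 0 → ∃ g : J →ₗ[R] I n, f = δ n ∘ₗ g)
    (E : ModuleCat.{u} R) (e : E →ₗ[R] I 0) (he : Injective e) (heδ : Exact e (δ 0)) :
    IsGorensteinInjective E := by
  let C : CochainComplex (ModuleCat.{u} R) ℤ := CochainComplex.of I
    (fun n => ModuleCat.ofHom (δ n)) (fun n => ModuleCat.hom_ext (hδ n).linearMap_comp_eq_zero)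
  have hCd : ∀ n, C.d n (n + 1) = ModuleCat.ofHom (δ n) := fun n =>
    CochainComplex.of_d I (fun n => ModuleCat.ofHom (δ n)) n
  refine ⟨C, fun n => Module.injective_object_of_injective_module (inj := hI n),
    fun n => ?_, ?_, fun J hJ i f hf => ?_⟩
  · obtain ⟨m, rfl⟩ : ∃ m, m + 1 = n := ⟨n - 1, by omega⟩
    rw [HomologicalComplex.exactAt_iff' C m (m + 1) (m + 1 + 1) (by simp) (by simp),
      ShortComplex.ShortExact.moduleCat_exact_iff_function_exact]
    dsimp only [HomologicalComplex.sc', HomologicalComplex.shortComplexFunctor']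
    rw [hCd, hCd]
    exact hδ m
  · let S : ShortComplex (ModuleCat.{u} R) := ShortComplex.mk (ModuleCat.ofHom e) (C.d 0 1) (by
      rw [show C.d 0 1 = ModuleCat.ofHom (δ 0) from hCd 0]
      exact ModuleCat.hom_ext heδ.linearMap_comp_eq_zero)
    have hS : S.Exact := (ShortComplex.ShortExact.moduleCat_exact_iff_function_exact _).2 (by
      dsimp only [S]
      rw [show C.d 0 1 = ModuleCat.ofHom (δ 0) from hCd 0]
      exact heδ)
    have : Mono S.f := (ModuleCat.mono_iff_injective _).2 he
    exact ⟨hS.fIsKernel.conePointUniqueUpToIso (limit.isLimit _)⟩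
  · have key : ∀ i j, j + 1 = i → ∀ f : J ⟶ C.X i, f ≫ C.d i (i + 1) = 0 →
        ∃ g : J ⟶ C.X j, f = g ≫ C.d j i := by
      rintro _ j rfl f hf
      have := Module.injective_module_of_injective_object (R := R) (M := J)
      rw [hCd] at hf
      obtain ⟨g, hg⟩ := h J j f.hom (ModuleCat.hom_ext_iff.1 hf)
      exact ⟨ModuleCat.ofHom g, by rw [hCd]; exact ModuleCat.hom_ext hg⟩
    exact key i (i - 1) (by omega) f hf

/-- Right orthogonality to all Gorenstein projective modules. -/
def W (M : Type u) [AddCommGroup M] [Module R M] : Prop :=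
  ∀ (C : Type u) [AddCommGroup C] [Module R C] (d : C →ₗ[R] C), TA d → HE d M

section W

variable {X Y Z : Type u} [AddCommGroup X] [Module R X] [AddCommGroup Y] [Module R Y]
  [AddCommGroup Z] [Module R Z]

theorem W.congr (h : W (R := R) Y) (e : X ≃ₗ[R] Y) : W (R := R) X :=
  fun C _ _ d hd => (h C d hd).congr_equiv e

theorem W.of_projective [Module.Projective R X] : W (R := R) X := fun _ _ _ _ hd => hd.he X

theorem W.of_injective [Module.Injective R X] : W (R := R) X :=
  fun _ _ _ _ hd => HE.of_injective hd.exact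

section

variable (i : X →ₗ[R] Y) (p : Y →ₗ[R] Z) (hi : Injective i) (hip : Exact i p) (hp : Surjective p)
include hi hip hp

theorem W.mid (hX : W (R := R) X) (hZ : W (R := R) Z) : W (R := R) Y := fun C _ _ d hd =>
  have := hd.projective
  HE.mid hd.exact.linearMap_comp_eq_zero i p hi hip hp (hX C d hd) (hZ C d hd)

theorem W.right (hY : W (R := R) Y) (hX : W (R := R) X) : W (R := R) Z := fun C _ _ d hd =>
  have := hd.projective
  HE.right hd.exact.linearMap_comp_eq_zero i p hi hip hp (hY C d hd) (hX C d hd)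

theorem W.left (hY : W (R := R) Y) (hZ : W (R := R) Z) : W (R := R) X := fun C _ _ d hd =>
  have := hd.projective
  HE.left hd.exact.linearMap_comp_eq_zero i p hi hip hp (hY C d hd) (hZ C d hd)

end

theorem W.quotient {A : Type u} [AddCommGroup A] [Module R A] {A₁ A₂ : Submodule R A}
    (h : A₁ ≤ A₂) (h₂ : W (R := R) A₂) (h₁ : W (R := R) A₁) :
    W (R := R) (A₂ ⧸ A₁.submoduleOf A₂) :=
  W.right (Submodule.inclusion h) (A₁.submoduleOf A₂).mkQ (Submodule.inclusion_injective h)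
    (fun x => by
      rw [Submodule.mkQ_apply, Submodule.Quotient.mk_eq_zero]
      exact ⟨fun hx => ⟨⟨x, hx⟩, rfl⟩, by rintro ⟨k, rfl⟩; exact k.2⟩)
    (Submodule.mkQ_surjective _) h₂ h₁

end W

/-- The virtually Gorenstein condition. -/
abbrev VG (R : Type u) [CommRing R] : Prop :=
  ∀ M : ModuleCat.{u} R, MemGPperp M ↔ MemPerpGI M

theorem VG.W_iff (hVG : VG R) (M : Type u) [AddCommGroup M] [Module R M] : W (R := R) M ↔
    ∀ E : ModuleCat.{u} R, IsGorensteinInjective E → E1 (R := R) M E := by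
  rw [W, ← memGPperp_iff (ModuleCat.of R M), hVG]
  exact forall₂_congr fun E _ => extVanish_one_iff _ _

/-- Periodic complexes of projective modules that stay exact after tensoring with any injective
module. -/
structure PGF {C : Type u} [AddCommGroup C] [Module R C] (d : C →ₗ[R] C) : Prop where
  projective : Module.Projective R C
  exact : Exact d d
  he : ∀ (I : Type u) [AddCommGroup I] [Module R I] [Module.Injective R I],
    HE d (CharacterModule I)

/-- Exchange of the arguments of a bilinear pairing. -/
def swap {A B : Type*} [AddCommGroup A] [Module R A] [AddCommGroup B] [Module R B]
    (f : A →ₗ[R] CharacterModule B) : B →ₗ[R] CharacterModule A where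
  toFun b :=
    { toFun := fun a => f a b
      map_zero' := by rw [map_zero]; rfl
      map_add' := fun a a' => by rw [map_add]; rfl }
  map_add' b b' := by ext a; exact map_add (f a) b b'
  map_smul' r b := by
    ext a
    change f a (r • b) = f (r • a) b
    rw [map_smul f]
    rfl

section PGF

variable {C : Type u} [AddCommGroup C] [Module R C] {d : C →ₗ[R] C}

theorem PGF.sq (h : PGF d) : d ∘ₗ d = 0 := h.exact.linearMap_comp_eq_zero

theorem exact_dual (hd : Exact d d) : Exact (CharacterModule.dual d) (CharacterModule.dual d) := by
  intro φ
  constructor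
  · intro hφ
    obtain ⟨ψ, hψ⟩ := exists_character_factor d φ (fun x hx => by
      obtain ⟨y, rfl⟩ := (hd x).1 hx
      exact DFunLike.congr_fun hφ y)
    exact ⟨ψ, DFunLike.ext _ _ hψ⟩
  · rintro ⟨ψ, rfl⟩
    ext x
    change ψ (d (d x)) = 0
    rw [hd.apply_apply_eq_zero, map_zero]

theorem PGF.isGorensteinInjective (h : PGF d) :
    IsGorensteinInjective (ModuleCat.of R (LinearMap.ker (CharacterModule.dual d))) := by
  have := h.projective
  refine isGorensteinInjective_of_seq (fun _ => ModuleCat.of R (CharacterModule C))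
    (fun _ => (Module.Flat.iff_characterModule_injective (R := R) (M := C)).1 inferInstance)
    (fun _ => CharacterModule.dual d) (fun _ => exact_dual h.exact) (fun J _ _ _ _ f hf => ?_) _
    (LinearMap.ker (CharacterModule.dual d)).subtype Subtype.val_injective
    (fun x => by simp)
  obtain ⟨g, hg⟩ := h.he J (swap f) (by
    ext c j
    exact DFunLike.congr_fun (LinearMap.congr_fun hf j) c)
  exact ⟨swap g, by ext j c; exact DFunLike.congr_fun (LinearMap.congr_fun hg c) j⟩

theorem W.he_character (hVG : VG R) {M : Type u} [AddCommGroup M] [Module R M] (hM : W (R := R) M)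
    (h : PGF d) : HE d (CharacterModule M) := by
  intro f hf
  obtain ⟨g, hg⟩ := ((hVG.W_iff M).1 hM _ h.isGorensteinInjective).lift
    (LinearMap.ker (CharacterModule.dual d)).subtype (CharacterModule.dual d).rangeRestrict
    Subtype.val_injective (fun x => by simp [Subtype.ext_iff])
    (LinearMap.surjective_rangeRestrict _) ((swap f).codRestrict _ fun m => by
      rw [LinearMap.mem_range]
      refine (exact_dual h.exact (swap f m)).1 ?_
      ext c
      exact DFunLike.congr_fun (LinearMap.congr_fun hf c) m)
  refine ⟨swap g, ?_⟩
  ext c m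
  exact (DFunLike.congr_fun (congrArg Subtype.val (LinearMap.congr_fun hg m)) c).symm

end PGF

end GorensteinPure

namespace GorensteinPure

open Function Cardinal TensorProduct

theorem W.of_filtration (hVG : VG R) {B A : Type u} [AddCommGroup A] [Module R A]
    {κ : Cardinal.{u}} (hκ : ℵ₀ ≤ κ) (hB : κ < #B) (c : Finset B → Set B) (hc : ∀ s, #(c s) ≤ κ)
    (A' : Set B → Submodule R A) (hA : Monotone A') (hAuniv : A' Set.univ = ⊤)
    (hAcont : ∀ S : Set (Set B), S.Nonempty → DirectedOn (· ⊆ ·) S →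
      ∀ x ∈ A' (⋃₀ S), ∃ X ∈ S, x ∈ A' X)
    (h : ∀ X, ClosedUnder c X → #X < #B → W (R := R) (A' X)) : W (R := R) A :=
  (hVG.W_iff A).2 fun E hE => E1.of_filtration hκ hB c hc A' hA hAuniv hAcont
    (fun X hX hXB => (hVG.W_iff _).1 (h X hX hXB) E hE)
    (fun X X' hX hX' hXX' hXB => (hVG.W_iff _).1 (W.quotient (hA hXX') (h X' hX' hXB)
      (h X hX ((mk_le_mk_of_subset hXX').trans_lt hXB))) E hE)

theorem W.of_locSplit [IsNoetherianRing R] (hVG : VG R) (B : Type u) (K : Submodule R (B →₀ R))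
    (hK : LocSplit K) : W (R := R) ((B →₀ R) ⧸ K) := by
  induction hμ : #B using WellFoundedLT.induction generalizing B with
  | ind μ ih =>
    subst hμ
    rcases le_or_gt #B ℵ₀ with hB | hB
    · have : Countable B := mk_le_aleph0_iff.1 hB
      have := hK.projective
      exact W.right (X := K) (Y := B →₀ R) K.subtype K.mkQ Subtype.val_injective
        (LinearMap.exact_subtype_mkQ K) K.mkQ_surjective W.of_projective W.of_projective
    · obtain ⟨c, hc, h⟩ := hK.admitsClosure
      refine W.of_filtration hVG le_rfl hB c hc
        (fun X => (Finsupp.supported R R X).map K.mkQ)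
        (fun X Y hXY => Submodule.map_mono (Finsupp.supported_mono hXY)) ?_ ?_ fun X hX hXB => ?_
      · rw [Finsupp.supported_univ, Submodule.map_top, Submodule.range_mkQ]
      · rintro S hS hdir _ ⟨v, hv, rfl⟩
        obtain ⟨X, hXS, hX⟩ := hdir.exists_mem_subset_of_finite_of_subset_sUnion hS
          v.support.finite_toSet ((Finsupp.mem_supported R v).1 hv)
        exact ⟨X, hXS, v, hX, rfl⟩
      · have e : ((X →₀ R) ⧸ K.comap (incl X)) ≃ₗ[R] (Finsupp.supported R R X).map K.mkQ := by
          have hr : LinearMap.range (K.mkQ ∘ₗ incl X) = (Finsupp.supported R R X).map K.mkQ := by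
            rw [LinearMap.range_comp]
            congr 1
            refine le_antisymm ?_ fun v hv => ⟨proj X v, incl_proj X hv⟩
            rintro _ ⟨v, rfl⟩
            exact incl_mem X v
          have hk : LinearMap.ker (K.mkQ ∘ₗ incl X) = K.comap (incl X) := by
            rw [LinearMap.ker_comp, Submodule.ker_mkQ]
          exact (Submodule.quotEquivOfEq _ _ hk.symm).trans
            ((K.mkQ ∘ₗ incl X).quotKerEquivRange.trans (LinearEquiv.ofEq _ _ hr))
        exact (ih #X hXB X _ (h X hX) rfl).congr e.symm

theorem W.of_flat [IsNoetherianRing R] (hVG : VG R) (M : Type u) [AddCommGroup M] [Module R M]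
    [Module.Flat R M] : W (R := R) M := by
  let p : (M →₀ R) →ₗ[R] M := Finsupp.linearCombination R id
  have e : ((M →₀ R) ⧸ LinearMap.ker p) ≃ₗ[R] M := p.quotKerEquivOfSurjective
    (Finsupp.linearCombination_id_surjective R M)
  have : Module.Flat R ((M →₀ R) ⧸ LinearMap.ker p) := Module.Flat.of_linearEquiv e
  exact (W.of_locSplit hVG M _ (locSplit_of_flat _)).congr e.symm

theorem TA.pgf [IsNoetherianRing R] (hVG : VG R) {C : Type u} [AddCommGroup C] [Module R C]
    {d : C →ₗ[R] C} (h : TA d) : PGF d where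
  projective := h.projective
  exact := h.exact
  he I _ _ _ := by
    have := flat_character_of_injective (R := R) I
    exact W.of_flat hVG (CharacterModule I) C d h

/-- Injective modules detecting exactness of a periodic complex of flat modules after tensoring
with an arbitrary injective module: the injective hulls of finitely generated modules. -/
noncomputable def testModule : Option (Σ n : ℕ, Submodule R (Fin n → R)) → ModuleCat.{u} R
  | none => ModuleCat.of R R
  | some s => Injective.under (ModuleCat.of R ((Fin s.1 → R) ⧸ s.2))

theorem rTensor_lTensor_comm {C N N' : Type*} [AddCommGroup C] [Module R C] [AddCommGroup N]
    [Module R N] [AddCommGroup N'] [Module R N'] (d : C →ₗ[R] C) (g : N →ₗ[R] N') (z : C ⊗[R] N) :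
    d.rTensor N' (g.lTensor C z) = g.lTensor C (d.rTensor N z) := by
  rw [← LinearMap.comp_apply, ← LinearMap.comp_apply, LinearMap.rTensor_comp_lTensor,
    LinearMap.lTensor_comp_rTensor]

theorem pgf_iff {C : Type u} [AddCommGroup C] [Module R C] [Module.Projective R C]
    (d : C →ₗ[R] C) (hd : d ∘ₗ d = 0) :
    (∀ s, HE d (CharacterModule (testModule (R := R) s))) ↔ PGF d := by
  constructor
  · intro h
    refine ⟨inferInstance, (HE_character_self_iff d hd).1 (h none), fun I _ _ _ => ?_⟩
    rw [HE_character_iff d hd]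
    intro z
    constructor
    · intro hz
      obtain ⟨N, hN, hzN⟩ := TensorProduct.exists_finite_submodule_right_of_setFinite {z}
        (Set.finite_singleton z)
      obtain ⟨z', rfl⟩ := hzN rfl
      obtain ⟨n, S, ⟨e⟩⟩ := Module.Finite.exists_fin_quot_equiv R N
      let ι : ((Fin n → R) ⧸ S) →ₗ[R] testModule (some ⟨n, S⟩) :=
        (Injective.ι (ModuleCat.of R ((Fin n → R) ⧸ S))).hom
      have hι : Injective ι := (ModuleCat.mono_iff_injective _).1 inferInstance
      obtain ⟨g, hg⟩ := Module.Injective.out (R := R) (Q := I) (ι ∘ₗ e.symm.toLinearMap)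
        (hι.comp e.symm.injective) N.subtype
      have hz' : d.rTensor N z' = 0 := by
        rw [rTensor_lTensor_comm] at hz
        exact (injective_iff_map_eq_zero _).1
          (Module.Flat.lTensor_preserves_injective_linearMap (M := C) N.subtype
            Subtype.val_injective) _ hz
      obtain ⟨w, hw⟩ := ((HE_character_iff d hd _).1 (h (some ⟨n, S⟩))
        ((ι ∘ₗ e.symm.toLinearMap).lTensor C z')).1 (by rw [rTensor_lTensor_comm, hz', map_zero])
      refine ⟨g.lTensor C w, ?_⟩
      rw [rTensor_lTensor_comm, hw, ← LinearMap.lTensor_comp_apply]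
      congr 2
      exact LinearMap.ext hg
    · rintro ⟨w, rfl⟩
      rw [← LinearMap.rTensor_comp_apply, hd, LinearMap.rTensor_zero, LinearMap.zero_apply]
  · rintro h (_ | ⟨n, S⟩)
    · exact (HE_character_self_iff d hd).2 h.exact
    · have : Injective (testModule (R := R) (some ⟨n, S⟩)) :=
        inferInstanceAs (Injective (Injective.under _))
      have := Module.injective_module_of_injective_object (R := R)
        (M := testModule (some ⟨n, S⟩))
      exact h.he _

variable (R) in
/-- A cardinal bounding the ring and all test modules. -/
noncomputable def testCardinal : Cardinal.{u} :=
  max ℵ₀ (max #R (max #(Option (Σ n : ℕ, Submodule R (Fin n → R)))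
    (sum fun s => #(testModule (R := R) s))))

variable (R) in
theorem aleph0_le_testCardinal : ℵ₀ ≤ testCardinal R := le_max_left _ _

variable (R) in
theorem mk_le_testCardinal : #R ≤ testCardinal R := (le_max_left _ _).trans (le_max_right _ _)

variable (R) in
/-- Representatives of the `PGF` complexes on few generators. -/
abbrev SmallPGF : Type u :=
  {x : Σ X : Set (testCardinal R).out, (X →₀ R) →ₗ[R] (X →₀ R) // PGF (R := R) x.2}

theorem nullHtpy_of_smallPGF {Y : Type u} [AddCommGroup Y] [Module R Y] (δ : Y →ₗ[R] Y)
    (hδ : δ ∘ₗ δ = 0) (h : ∀ s : SmallPGF R, NullHtpy (R := R) s.1.2 δ) {C : Type u} [AddCommGroup C]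
    [Module R C] (d : C →ₗ[R] C) (hd : PGF d) : NullHtpy d δ := by
  have := hd.projective
  refine nullHtpy_of_small_of_projective (aleph0_le_testCardinal R)
    (fun s => ModuleCat.of R (CharacterModule (testModule (R := R) s))) δ hδ
    (fun B d hd hT => ?_) (fun B d hB hd hT => ?_) d hd.sq ((pgf_iff d hd.sq).2 hd)
  · refine (AdmitsClosure.forall (aleph0_le_testCardinal R) ?_ fun s =>
      HE_restr_character_admitsClosure (aleph0_le_testCardinal R) (mk_le_testCardinal R) d hd
        (N := testModule (R := R) s) ?_ (hT s)).mono fun X hX => ⟨(hX none).1, fun s => (hX s).2⟩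
    · exact (le_max_left _ _).trans ((le_max_right _ _).trans (le_max_right _ _))
    · exact (le_sum (fun s => #(testModule (R := R) s)) s).trans
        ((le_max_right _ _).trans ((le_max_right _ _).trans (le_max_right _ _)))
  · rw [← mk_out (testCardinal R)] at hB
    obtain ⟨f⟩ := hB
    let e : (B →₀ R) ≃ₗ[R] (Set.range f →₀ R) :=
      Finsupp.domLCongr (Equiv.ofInjective f f.injective)
    let d' := e.toLinearMap ∘ₗ d ∘ₗ e.symm.toLinearMap
    have hd' : d' ∘ₗ d' = 0 := by
      have hdd : ∀ x, d (d x) = 0 := LinearMap.congr_fun hd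
      refine LinearMap.ext fun x => ?_
      simp [d', hdd]
    have hP : PGF d' := (pgf_iff d' hd').1 fun s => (hT s).of_chain_retract e.symm.toLinearMap
      e.toLinearMap (by simp) (LinearMap.ext fun x => by simp [d'])
      (LinearMap.ext fun x => by simp [d'])
    exact (h ⟨⟨Set.range f, d'⟩, hP⟩).of_chain_retract e.toLinearMap e.symm.toLinearMap (by simp)
      (LinearMap.ext fun x => by simp [d']) (LinearMap.ext fun x => by simp [d'])

theorem nullHtpy_zero_iff {C Y : Type*} [AddCommGroup C] [Module R C] [AddCommGroup Y]
    [Module R Y] (d : C →ₗ[R] C) : NullHtpy d (0 : Y →ₗ[R] Y) ↔ HE d Y := by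
  simp [NullHtpy, HE, eq_comm (a := (0 : C →ₗ[R] Y))]

theorem HE_of_smallPGF {Y : Type u} [AddCommGroup Y] [Module R Y]
    (h : ∀ s : SmallPGF R, HE (R := R) s.1.2 Y) {C : Type u} [AddCommGroup C] [Module R C]
    (d : C →ₗ[R] C) (hd : PGF d) : HE d Y :=
  (nullHtpy_zero_iff d).1 (nullHtpy_of_smallPGF 0 (LinearMap.zero_comp _)
    (fun s => (nullHtpy_zero_iff _).2 (h s)) d hd)

end GorensteinPure

namespace GorensteinPure

open MorphismProperty Function ZeroObject

theorem hasSmallObjectArgument_ofHoms {𝒞 : Type (u + 1)} [Category.{u} 𝒞] [Abelian 𝒞]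
    [IsGrothendieckAbelian.{u} 𝒞] {ι : Type u} {A B : ι → 𝒞} (f : ∀ i, A i ⟶ B i)
    [∀ i, Mono (f i)] : HasSmallObjectArgument.{u} (ofHoms f) := by
  obtain ⟨κ, hκ', hκ⟩ := HasCardinalLT.exists_regular_cardinal.{u} (Σ i, Subobject (A i))
  have : Fact κ.IsRegular := ⟨hκ'⟩
  have : Nonempty κ.ord.ToType := by simpa using hκ'.ne_zero
  have := WellFoundedLT.toOrderBot κ.ord.ToType
  have hmono : ofHoms f ≤ monomorphisms 𝒞 := by
    rintro _ _ _ ⟨i⟩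
    exact inferInstanceAs (Mono (f i))
  exact ⟨κ, inferInstance, inferInstance,
    { preservesColimit {A B X Y} i hi g hg := by
        let hg' : (monomorphisms 𝒞).TransfiniteCompositionOfShape κ.ord.ToType g :=
          { toTransfiniteCompositionOfShape := hg.toTransfiniteCompositionOfShape
            map_mem j hj := by
              have := (hg.attachCells j hj).pushouts_coproducts
              simp only [ofHoms_homFamily] at this
              refine (?_ : _ ≤ monomorphisms 𝒞) _ this
              simp only [pushouts_le_iff, coproducts_le_iff]
              exact hmono }
        have (j j' : κ.ord.ToType) (φ : j ⟶ j') : Mono (hg'.F.map φ) := hg'.mem_map φ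
        apply IsGrothendieckAbelian.preservesColimit_coyoneda_obj_of_mono (Y := hg'.F) (κ := κ)
        obtain ⟨s⟩ := hi
        exact hκ.of_injective (fun x => (⟨s, x⟩ : Σ i, Subobject _))
          (fun x y h => by simpa using h) }⟩

/-- Factorization of a morphism produced by the small object argument. -/
theorem exists_factorization_ofHoms {𝒞 : Type (u + 1)} [Category.{u} 𝒞] [Abelian 𝒞]
    [IsGrothendieckAbelian.{u} 𝒞] {ι : Type u} {A B : ι → 𝒞} (f : ∀ i, A i ⟶ B i)
    [∀ i, Mono (f i)] {X Y : 𝒞} (g : X ⟶ Y) :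
    ∃ (Z : 𝒞) (a : X ⟶ Z) (b : Z ⟶ Y), a ≫ b = g ∧ (ofHoms f).rlp.llp a ∧
      (ofHoms f).rlp b := by
  have := hasSmallObjectArgument_ofHoms f
  let fac := (functorialFactorizationData (ofHoms f).rlp.llp (ofHoms f).rlp).factorizationData g
  exact ⟨fac.Z, fac.i, fac.p, fac.fac, fac.hi, fac.hp⟩

theorem exists_lift_of_llp_rlp {𝒞 : Type*} [Category* 𝒞] {T : MorphismProperty 𝒞} {A B X Y : 𝒞}
    {a : A ⟶ B} {b : X ⟶ Y} (ha : T.rlp.llp a) (hb : T.rlp b) (f : A ⟶ X) (g : B ⟶ Y)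
    (w : f ≫ b = a ≫ g) : ∃ l : B ⟶ X, a ≫ l = f ∧ l ≫ b = g := by
  have := ha b hb
  have sq : CommSq f a b g := ⟨w⟩
  exact ⟨sq.lift, sq.fac_left, sq.fac_right⟩

theorem rlp_ofHoms {𝒞 : Type*} [Category* 𝒞] {ι : Type*} {A B : ι → 𝒞} (f : ∀ i, A i ⟶ B i)
    {X Y : 𝒞} (p : X ⟶ Y) (h : ∀ i (u : A i ⟶ X) (v : B i ⟶ Y), u ≫ p = f i ≫ v →
      ∃ l : B i ⟶ X, f i ≫ l = u ∧ l ≫ p = v) : (ofHoms f).rlp p := by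
  rintro _ _ _ ⟨i⟩
  refine ⟨fun {u v} sq => ?_⟩
  obtain ⟨l, h₁, h₂⟩ := h i u v sq.w
  exact ⟨⟨⟨l, h₁, h₂⟩⟩⟩

theorem E1.of_lift {A E X Q : Type u} [AddCommGroup A] [Module R A] [AddCommGroup E] [Module R E]
    [AddCommGroup X] [Module R X] [AddCommGroup Q] [Module R Q] [Module.Injective R X]
    (i : E →ₗ[R] X) (q : X →ₗ[R] Q) (hi : Injective i) (hiq : Exact i q)
    (h : ∀ f : A →ₗ[R] Q, ∃ g : A →ₗ[R] X, q ∘ₗ g = f) : E1 (R := R) A E := by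
  intro P _ _ p hp f
  obtain ⟨k, hk⟩ := Module.Injective.out (R := R) (Q := X) (LinearMap.ker p).subtype
    Subtype.val_injective (i ∘ₗ f)
  obtain ⟨t, ht⟩ := exists_comp_eq_of_surjective p hp (q ∘ₗ k) (fun a ha => by
    have := hk ⟨a, ha⟩
    simp only [Submodule.subtype_apply] at this
    rw [LinearMap.comp_apply, this]
    exact hiq.apply_apply_eq_zero _)
  obtain ⟨t', ht'⟩ := h t
  obtain ⟨g, hg⟩ := exists_comp_eq_of_injective i hi (k - t' ∘ₗ p) (fun x => (hiq _).1 (by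
    rw [LinearMap.sub_apply, map_sub, sub_eq_zero]
    exact (LinearMap.congr_fun ht x).symm.trans (LinearMap.congr_fun ht' (p x)).symm))
  refine ⟨g, LinearMap.ext fun x => hi ?_⟩
  have h₁ := LinearMap.congr_fun hg x
  have h₂ := hk
  have h₃ : p x = 0 := x.2
  have h₄ : k x = i (f x) := h₂ x
  simpa [h₃, h₄] using h₁

/-- Special preenvelopes for the right orthogonal of a set of modules. -/
theorem exists_preenvelope {ι : Type u} (A : ι → ModuleCat.{u} R) (M : ModuleCat.{u} R) :
    ∃ (E L : ModuleCat.{u} R) (j : M →ₗ[R] E) (p : E →ₗ[R] L),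
      Injective j ∧ Exact j p ∧ Surjective p ∧ (∀ s, E1 (R := R) (A s) E) ∧
      ∀ E' : ModuleCat.{u} R, (∀ s, E1 (R := R) (A s) E') → E1 (R := R) L E' := by
  let P : ∀ s, (A s →₀ R) →ₗ[R] A s := fun s => Finsupp.linearCombination R id
  have hP : ∀ s, Surjective (P s) := fun s => Finsupp.linearCombination_id_surjective R (A s)
  let f : ∀ s, ModuleCat.of R (LinearMap.ker (P s)) ⟶ ModuleCat.of R (A s →₀ R) :=
    fun s => ModuleCat.ofHom (LinearMap.ker (P s)).subtype
  have hf : ∀ s, Mono (f s) := fun s => (ModuleCat.mono_iff_injective _).2 Subtype.val_injective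
  obtain ⟨E, a, b, -, ha, hb⟩ := exists_factorization_ofHoms f (0 : M ⟶ (0 : ModuleCat.{u} R))
  have hinj : Mono a := by
    obtain ⟨l, hl, -⟩ := exists_lift_of_llp_rlp ha (b := (0 : Injective.under M ⟶ (0 : ModuleCat.{u} R)))
      (rlp_ofHoms f _ fun s u v _ => ⟨Injective.factorThru u (f s), by simp,
        (isZero_zero _).eq_of_tgt _ _⟩) (Injective.ι M) 0 (by simp)
    exact mono_of_mono_fac hl
  refine ⟨E, ModuleCat.of R (E ⧸ LinearMap.range a.hom), a.hom, (LinearMap.range a.hom).mkQ,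
    (ModuleCat.mono_iff_injective _).1 hinj, LinearMap.exact_map_mkQ_range _,
    Submodule.mkQ_surjective _, fun s => E1.of_presentation (P s) (hP s) fun g => ?_,
    fun E' hE' => ?_⟩
  · have := hb (f s) ⟨s⟩
    have sq : CommSq (ModuleCat.ofHom g) (f s) b 0 := ⟨(isZero_zero _).eq_of_tgt _ _⟩
    exact ⟨sq.lift.hom, ModuleCat.hom_ext_iff.1 sq.fac_left⟩
  · let J : ModuleCat.{u} R := Injective.under E'
    let i : E' →ₗ[R] J := (Injective.ι E').hom
    have hi : Injective i := (ModuleCat.mono_iff_injective _).1 inferInstance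
    have : CategoryTheory.Injective (ModuleCat.of R J) :=
      inferInstanceAs (CategoryTheory.Injective (Injective.under E'))
    have : Module.Injective R J := Module.injective_module_of_injective_object (R := R) (M := J)
    refine E1.of_lift i (LinearMap.range i).mkQ hi (LinearMap.exact_map_mkQ_range _) fun g => ?_
    have hrlp : (ofHoms f).rlp (ModuleCat.ofHom (LinearMap.range i).mkQ) := by
      refine rlp_ofHoms f _ fun s u v w => ?_
      obtain ⟨v', hv'⟩ := Module.projective_lifting_property (LinearMap.range i).mkQ v.hom
        (Submodule.mkQ_surjective _)
      obtain ⟨r, hr⟩ := exists_comp_eq_of_injective i hi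
        (u.hom - v' ∘ₗ (LinearMap.ker (P s)).subtype) (fun x =>
          (Submodule.Quotient.mk_eq_zero (LinearMap.range i)).1 (by
            have h₁ := LinearMap.congr_fun (ModuleCat.hom_ext_iff.1 w) x
            have h₂ := LinearMap.congr_fun hv' x.1
            exact sub_eq_zero.2 (h₁.trans h₂.symm)))
      obtain ⟨r', hr'⟩ := hE' s _ (P s) (hP s) r
      refine ⟨ModuleCat.ofHom (v' + i ∘ₗ r'), ?_, ?_⟩
      · ext x
        have h₁ := LinearMap.congr_fun hr x
        have h₂ := LinearMap.congr_fun hr' x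
        change v' x.1 + i (r' x.1) = u.hom x
        rw [show r' x.1 = r x from h₂, show i (r x) = u.hom x - v' x.1 from h₁]
        abel
      · refine ModuleCat.hom_ext (LinearMap.ext fun x => ?_)
        change (LinearMap.range i).mkQ (v' x + i (r' x)) = v.hom x
        rw [map_add, show (LinearMap.range i).mkQ (i (r' x)) = 0 from
          (Submodule.Quotient.mk_eq_zero _).2 ⟨_, rfl⟩, add_zero]
        exact LinearMap.congr_fun hv' x
    obtain ⟨l, hl, hl'⟩ := exists_lift_of_llp_rlp ha
      (b := ModuleCat.ofHom (LinearMap.range i).mkQ) hrlp 0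
      (ModuleCat.ofHom (g ∘ₗ (LinearMap.range a.hom).mkQ)) (by
        ext x
        simp [(Submodule.Quotient.mk_eq_zero _).2 (LinearMap.mem_range_self a.hom x)])
    obtain ⟨t, ht⟩ := exists_comp_eq_of_surjective (LinearMap.range a.hom).mkQ
      (Submodule.mkQ_surjective _) l.hom (fun x hx => by
        obtain ⟨m, rfl⟩ := (Submodule.Quotient.mk_eq_zero _).1 hx
        exact LinearMap.congr_fun (ModuleCat.hom_ext_iff.1 hl) m)
    refine ⟨t, LinearMap.ext fun y => ?_⟩
    obtain ⟨x, rfl⟩ := Submodule.mkQ_surjective _ y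
    exact (congrArg _ (LinearMap.congr_fun ht x)).trans
      (LinearMap.congr_fun (ModuleCat.hom_ext_iff.1 hl') x)

end GorensteinPure

namespace GorensteinPure

open MorphismProperty Function ZeroObject

section ConstHom

variable {C : Type u} [AddCommGroup C] [Module R C] {Y Z : ChainComplex (ModuleCat.{u} R) ℤ}

/-- The components of a chain map out of a constant complex. -/
noncomputable def constApp {d : C →ₗ[R] C} {hd : d ∘ₗ d = 0} (u : constComplex d hd ⟶ Y) (n : ℤ) :
    C →ₗ[R] Y.X n :=
  (u.f n).hom

theorem constApp_comm {d : C →ₗ[R] C} {hd : d ∘ₗ d = 0} (u : constComplex d hd ⟶ Y) (i j : ℤ)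
    (h : j + 1 = i) : (Y.d i j).hom ∘ₗ constApp u i = constApp u j ∘ₗ d := by
  have := u.comm i j
  rw [constComplex_d d hd i j h] at this
  exact ModuleCat.hom_ext_iff.1 this

theorem constHom_ext {d : C →ₗ[R] C} {hd : d ∘ₗ d = 0} {u v : constComplex d hd ⟶ Y}
    (h : ∀ n, constApp u n = constApp v n) : u = v :=
  HomologicalComplex.hom_ext _ _ fun n => ModuleCat.hom_ext (h n)

/-- A chain map out of a constant complex given by a family of linear maps. -/
noncomputable def constHom (d : C →ₗ[R] C) (hd : d ∘ₗ d = 0) (φ : ∀ n, C →ₗ[R] Y.X n)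
    (h : ∀ i j, j + 1 = i → (Y.d i j).hom ∘ₗ φ i = φ j ∘ₗ d) : constComplex d hd ⟶ Y where
  f n := ModuleCat.ofHom (φ n)
  comm' i j hij := by
    rw [constComplex_d d hd i j hij]
    exact ModuleCat.hom_ext (h i j hij)

/-- The components of a chain map into a constant complex. -/
noncomputable def appConst {d : C →ₗ[R] C} {hd : d ∘ₗ d = 0} (u : Y ⟶ constComplex d hd) (n : ℤ) :
    Y.X n →ₗ[R] C :=
  (u.f n).hom

theorem appConst_comm {d : C →ₗ[R] C} {hd : d ∘ₗ d = 0} (u : Y ⟶ constComplex d hd) (i j : ℤ)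
    (h : j + 1 = i) : d ∘ₗ appConst u i = appConst u j ∘ₗ (Y.d i j).hom := by
  have := u.comm i j
  rw [constComplex_d d hd i j h] at this
  exact ModuleCat.hom_ext_iff.1 this

/-- A chain map into a constant complex given by a family of linear maps. -/
noncomputable def homConst (d : C →ₗ[R] C) (hd : d ∘ₗ d = 0) (φ : ∀ n, Y.X n →ₗ[R] C)
    (h : ∀ i j, j + 1 = i → d ∘ₗ φ i = φ j ∘ₗ (Y.d i j).hom) : Y ⟶ constComplex d hd where
  f n := ModuleCat.ofHom (φ n)
  comm' i j hij := by
    rw [constComplex_d d hd i j hij]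
    exact ModuleCat.hom_ext (h i j hij)

/-- The differential of the cone of the identity. -/
def coneD (d : C →ₗ[R] C) : C × C →ₗ[R] C × C :=
  (d ∘ₗ LinearMap.fst R C C + LinearMap.snd R C C).prod (-(d ∘ₗ LinearMap.snd R C C))

theorem coneD_comp_inl (d : C →ₗ[R] C) :
    coneD d ∘ₗ LinearMap.inl R C C = LinearMap.inl R C C ∘ₗ d :=
  LinearMap.ext fun x => by simp [coneD]

theorem coneD_comp_inr (d : C →ₗ[R] C) :
    coneD d ∘ₗ LinearMap.inr R C C = LinearMap.inl R C C - LinearMap.inr R C C ∘ₗ d :=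
  LinearMap.ext fun x => by simp [coneD]

theorem coneD_comp (d : C →ₗ[R] C) (hd : d ∘ₗ d = 0) : coneD d ∘ₗ coneD d = 0 := by
  have : ∀ x, d (d x) = 0 := LinearMap.congr_fun hd
  refine LinearMap.ext fun x => ?_
  simp [coneD, this]

/-- The inclusion of a constant complex into the cone of its identity. -/
noncomputable def coneIncl (d : C →ₗ[R] C) (hd : d ∘ₗ d = 0) :
    constComplex d hd ⟶ constComplex (coneD d) (coneD_comp d hd) :=
  homConst (coneD d) (coneD_comp d hd) (fun _ => LinearMap.inl R C C) (fun i j h => by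
    rw [constComplex_d d hd i j h]
    exact coneD_comp_inl d)

instance (d : C →ₗ[R] C) (hd : d ∘ₗ d = 0) : Mono (coneIncl d hd) := by
  have : ∀ n, Mono ((coneIncl d hd).f n) := fun n =>
    (ModuleCat.mono_iff_injective _).2 (LinearMap.inl_injective (R := R) (M := C) (M₂ := C))
  exact HomologicalComplex.mono_of_mono_f _ this

end ConstHom

section Small

variable {ι : Type u} {X : ι → Type u} [∀ s, AddCommGroup (X s)] [∀ s, Module R (X s)]
  (d : ∀ s, X s →ₗ[R] X s) (hd : ∀ s, d s ∘ₗ d s = 0)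

theorem rlp_coneIncl {Y Z : ChainComplex (ModuleCat.{u} R) ℤ} (p : Y ⟶ Z)
    (h : ∀ s (v : ∀ n, X s →ₗ[R] Y.X n) (w : ∀ n, X s →ₗ[R] Z.X n),
      (∀ i j, j + 1 = i → (Y.d i j).hom ∘ₗ v i = v j ∘ₗ d s) →
      (∀ i j, j + 1 = i → (Z.d i j).hom ∘ₗ w i = (p.f j).hom ∘ₗ v j - w j ∘ₗ d s) →
      ∃ t : ∀ n, X s →ₗ[R] Y.X n,
        (∀ i j, j + 1 = i → (Y.d i j).hom ∘ₗ t i = v j - t j ∘ₗ d s) ∧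
        ∀ n, (p.f n).hom ∘ₗ t n = w n) :
    (ofHoms fun s => coneIncl (d s) (hd s)).rlp p := by
  refine rlp_ofHoms _ p fun s a b hab => ?_
  have h₀ : ∀ n, (p.f n).hom ∘ₗ constApp a n = constApp b n ∘ₗ LinearMap.inl R (X s) (X s) :=
    fun n => congrArg (fun f => constApp f n) hab
  obtain ⟨t, ht, ht'⟩ := h s (constApp a) (fun n => constApp b n ∘ₗ LinearMap.inr R (X s) (X s))
    (constApp_comm a) (fun i j hij => by
      rw [← LinearMap.comp_assoc, constApp_comm b i j hij, h₀, LinearMap.comp_assoc,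
        coneD_comp_inr, LinearMap.comp_sub, LinearMap.comp_assoc])
  refine ⟨constHom _ _ (fun n => (constApp a n).coprod (t n)) (fun i j hij => ?_),
    constHom_ext fun n => ?_, constHom_ext fun n => ?_⟩
  · refine LinearMap.ext fun x => ?_
    have h₁ := LinearMap.congr_fun (constApp_comm a i j hij) x.1
    have h₂ := LinearMap.congr_fun (ht i j hij) x.2
    simp only [LinearMap.comp_apply, LinearMap.sub_apply] at h₁ h₂
    simp [coneD, h₁, h₂]
    abel
  · exact LinearMap.coprod_inl _ _
  · refine LinearMap.prod_ext ?_ ?_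
    · exact Eq.trans (LinearMap.ext fun x => by
        change (p.f n).hom ((constApp a n).coprod (t n) (x, 0)) = _
        simp) (h₀ n)
    · exact Eq.trans (LinearMap.ext fun x => by
        change (p.f n).hom ((constApp a n).coprod (t n) (0, x)) = _
        simp) (ht' n)

theorem exists_of_rlp_coneIncl {Y : ChainComplex (ModuleCat.{u} R) ℤ}
    {p : Y ⟶ (0 : ChainComplex (ModuleCat.{u} R) ℤ)}
    (hp : (ofHoms fun s => coneIncl (d s) (hd s)).rlp p) (s : ι) (v : ∀ n, X s →ₗ[R] Y.X n)
    (hv : ∀ i j, j + 1 = i → (Y.d i j).hom ∘ₗ v i = v j ∘ₗ d s) :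
    ∃ t : ∀ n, X s →ₗ[R] Y.X n, ∀ i j, j + 1 = i → (Y.d i j).hom ∘ₗ t i = v j - t j ∘ₗ d s := by
  have := hp _ ⟨s⟩
  have sq : CommSq (constHom (d s) (hd s) v hv) (coneIncl (d s) (hd s)) p 0 :=
    ⟨(isZero_zero _).eq_of_tgt _ _⟩
  refine ⟨fun n => constApp sq.lift n ∘ₗ LinearMap.inr R _ _, fun i j hij => ?_⟩
  have h₀ : constApp sq.lift j ∘ₗ LinearMap.inl R _ _ = v j :=
    congrArg (fun f => constApp f j) sq.fac_left
  rw [← LinearMap.comp_assoc, constApp_comm _ i j hij, ← h₀, LinearMap.comp_assoc,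
    coneD_comp_inr, LinearMap.comp_sub, LinearMap.comp_assoc]

end Small

section Free

variable (Y : Type u) [AddCommGroup Y] [Module R Y]

/-- The differential of the contractible complex with two copies of `Y` in each degree. -/
def freeD : Y × Y →ₗ[R] Y × Y :=
  (LinearMap.snd R Y Y).prod 0

theorem freeD_comp : freeD (R := R) Y ∘ₗ freeD Y = 0 :=
  LinearMap.ext fun x => by simp [freeD]

variable {Y}

/-- The map of contractible complexes induced by a linear map. -/
noncomputable def constFreeMap {Z : Type u} [AddCommGroup Z] [Module R Z] (q : Y →ₗ[R] Z) :
    constComplex (freeD (R := R) Y) (freeD_comp Y) ⟶ constComplex (freeD (R := R) Z) (freeD_comp Z) :=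
  constHom _ _ (fun _ => q.prodMap q) (fun i j h => by
    rw [constComplex_d _ _ i j h]
    exact LinearMap.ext fun x => Prod.ext rfl (map_zero q).symm)

/-- The second projection of the contractible complex. -/
noncomputable def constFreeSnd :
    constComplex (freeD (R := R) Y) (freeD_comp Y) ⟶
      constComplex (0 : Y →ₗ[R] Y) (LinearMap.zero_comp _) :=
  constHom _ _ (fun _ => LinearMap.snd R Y Y) (fun i j h => by
    rw [constComplex_d _ _ i j h]
    exact LinearMap.ext fun x => rfl)

variable {K : ChainComplex (ModuleCat.{u} R) ℤ}

/-- The chain map to a contractible complex determined by a family of linear maps. -/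
noncomputable def homFree (f : ∀ n, K.X n →ₗ[R] Y) : K ⟶ constComplex (freeD (R := R) Y) (freeD_comp Y) :=
  homConst _ _ (fun n => (f n).prod (f (n - 1) ∘ₗ (K.d n (n - 1)).hom)) (fun i j h => by
    obtain rfl : j = i - 1 := by omega
    refine LinearMap.ext fun x => ?_
    have : K.d (i - 1) (i - 1 - 1) (K.d i (i - 1) x) = 0 := by
      rw [← ModuleCat.comp_apply, K.d_comp_d]
      rfl
    simp [freeD, this])

theorem rlp_free {ι : Type u} {X : ι → Type u} [∀ s, AddCommGroup (X s)] [∀ s, Module R (X s)]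
    (d : ∀ s, X s →ₗ[R] X s) (hd : ∀ s, d s ∘ₗ d s = 0) [∀ s, Module.Projective R (X s)]
    {Z : Type u} [AddCommGroup Z] [Module R Z] (q : Y →ₗ[R] Z) (hq : Surjective q) :
    (ofHoms fun s => coneIncl (d s) (hd s)).rlp (constFreeMap q) := by
  refine rlp_coneIncl d hd _ fun s v w hv hw => ?_
  change ∀ n, X s →ₗ[R] Y × Y at v
  change ∀ n, X s →ₗ[R] Z × Z at w
  choose G hG using fun n => Module.projective_lifting_property q (LinearMap.fst R Z Z ∘ₗ w n) hq
  have hv' : ∀ i j, j + 1 = i → ∀ x, ((v i x).2, 0) = v j (d s x) := fun i j h x => by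
    have := LinearMap.congr_fun (hv i j h) x
    rw [constComplex_d _ _ i j h] at this
    exact this
  have hw' : ∀ i j, j + 1 = i → ∀ x, ((w i x).2, 0) = Prod.map q q (v j x) - w j (d s x) :=
    fun i j h x => by
      have := LinearMap.congr_fun (hw i j h) x
      rw [constComplex_d _ _ i j h] at this
      exact this
  have hG' : ∀ n x, q (G n x) = (w n x).1 := fun n x => LinearMap.congr_fun (hG n) x
  refine ⟨fun n => (G n).prod (LinearMap.fst R Y Y ∘ₗ v (n - 1) - G (n - 1) ∘ₗ d s),
    fun i j h => ?_, fun n => LinearMap.ext fun x => ?_⟩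
  · obtain rfl : j = i - 1 := by omega
    rw [constComplex_d _ _ i (i - 1) h]
    refine LinearMap.ext fun x => ?_
    have h₁ := hv' (i - 1) (i - 1 - 1) (by omega) x
    have h₂ : d s (d s x) = 0 := LinearMap.congr_fun (hd s) x
    change ((v (i - 1) x).1 - G (i - 1) (d s x), (0 : Y)) = v (i - 1) x -
      (G (i - 1) (d s x), (v (i - 1 - 1) (d s x)).1 - G (i - 1 - 1) (d s (d s x)))
    rw [← h₁, h₂]
    ext <;> simp
  · have h₁ := hw' n (n - 1) (by omega) x
    change (q (G n x), q ((v (n - 1) x).1 - G (n - 1) (d s x))) = w n x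
    rw [map_sub, hG', hG']
    exact Prod.ext rfl (congrArg Prod.fst h₁).symm

theorem rlp_snd {ι : Type u} {X : ι → Type u} [∀ s, AddCommGroup (X s)] [∀ s, Module R (X s)]
    (d : ∀ s, X s →ₗ[R] X s) (hd : ∀ s, d s ∘ₗ d s = 0) (h : ∀ s, HE (d s) Y) :
    (ofHoms fun s => coneIncl (d s) (hd s)).rlp (constFreeSnd (R := R) (Y := Y)) := by
  refine rlp_coneIncl d hd _ fun s v w hv hw => ?_
  change ∀ n, X s →ₗ[R] Y × Y at v
  change ∀ n, X s →ₗ[R] Y at w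
  have hv' : ∀ i j, j + 1 = i → ∀ x, ((v i x).2, 0) = v j (d s x) := fun i j h x => by
    have := LinearMap.congr_fun (hv i j h) x
    rw [constComplex_d _ _ i j h] at this
    exact this
  have hw' : ∀ i j, j + 1 = i → ∀ x, 0 = (v j x).2 - w j (d s x) := fun i j h x => by
    have := LinearMap.congr_fun (hw i j h) x
    rw [constComplex_d _ _ i j h] at this
    exact this
  have key : ∀ n, (LinearMap.fst R Y Y ∘ₗ v n - w (n + 1)) ∘ₗ d s = 0 := fun n =>
    LinearMap.ext fun x => by
      have h₁ := congrArg Prod.fst (hv' (n + 1) n rfl x)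
      have h₂ := hw' (n + 1 + 1) (n + 1) rfl x
      change (v n (d s x)).1 - w (n + 1) (d s x) = 0
      rw [← h₁]
      exact h₂.symm
  choose G hG using fun n => h s _ (key n)
  refine ⟨fun n => (G n).prod (w n), fun i j hij => ?_, fun n => rfl⟩
  rw [constComplex_d _ _ i j hij]
  refine LinearMap.ext fun x => ?_
  have h₁ := LinearMap.congr_fun (hG j) x
  have h₂ := hw' i j hij x
  subst hij
  change (w (j + 1) x, (0 : Y)) = v j x - (G j (d s x), w j (d s x))
  refine Prod.ext ?_ h₂
  have h₃ : (v j x).1 - w (j + 1) x = G j (d s x) := h₁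
  simp [← h₃]

theorem projective_of_llp {ι : Type u} {X : ι → Type u} [∀ s, AddCommGroup (X s)]
    [∀ s, Module R (X s)] (d : ∀ s, X s →ₗ[R] X s) (hd : ∀ s, d s ∘ₗ d s = 0)
    [∀ s, Module.Projective R (X s)]
    (hK : ∀ {Y Z : ChainComplex (ModuleCat.{u} R) ℤ} (p : Y ⟶ Z),
      (ofHoms fun s => coneIncl (d s) (hd s)).rlp p → ∀ g : K ⟶ Z, ∃ l, l ≫ p = g) (n : ℤ) :
    Module.Projective R (K.X n) := by
  refine Module.Projective.of_lifting_property'' (R := R) fun q hq => ?_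
  let F : ∀ m, K.X m →ₗ[R] K.X n := Function.update (fun _ => 0) n LinearMap.id
  have hF : F n = LinearMap.id := Function.update_self _ _ _
  obtain ⟨l, hl⟩ := hK _ (rlp_free d hd q hq) (homFree F)
  refine ⟨LinearMap.fst R _ _ ∘ₗ appConst l n, ?_⟩
  exact Eq.trans (congrArg (fun u => LinearMap.fst R _ _ ∘ₗ appConst u n) hl) hF

theorem HE_totD_of_llp {ι : Type u} {X : ι → Type u} [∀ s, AddCommGroup (X s)]
    [∀ s, Module R (X s)] (d : ∀ s, X s →ₗ[R] X s) (hd : ∀ s, d s ∘ₗ d s = 0)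
    (hK : ∀ {Y Z : ChainComplex (ModuleCat.{u} R) ℤ} (p : Y ⟶ Z),
      (ofHoms fun s => coneIncl (d s) (hd s)).rlp p → ∀ g : K ⟶ Z, ∃ l, l ≫ p = g)
    (h : ∀ s, HE (d s) Y) : HE (totD K) Y := by
  rw [HE_totD_iff]
  intro i f hf
  have h₀ : (0 : Y →ₗ[R] Y) ∘ₗ (0 : Y →ₗ[R] Y) = 0 := LinearMap.zero_comp _
  let F : ∀ n, K.X n →ₗ[R] Y := Function.update (fun _ => 0) i f
  have hF : F i = f := Function.update_self _ _ _
  obtain ⟨l, hl⟩ := hK _ (rlp_snd (Y := Y) d hd h) (homConst (0 : Y →ₗ[R] Y) h₀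
    F (fun m j hj => by
      rw [LinearMap.zero_comp]
      obtain rfl | hi := eq_or_ne j i
      · subst hj
        rw [hF, hf]
      · rw [show F j = 0 from Function.update_of_ne hi _ _, LinearMap.zero_comp]))
  have hl' : ∀ n, LinearMap.snd R Y Y ∘ₗ appConst l n = F n :=
    fun n => congrArg (fun u => appConst u n) hl
  refine ⟨LinearMap.fst R Y Y ∘ₗ appConst l (i - 1), ?_⟩
  rw [LinearMap.comp_assoc, ← appConst_comm l i (i - 1) (by omega)]
  exact hF.symm.trans (hl' i).symm

end Free

/-- The differential on the product of the terms of a complex. -/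
noncomputable def prodD (K : ChainComplex (ModuleCat.{u} R) ℤ) :
    (∀ n, K.X n) →ₗ[R] ∀ n, K.X n :=
  LinearMap.pi fun n => (K.d (n + 1) n).hom ∘ₗ LinearMap.proj (n + 1)

theorem nullHtpy_prodD_iff {C : Type u} [AddCommGroup C] [Module R C] (d : C →ₗ[R] C)
    (K : ChainComplex (ModuleCat.{u} R) ℤ) : NullHtpy d (prodD K) ↔
    ∀ v : ∀ n, C →ₗ[R] K.X n, (∀ i j, j + 1 = i → (K.d i j).hom ∘ₗ v i = v j ∘ₗ d) →
      ∃ t : ∀ n, C →ₗ[R] K.X n, ∀ i j, j + 1 = i → v j = (K.d i j).hom ∘ₗ t i + t j ∘ₗ d := by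
  constructor
  · intro h v hv
    obtain ⟨s, hs⟩ := h (LinearMap.pi v) (LinearMap.ext fun x => funext fun n =>
      LinearMap.congr_fun (hv (n + 1) n rfl) x)
    refine ⟨fun n => LinearMap.proj n ∘ₗ s, fun i j hij => ?_⟩
    subst hij
    exact LinearMap.ext fun x => congrFun (LinearMap.congr_fun hs x) j
  · intro h φ hφ
    obtain ⟨t, ht⟩ := h (fun n => LinearMap.proj n ∘ₗ φ) (fun i j hij => by
      subst hij
      exact LinearMap.ext fun x => congrFun (LinearMap.congr_fun hφ x) j)
    refine ⟨LinearMap.pi t, LinearMap.ext fun x => funext fun n => ?_⟩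
    exact LinearMap.congr_fun (ht (n + 1) n rfl) x

/-- Every complex embeds in one to which all chain maps from the given differential modules are
null homotopic, with a cokernel built from these differential modules. -/
theorem exists_nullHtpy_embedding {ι : Type u} {X : ι → Type u} [∀ s, AddCommGroup (X s)]
    [∀ s, Module R (X s)] (d : ∀ s, X s →ₗ[R] X s) (hd : ∀ s, d s ∘ₗ d s = 0)
    [∀ s, Module.Projective R (X s)] (A : ChainComplex (ModuleCat.{u} R) ℤ) :
    ∃ (B L : ChainComplex (ModuleCat.{u} R) ℤ) (a : A ⟶ B) (π : B ⟶ L),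
      (∀ n, Injective (a.f n)) ∧ (∀ n, Exact (a.f n) (π.f n)) ∧ (∀ n, Surjective (π.f n)) ∧
      (∀ n, Module.Projective R (L.X n)) ∧
      (∀ (Y : Type u) [AddCommGroup Y] [Module R Y], (∀ s, HE (d s) Y) → HE (totD L) Y) ∧
      ∀ s, NullHtpy (d s) (prodD B) := by
  obtain ⟨B, a, b, -, ha, hb⟩ := exists_factorization_ofHoms
    (fun s => coneIncl (d s) (hd s)) (0 : A ⟶ (0 : ChainComplex (ModuleCat.{u} R) ℤ))
  have hmono : Mono a := by
    obtain ⟨l, hl, -⟩ := exists_lift_of_llp_rlp ha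
      (b := (0 : Injective.under A ⟶ (0 : ChainComplex (ModuleCat.{u} R) ℤ)))
      (rlp_ofHoms _ _ fun s u v _ => ⟨Injective.factorThru u (coneIncl (d s) (hd s)), by simp,
        (isZero_zero _).eq_of_tgt _ _⟩) (Injective.ι A) 0 (by simp)
    exact mono_of_mono_fac hl
  have hL : ∀ {Y Z : ChainComplex (ModuleCat.{u} R) ℤ} (p : Y ⟶ Z),
      (ofHoms fun s => coneIncl (d s) (hd s)).rlp p →
        ∀ g : cokernel a ⟶ Z, ∃ l, l ≫ p = g := by
    intro Y Z p hp g
    obtain ⟨l, hl, hl'⟩ := exists_lift_of_llp_rlp ha hp 0 (cokernel.π a ≫ g) (by simp)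
    exact ⟨cokernel.desc a l hl, (cancel_epi (cokernel.π a)).1 (by simpa using hl')⟩
  let S : ShortComplex (ChainComplex (ModuleCat.{u} R) ℤ) :=
    ShortComplex.mk a (cokernel.π a) (cokernel.condition a)
  have hS : S.ShortExact := { exact := ShortComplex.exact_cokernel a }
  have hSn := fun n => hS.map_of_exact
    (HomologicalComplex.eval (ModuleCat.{u} R) (ComplexShape.down ℤ) n)
  refine ⟨B, cokernel a, a, cokernel.π a, fun n => (hSn n).moduleCat_injective_f,
    fun n => (ShortComplex.ShortExact.moduleCat_exact_iff_function_exact _).1 (hSn n).exact,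
    fun n => (hSn n).moduleCat_surjective_g, fun n => projective_of_llp d hd hL n,
    fun Y _ _ h => HE_totD_of_llp d hd hL h, fun s => ?_⟩
  rw [nullHtpy_prodD_iff]
  intro v hv
  obtain ⟨t, ht⟩ := exists_of_rlp_coneIncl d hd hb s v hv
  exact ⟨t, fun i j hij => by rw [ht i j hij, sub_add_cancel]⟩

end GorensteinPure

namespace GorensteinPure

open Function

/-- Dependent choice in both directions along the integers. -/
theorem exists_int_family {α : ℤ → Type*} (r : ∀ i j, α i → α j → Prop) (a : α 0)
    (ha : ∃ y, r 1 0 y a) (ha' : ∃ y, r 0 (-1) a y)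
    (hup : ∀ i j k, 0 ≤ k → k + 1 = j → j + 1 = i → ∀ (x : α k) (y : α j), r j k y x →
      ∃ z : α i, r i j z y)
    (hdown : ∀ i j k, i ≤ 0 → k + 1 = j → j + 1 = i → ∀ (x : α i) (y : α j), r i j x y →
      ∃ z : α k, r j k y z) :
    ∃ f : ∀ n, α n, f 0 = a ∧ ∀ i j, j + 1 = i → r i j (f i) (f j) := by
  have up : ∃ f : ∀ n : ℕ, α n, f 0 = a ∧ ∀ n : ℕ, r ((n + 1 : ℕ) : ℤ) n (f (n + 1)) (f n) := by
    let β : ℕ → Type _ := fun n => {x : α n // ∃ y : α ((n + 1 : ℕ) : ℤ), r _ _ y x}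
    have hstep : ∀ n (x : β n), ∃ y : β (n + 1), r _ _ y.1 x.1 := fun n x => by
      obtain ⟨y, hy⟩ := x.2
      obtain ⟨z, hz⟩ := hup ((n + 1 + 1 : ℕ) : ℤ) ((n + 1 : ℕ) : ℤ) n (by omega) (by omega)
        (by omega) _ _ hy
      exact ⟨⟨y, z, hz⟩, hy⟩
    choose step hs using hstep
    let F : ∀ n, β n := fun n => Nat.rec ⟨a, ha⟩ step n
    exact ⟨fun n => (F n).1, rfl, fun n => hs n (F n)⟩
  have down : ∃ f : ∀ n : ℕ, α (Int.negSucc n), r 0 (Int.negSucc 0) a (f 0) ∧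
      ∀ n : ℕ, r (Int.negSucc n) (Int.negSucc (n + 1)) (f n) (f (n + 1)) := by
    let β : ℕ → Type _ := fun n =>
      {x : α (Int.negSucc n) // ∃ y : α (Int.negSucc n + 1), r _ _ y x}
    have hstep : ∀ n (x : β n), ∃ y : β (n + 1), r _ _ x.1 y.1 := fun n x => by
      obtain ⟨y, hy⟩ := x.2
      obtain ⟨z, hz⟩ := hdown (Int.negSucc n + 1) (Int.negSucc n) (Int.negSucc (n + 1))
        (by omega) (by omega) (by omega) _ _ hy
      exact ⟨⟨z, x.1, hz⟩, hz⟩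
    choose step hs using hstep
    obtain ⟨y, hy⟩ := ha'
    let F : ∀ n, β n := fun n => Nat.rec ⟨y, a, hy⟩ step n
    exact ⟨fun n => (F n).1, hy, fun n => hs n (F n)⟩
  obtain ⟨f, hf₀, hf⟩ := up
  obtain ⟨g, hg₀, hg⟩ := down
  refine ⟨fun n => match n with
    | Int.ofNat n => f n
    | Int.negSucc n => g n, hf₀, ?_⟩
  rintro i (n | (_ | n)) rfl
  · exact hf n
  · subst hf₀
    exact hg₀
  · exact hg n

theorem prodD_comp (K : ChainComplex (ModuleCat.{u} R) ℤ) : prodD K ∘ₗ prodD K = 0 := by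
  refine LinearMap.ext fun x => funext fun n => ?_
  change K.d (n + 1) n (K.d (n + 1 + 1) (n + 1) (x (n + 1 + 1))) = 0
  rw [← ModuleCat.comp_apply, K.d_comp_d]
  rfl

theorem d_apply_d_apply (K : ChainComplex (ModuleCat.{u} R) ℤ) (i j k : ℤ) (x : K.X i) :
    K.d j k (K.d i j x) = 0 := by
  rw [← ModuleCat.comp_apply, K.d_comp_d]
  rfl

/-- The complex `B` contains the module `M` in degree zero, with quotient the complex `L`. -/
structure Extension (M : Type u) [AddCommGroup M] [Module R M]
    (B L : ChainComplex (ModuleCat.{u} R) ℤ) where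
  /-- The projection. -/
  π : B ⟶ L
  /-- The inclusion of `M` in degree zero. -/
  j : M →ₗ[R] B.X 0
  j_injective : Injective j
  exact : Exact j (π.f 0)
  surjective : ∀ n, Surjective (π.f n)
  injective : ∀ n, n ≠ 0 → Injective (π.f n)

theorem exists_extension {ι : Type u} {X : ι → Type u} [∀ s, AddCommGroup (X s)]
    [∀ s, Module R (X s)] (d : ∀ s, X s →ₗ[R] X s) (hd : ∀ s, d s ∘ₗ d s = 0)
    [∀ s, Module.Projective R (X s)] (M : Type u) [AddCommGroup M] [Module R M] :
    ∃ (B L : ChainComplex (ModuleCat.{u} R) ℤ) (_ : Extension M B L),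
      (∀ n, Module.Projective R (L.X n)) ∧
      (∀ (Y : Type u) [AddCommGroup Y] [Module R Y], (∀ s, HE (d s) Y) → HE (totD L) Y) ∧
      ∀ s, NullHtpy (d s) (prodD B) := by
  let A := (HomologicalComplex.single (ModuleCat.{u} R) (ComplexShape.down ℤ) 0).obj
    (ModuleCat.of R M)
  obtain ⟨B, L, a, π, h₁, h₂, h₃, h₄, h₅, h₆⟩ := exists_nullHtpy_embedding d hd A
  let e : M ≃ₗ[R] A.X 0 :=
    (HomologicalComplex.singleObjXSelf (ComplexShape.down ℤ) 0 (ModuleCat.of R M)).symm.toLinearEquiv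
  refine ⟨B, L, ⟨π, (a.f 0).hom ∘ₗ e.toLinearMap, (h₁ 0).comp e.injective, fun x => ?_, h₃,
    fun n hn => ?_⟩, h₄, h₅, h₆⟩
  · rw [h₂ 0 x]
    exact ⟨fun ⟨y, hy⟩ => ⟨e.symm y, by simp [← hy]⟩, fun ⟨y, hy⟩ => ⟨e y, hy⟩⟩
  · have hz : IsZero (A.X n) :=
      HomologicalComplex.isZero_single_obj_X (ComplexShape.down ℤ) 0 (ModuleCat.of R M) n hn
    refine (injective_iff_map_eq_zero (π.f n).hom).2 fun x hx => ?_
    obtain ⟨y, rfl⟩ := (h₂ n x).1 hx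
    have := ModuleCat.subsingleton_of_isZero hz
    rw [Subsingleton.elim y 0]
    exact map_zero (a.f n).hom

theorem exists_lift_of_exists {P A B : Type*} [AddCommGroup P] [Module R P] [AddCommGroup A]
    [Module R A] [AddCommGroup B] [Module R B] [Module.Projective R P] (f : A →ₗ[R] B)
    (g : P →ₗ[R] B) (h : ∀ x, ∃ y, f y = g x) : ∃ l : P →ₗ[R] A, f ∘ₗ l = g := by
  obtain ⟨l, hl⟩ := Module.projective_lifting_property f.rangeRestrict
    (g.codRestrict (LinearMap.range f) h) f.surjective_rangeRestrict
  exact ⟨l, LinearMap.ext fun x => congrArg Subtype.val (LinearMap.congr_fun hl x)⟩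

namespace Extension

variable {M : Type u} [AddCommGroup M] [Module R M] {B L : ChainComplex (ModuleCat.{u} R) ℤ}

theorem d_apply (S : Extension M B L) (i j : ℤ) (x : B.X i) :
    L.d i j (S.π.f i x) = S.π.f j (B.d i j x) := by
  rw [← ModuleCat.comp_apply, S.π.comm, ModuleCat.comp_apply]

theorem exists_d_eq (S : Extension M B L)
    (hL : ∀ i j k, j + 1 = i → k + 1 = j → Exact (L.d i j) (L.d j k))
    (i j k : ℤ) (hij : j + 1 = i) (hjk : k + 1 = j) (x : B.X j) (hx : S.π.f k (B.d j k x) = 0) :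
    ∃ y, S.π.f j (B.d i j y) = S.π.f j x := by
  obtain ⟨y, hy⟩ := (hL i j k hij hjk (S.π.f j x)).1 (by rw [S.d_apply, hx])
  obtain ⟨z, rfl⟩ := S.surjective i y
  exact ⟨z, by rw [← hy, S.d_apply]⟩

theorem exact_of_pos (S : Extension M B L)
    (hL : ∀ i j k, j + 1 = i → k + 1 = j → Exact (L.d i j) (L.d j k))
    (i j k : ℤ) (hij : j + 1 = i) (hjk : k + 1 = j) (hj : 0 < j) : Exact (B.d i j) (B.d j k) := by
  intro x
  constructor
  · intro hx
    obtain ⟨y, hy⟩ := S.exists_d_eq hL i j k hij hjk x (by rw [hx]; exact map_zero (S.π.f k).hom)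
    exact ⟨y, S.injective j (by omega) hy⟩
  · rintro ⟨y, rfl⟩
    exact d_apply_d_apply B i j k y

/-- The cokernel of `B.d 1 0`. -/
abbrev V (_ : Extension M B L) : Type u := B.X 0 ⧸ LinearMap.range (B.d 1 0).hom

/-- The cokernel of `L.d 1 0`. -/
abbrev Z (_ : Extension M B L) : Type u := L.X 0 ⧸ LinearMap.range (L.d 1 0).hom

/-- The map from `M` to the cokernel of `B.d 1 0`. -/
def i (S : Extension M B L) : M →ₗ[R] S.V := (LinearMap.range (B.d 1 0).hom).mkQ ∘ₗ S.j

/-- The map from the cokernel of `B.d 1 0` to that of `L.d 1 0`. -/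
def q (S : Extension M B L) : S.V →ₗ[R] S.Z :=
  Submodule.mapQ _ _ (S.π.f 0).hom (by
    rintro _ ⟨y, rfl⟩
    exact ⟨S.π.f 1 y, S.d_apply 1 0 y⟩)

theorem i_injective (S : Extension M B L)
    (hL : ∀ i j k, j + 1 = i → k + 1 = j → Exact (L.d i j) (L.d j k)) : Injective S.i := by
  refine (injective_iff_map_eq_zero _).2 fun m hm => ?_
  obtain ⟨b, hb⟩ := (Submodule.Quotient.mk_eq_zero (LinearMap.range (B.d 1 0).hom)).1 hm
  have hb' : B.d 1 0 b = S.j m := hb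
  obtain ⟨y, hy⟩ := S.exists_d_eq hL 2 1 0 rfl rfl b (by
    rw [hb']
    exact S.exact.apply_apply_eq_zero m)
  have h := S.injective 1 one_ne_zero hy
  refine S.j_injective ?_
  rw [map_zero, ← hb', ← h, d_apply_d_apply]

theorem q_surjective (S : Extension M B L) : Surjective S.q := by
  intro z
  obtain ⟨l, rfl⟩ := Submodule.mkQ_surjective _ z
  obtain ⟨b, rfl⟩ := S.surjective 0 l
  exact ⟨(LinearMap.range (B.d 1 0).hom).mkQ b, rfl⟩

theorem exact_i_q (S : Extension M B L) : Exact S.i S.q := by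
  intro v
  obtain ⟨b, rfl⟩ := Submodule.mkQ_surjective _ v
  constructor
  · intro h
    obtain ⟨c, hc⟩ := (Submodule.Quotient.mk_eq_zero (LinearMap.range (L.d 1 0).hom)).1 h
    have hc' : L.d 1 0 c = S.π.f 0 b := hc
    obtain ⟨c, rfl⟩ := S.surjective 1 c
    obtain ⟨m, hm⟩ := (S.exact (b - B.d 1 0 c)).1 (by
      rw [map_sub, ← hc', S.d_apply, sub_self])
    refine ⟨m, ?_⟩
    change (LinearMap.range (B.d 1 0).hom).mkQ (S.j m) = _
    rw [hm, map_sub, sub_eq_self]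
    exact (Submodule.Quotient.mk_eq_zero _).2 ⟨c, rfl⟩
  · rintro ⟨m, hm⟩
    rw [← hm]
    change (LinearMap.range (L.d 1 0).hom).mkQ (S.π.f 0 (S.j m)) = 0
    rw [S.exact.apply_apply_eq_zero, map_zero]

/-- The cokernel of `B.d 1 0` is right orthogonal to totally acyclic complexes when all maps from
these to `B` are null homotopic. -/
theorem HE_V (S : Extension M B L)
    (hL : ∀ i j k, j + 1 = i → k + 1 = j → Exact (L.d i j) (L.d j k))
    (hP : ∀ n, Module.Projective R (L.X n)) {C : Type u} [AddCommGroup C] [Module R C]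
    {d : C →ₗ[R] C} (hd : TA d) (hB : NullHtpy d (prodD B)) : HE d S.V := by
  intro f hf
  have := hd.projective
  have hdd : ∀ x, d (d x) = 0 := LinearMap.congr_fun hd.exact.linearMap_comp_eq_zero
  let ρ := (LinearMap.range (B.d 1 0).hom).mkQ
  obtain ⟨v₀, hv₀⟩ := Module.projective_lifting_property ρ f (Submodule.mkQ_surjective _)
  have hHE : ∀ n, n ≠ 0 → HE d (B.X n) := fun n hn => by
    have := hP n
    exact (hd.he (L.X n)).congr_equiv
      (LinearEquiv.ofBijective (S.π.f n).hom ⟨S.injective n hn, S.surjective n⟩)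
  have h₀ : ∃ y : C →ₗ[R] B.X 1, (B.d 1 0).hom ∘ₗ y = v₀ ∘ₗ d := by
    have h : ∀ x, ∃ y, B.d 1 0 y = v₀ (d x) := fun x =>
      (Submodule.Quotient.mk_eq_zero (LinearMap.range (B.d 1 0).hom)).1
        ((LinearMap.congr_fun hv₀ (d x)).trans (LinearMap.congr_fun hf x))
    exact exists_lift_of_exists (B.d 1 0).hom (v₀ ∘ₗ d) h
  have hdown : ∀ i j (x : C →ₗ[R] B.X i), j ≠ 0 → ((B.d i j).hom ∘ₗ x) ∘ₗ d = 0 →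
      ∃ z : C →ₗ[R] B.X j, (B.d i j).hom ∘ₗ x = z ∘ₗ d :=
    fun i j x hj hx => hHE j hj _ hx
  have h₁ : ∃ y : C →ₗ[R] B.X (-1), (B.d 0 (-1)).hom ∘ₗ v₀ = y ∘ₗ d := by
    obtain ⟨y, hy⟩ := h₀
    refine hdown 0 (-1) v₀ (by omega) ?_
    rw [LinearMap.comp_assoc, ← hy]
    exact LinearMap.ext fun x => d_apply_d_apply B 1 0 (-1) (y x)
  have h₂ : ∀ i j k, 0 ≤ k → k + 1 = j → j + 1 = i → ∀ (x : C →ₗ[R] B.X k) (y : C →ₗ[R] B.X j),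
      (B.d j k).hom ∘ₗ y = x ∘ₗ d → ∃ z : C →ₗ[R] B.X i, (B.d i j).hom ∘ₗ z = y ∘ₗ d := by
    intro i j k hk hkj hji x y hxy
    refine exists_lift_of_exists _ _ fun c =>
      (S.exact_of_pos hL i j k hji hkj (by omega) (y (d c))).1 ?_
    refine (LinearMap.congr_fun hxy (d c)).trans ?_
    rw [LinearMap.comp_apply, hdd, map_zero]
  have h₃ : ∀ i j k, i ≤ 0 → k + 1 = j → j + 1 = i → ∀ (x : C →ₗ[R] B.X i) (y : C →ₗ[R] B.X j),
      (B.d i j).hom ∘ₗ x = y ∘ₗ d → ∃ z : C →ₗ[R] B.X k, (B.d j k).hom ∘ₗ y = z ∘ₗ d := by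
    intro i j k hi hkj hji x y hxy
    refine hdown j k y (by omega) ?_
    rw [LinearMap.comp_assoc, ← hxy]
    exact LinearMap.ext fun c => d_apply_d_apply B i j k (x c)
  obtain ⟨v, hv0, hv⟩ := exists_int_family (α := fun n => C →ₗ[R] B.X n)
    (fun i j x y => (B.d i j).hom ∘ₗ x = y ∘ₗ d) v₀ h₀ h₁ h₂ h₃
  obtain ⟨t, ht⟩ := (nullHtpy_prodD_iff d B).1 hB v hv
  refine ⟨ρ ∘ₗ t 0, ?_⟩
  rw [← hv₀, ← hv0, ht 1 0 rfl, LinearMap.comp_add, ← LinearMap.comp_assoc,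
    LinearMap.range_mkQ_comp, LinearMap.zero_comp, zero_add, LinearMap.comp_assoc]

end Extension

end GorensteinPure

namespace GorensteinPure

open Function

section Dual

variable {X Y Z : Type u} [AddCommGroup X] [Module R X] [AddCommGroup Y] [Module R Y]
  [AddCommGroup Z] [Module R Z]

theorem dual_injective_of_surjective (p : Y →ₗ[R] Z) (hp : Surjective p) :
    Injective (CharacterModule.dual p) := fun φ ψ h => DFunLike.ext _ _ fun z => by
  obtain ⟨y, rfl⟩ := hp z
  exact DFunLike.congr_fun h y

theorem exact_dual_of_exact (i : X →ₗ[R] Y) (p : Y →ₗ[R] Z) (hip : Exact i p) :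
    Exact (CharacterModule.dual p) (CharacterModule.dual i) := by
  intro φ
  constructor
  · intro hφ
    obtain ⟨ψ, hψ⟩ := exists_character_factor p φ (fun x hx => by
      obtain ⟨y, rfl⟩ := (hip x).1 hx
      exact DFunLike.congr_fun hφ y)
    exact ⟨ψ, DFunLike.ext _ _ hψ⟩
  · rintro ⟨ψ, rfl⟩
    refine DFunLike.ext _ _ fun x => ?_
    change ψ (p (i x)) = 0
    rw [hip.apply_apply_eq_zero, map_zero]

variable {C : Type u} [AddCommGroup C] [Module R C] [Module.Projective R C] {d : C →ₗ[R] C}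

theorem HE.character_right (hd : d ∘ₗ d = 0) (i : X →ₗ[R] Y) (p : Y →ₗ[R] Z) (hi : Injective i)
    (hip : Exact i p) (hp : Surjective p) (hX : HE d (CharacterModule X))
    (hY : HE d (CharacterModule Y)) : HE d (CharacterModule Z) :=
  HE.left hd _ _ (dual_injective_of_surjective p hp) (exact_dual_of_exact i p hip)
    (CharacterModule.dual_surjective_of_injective i hi) hY hX

theorem HE.character_left (hd : d ∘ₗ d = 0) (i : X →ₗ[R] Y) (p : Y →ₗ[R] Z) (hi : Injective i)
    (hip : Exact i p) (hp : Surjective p) (hY : HE d (CharacterModule Y))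
    (hZ : HE d (CharacterModule Z)) : HE d (CharacterModule X) :=
  HE.right hd _ _ (dual_injective_of_surjective p hp) (exact_dual_of_exact i p hip)
    (CharacterModule.dual_surjective_of_injective i hi) hY hZ

/-- Vanishing of the first extension group against a character module is symmetric. -/
theorem E1.symm_character {A B : Type u} [AddCommGroup A] [Module R A] [AddCommGroup B] [Module R B]
    (h : E1 (R := R) A (CharacterModule B)) : E1 (R := R) B (CharacterModule A) := by
  let p : (A →₀ R) →ₗ[R] A := Finsupp.linearCombination R id
  let p' : (B →₀ R) →ₗ[R] B := Finsupp.linearCombination R id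
  have hp : Surjective p := Finsupp.linearCombination_id_surjective R A
  have hp' : Surjective p' := Finsupp.linearCombination_id_surjective R B
  refine E1.of_presentation p' hp' fun f => ?_
  let res := CharacterModule.dual (R := R) (A := LinearMap.ker p') (LinearMap.ker p').subtype
  obtain ⟨t, ht⟩ := Module.projective_lifting_property res (swap f ∘ₗ p)
    (CharacterModule.dual_surjective_of_injective _ Subtype.val_injective)
  have ht' : ∀ x, res (t x) = swap f (p x) := LinearMap.congr_fun ht
  have hex := exact_dual_of_exact (X := LinearMap.ker p') (LinearMap.ker p').subtype p'
    p'.exact_subtype_ker_map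
  obtain ⟨r, hr⟩ := exists_comp_eq_of_injective (X := LinearMap.ker p) (CharacterModule.dual p')
    (dual_injective_of_surjective p' hp') (t.domRestrict (LinearMap.ker p)) (fun x =>
      (hex _).1 ((ht' x).trans (by rw [show p x = 0 from x.2, map_zero])))
  obtain ⟨r', hr'⟩ := h _ p hp r
  obtain ⟨t', ht'⟩ := exists_comp_eq_of_surjective p hp (t - CharacterModule.dual p' ∘ₗ r')
    (fun a ha => by
      have h₁ : r' a = r ⟨a, ha⟩ := LinearMap.congr_fun hr' ⟨a, ha⟩
      have h₂ : CharacterModule.dual p' (r ⟨a, ha⟩) = t a := LinearMap.congr_fun hr ⟨a, ha⟩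
      rw [LinearMap.sub_apply, LinearMap.comp_apply, h₁, h₂, sub_self])
  refine ⟨swap t', LinearMap.ext fun x => DFunLike.ext _ _ fun a => ?_⟩
  obtain ⟨y, rfl⟩ := hp a
  have h₁ : t' (p y) = t y - CharacterModule.dual p' (r' y) := LinearMap.congr_fun ht' y
  have h₂ : t y x.1 = f x (p y) := DFunLike.congr_fun (LinearMap.congr_fun ht y) x
  change t' (p y) x.1 = f x (p y)
  rw [h₁, ← h₂]
  change t y x.1 - r' y (p' x.1) = t y x.1
  rw [show p' x.1 = 0 from x.2, map_zero, sub_zero]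

end Dual

theorem PGF.he_projective {C : Type u} [AddCommGroup C] [Module R C] {d : C →ₗ[R] C} (h : PGF d)
    (P : Type u) [AddCommGroup P] [Module R P] [Module.Flat R P] :
    HE d (CharacterModule P) := by
  have : Module.Injective R (CharacterModule P) :=
    (Module.Flat.iff_characterModule_injective (R := R) (M := P)).1 inferInstance
  exact HE.of_injective h.exact

/-- `HE d (CharacterModule M)` for all `PGF d`. -/
def CharAcyclic (M : Type u) [AddCommGroup M] [Module R M] : Prop :=
  ∀ (C : Type u) [AddCommGroup C] [Module R C] (d : C →ₗ[R] C), PGF d → HE d (CharacterModule M)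

/-- The cokernel of a component of the differential of a complex. -/
abbrev coker (K : ChainComplex (ModuleCat.{u} R) ℤ) (i j : ℤ) : Type u :=
  K.X j ⧸ LinearMap.range (K.d i j).hom

theorem exact_of_exact_totD {K : ChainComplex (ModuleCat.{u} R) ℤ} (h : Exact (totD K) (totD K))
    (i j k : ℤ) (hij : j + 1 = i) (hjk : k + 1 = j) : Exact (K.d i j) (K.d j k) := by
  intro x
  constructor
  · intro hx
    obtain ⟨y, hy⟩ := (h (DirectSum.lof R ℤ (fun i => K.X i) j x)).1 (by
      rw [totD_lof K j k hjk, hx, map_zero])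
    subst hij
    refine ⟨y (j + 1), ?_⟩
    rw [← totD_apply, hy, DirectSum.lof_apply]
  · rintro ⟨y, rfl⟩
    exact d_apply_d_apply K i j k y

theorem HE_totD_iff_coker {K : ChainComplex (ModuleCat.{u} R) ℤ} (h : Exact (totD K) (totD K))
    (hK : ∀ n, Module.Projective R (K.X n)) (X : Type u) [AddCommGroup X] [Module R X] :
    HE (totD K) X ↔ ∀ i j, j + 1 = i → E1 (R := R) (coker K i j) X := by
  have key : ∀ i j, j + 1 = i → (E1 (R := R) (coker K i j) X ↔ ∀ f : K.X i →ₗ[R] X,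
      f ∘ₗ (K.d (i + 1) i).hom = 0 → ∃ g : K.X j →ₗ[R] X, f = g ∘ₗ (K.d i j).hom) :=
    fun i j hij => by
      have := hK j
      exact E1_iff_of_exact (K.d (i + 1) i).hom (K.d i j).hom
        (LinearMap.range (K.d i j).hom).mkQ (exact_of_exact_totD h (i + 1) i j rfl hij)
        (LinearMap.exact_map_mkQ_range _) (Submodule.mkQ_surjective _)
  rw [HE_totD_iff]
  constructor
  · intro H i j hij
    rw [key i j hij]
    obtain rfl : j = i - 1 := by omega
    exact H i
  · exact fun H i => (key i (i - 1) (by omega)).1 (H i (i - 1) (by omega))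

theorem CharAcyclic.coker {K : ChainComplex (ModuleCat.{u} R) ℤ} (h : Exact (totD K) (totD K))
    (hK : ∀ n, Module.Projective R (K.X n)) (h₀ : CharAcyclic (R := R) (coker K 1 0)) (i j : ℤ)
    (hij : j + 1 = i) : CharAcyclic (R := R) (coker K i j) := by
  have seq : ∀ i j k, j + 1 = i → k + 1 = j → ∃ a : GorensteinPure.coker K i j →ₗ[R] K.X k,
      Injective a ∧ Exact a (LinearMap.range (K.d j k).hom).mkQ := fun i j k hij hjk => by
    have hle : LinearMap.range (K.d i j).hom ≤ LinearMap.ker (K.d j k).hom := by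
      rintro _ ⟨y, rfl⟩
      exact d_apply_d_apply K i j k y
    refine ⟨(LinearMap.range (K.d i j).hom).liftQ (K.d j k).hom hle,
      (injective_iff_map_eq_zero _).2 fun x hx => ?_, fun x => ?_⟩
    · obtain ⟨y, rfl⟩ := Submodule.mkQ_surjective _ x
      exact (Submodule.Quotient.mk_eq_zero _).2 ((exact_of_exact_totD h i j k hij hjk y).1 hx)
    · refine (LinearMap.exact_map_mkQ_range (K.d j k).hom x).trans
        ⟨fun ⟨y, hy⟩ => ⟨(LinearMap.range (K.d i j).hom).mkQ y, hy⟩, fun ⟨y, hy⟩ => ?_⟩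
      obtain ⟨z, rfl⟩ := Submodule.mkQ_surjective _ y
      exact ⟨z, hy⟩
  suffices ∀ n : ℤ, CharAcyclic (R := R) (GorensteinPure.coker K (n + 1) n) by
    subst hij
    exact this j
  intro n
  induction n using Int.induction_on with
  | zero => exact h₀
  | succ n ih =>
    obtain ⟨a, ha, ha'⟩ := seq ((n : ℤ) + 1 + 1) (n + 1) n rfl rfl
    intro C _ _ d hd
    have := hd.projective
    have := hK n
    exact HE.character_left hd.sq a _ ha ha' (Submodule.mkQ_surjective _)
      (hd.he_projective (K.X n)) (ih C d hd)
  | pred n ih =>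
    obtain ⟨a, ha, ha'⟩ := seq (-(n : ℤ) + 1) (-n) (-n - 1) rfl (by omega)
    intro C _ _ d hd
    have := hd.projective
    have := hK (-n - 1)
    rw [sub_add_cancel]
    exact HE.character_right hd.sq a _ ha ha' (Submodule.mkQ_surjective _)
      (ih C d hd) (hd.he_projective (K.X (-n - 1)))

end GorensteinPure

namespace GorensteinPure

open Function

theorem exists_pgf_extension (M : Type u) [AddCommGroup M] [Module R M] :
    ∃ (B L : ChainComplex (ModuleCat.{u} R) ℤ) (_ : Extension M B L),
      (∀ n, Module.Projective R (L.X n)) ∧ PGF (totD L) ∧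
      ∀ (C : Type u) [AddCommGroup C] [Module R C] (d : C →ₗ[R] C), PGF d →
        NullHtpy d (prodD B) := by
  have hX : ∀ s : SmallPGF R, Module.Projective R (s.1.1 →₀ R) := fun s => s.2.projective
  obtain ⟨B, L, S, h₁, h₂, h₃⟩ := exists_extension (X := fun s : SmallPGF R => s.1.1 →₀ R)
    (fun s => s.1.2) (fun s => s.2.sq) M
  refine ⟨B, L, S, h₁, ⟨?_, ?_, ?_⟩, fun C _ _ d hd =>
    nullHtpy_of_smallPGF (prodD B) (prodD_comp B) h₃ d hd⟩
  · exact inferInstanceAs (Module.Projective R (DirectSum ℤ fun n => L.X n))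
  · exact (HE_character_self_iff _ (totD_comp L)).1
      (h₂ _ fun s => (HE_character_self_iff _ s.2.sq).2 s.2.exact)
  · exact fun I _ _ _ => h₂ _ fun s => s.2.he I

section

variable {M : Type u} [AddCommGroup M] [Module R M] {B L : ChainComplex (ModuleCat.{u} R) ℤ}

theorem Extension.W_V [IsNoetherianRing R] (hVG : VG R) (S : Extension M B L)
    (hP : ∀ n, Module.Projective R (L.X n)) (hL : PGF (totD L))
    (hB : ∀ (C : Type u) [AddCommGroup C] [Module R C] (d : C →ₗ[R] C), PGF d →
      NullHtpy d (prodD B)) : W (R := R) S.V := fun C _ _ d hd =>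
  S.HE_V (exact_of_exact_totD hL.exact) hP hd (hB C d (hd.pgf hVG))

theorem W.charAcyclic (hVG : VG R) (hM : W (R := R) M) : CharAcyclic (R := R) M :=
  fun _ _ _ _ hd => hM.he_character hVG hd

theorem Extension.charAcyclic_Z [IsNoetherianRing R] (hVG : VG R) (S : Extension M B L)
    (hP : ∀ n, Module.Projective R (L.X n)) (hL : PGF (totD L))
    (hB : ∀ (C : Type u) [AddCommGroup C] [Module R C] (d : C →ₗ[R] C), PGF d →
      NullHtpy d (prodD B)) (hM : CharAcyclic (R := R) M) : CharAcyclic (R := R) S.Z := by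
  intro C _ _ d hd
  have := hd.projective
  exact HE.character_right hd.sq S.i S.q (S.i_injective (exact_of_exact_totD hL.exact))
    S.exact_i_q S.q_surjective (hM C d hd) ((S.W_V hVG hP hL hB).charAcyclic hVG C d hd)

theorem Extension.HE_character [IsNoetherianRing R] (hVG : VG R) (S : Extension M B L)
    (hP : ∀ n, Module.Projective R (L.X n)) (hL : PGF (totD L))
    (hB : ∀ (C : Type u) [AddCommGroup C] [Module R C] (d : C →ₗ[R] C), PGF d →
      NullHtpy d (prodD B)) (hM : CharAcyclic (R := R) M) (N : Type u) [AddCommGroup N]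
    [Module R N] : HE (totD L) (CharacterModule N) := by
  obtain ⟨B', L', S', hP', hL', hB'⟩ := exists_pgf_extension (R := R) N
  have hZ := CharAcyclic.coker hL.exact hP (S.charAcyclic_Z hVG hP hL hB hM)
  have hLZ : HE (totD L) (CharacterModule S'.Z) := by
    rw [HE_totD_iff_coker hL.exact hP]
    intro i j hij
    refine E1.symm_character ?_
    exact (HE_totD_iff_coker hL'.exact hP' _).1 (hZ i j hij _ _ hL') 1 0 rfl
  have := hL.projective
  exact HE.character_left hL.sq S'.i S'.q (S'.i_injective (exact_of_exact_totD hL'.exact))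
    S'.exact_i_q S'.q_surjective
    ((S'.W_V hVG hP' hL' hB').charAcyclic hVG _ _ hL) hLZ

theorem CharAcyclic.HE [IsNoetherianRing R] (hVG : VG R) (hM : CharAcyclic (R := R) M) {C : Type u}
    [AddCommGroup C] [Module R C] {d : C →ₗ[R] C} (hd : PGF d) : HE d M := by
  obtain ⟨B, L, S, hP, hL, hB⟩ := exists_pgf_extension (R := R) M
  have hE1 : E1 (R := R) S.Z M := by
    refine (HE_totD_iff_coker hL.exact hP M).1 ?_ 1 0 rfl
    have := hL.projective
    obtain ⟨s, hs⟩ := exists_contraction_of_character (totD L) hL.sq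
      fun N _ _ => S.HE_character hVG hP hL hB hM N
    refine fun f hf => ⟨f ∘ₗ s, ?_⟩
    conv_lhs => rw [← LinearMap.comp_id f, hs, LinearMap.comp_add, ← LinearMap.comp_assoc, hf,
      LinearMap.zero_comp, zero_add, ← LinearMap.comp_assoc]
  obtain ⟨ρ, hρ⟩ := hE1.extend S.i S.q (S.i_injective (exact_of_exact_totD hL.exact))
    S.exact_i_q S.q_surjective LinearMap.id
  intro f hf
  have hj : ∀ n, n ≠ 0 → ∀ m, B.d 0 n (S.j m) = 0 := fun n hn m => S.injective n hn (by
    rw [← S.d_apply, S.exact.apply_apply_eq_zero, map_zero, map_zero])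
  let v : ∀ n, C →ₗ[R] B.X n := Function.update (fun _ => 0) 0 (S.j ∘ₗ f)
  have hv₀ : v 0 = S.j ∘ₗ f := Function.update_self _ _ _
  have hv₁ : ∀ n, n ≠ 0 → v n = 0 := fun n hn => Function.update_of_ne hn _ _
  obtain ⟨t, ht⟩ := (nullHtpy_prodD_iff d B).1 (hB C d hd) v (fun i j hij => by
    obtain rfl | hi := eq_or_ne i 0
    · rw [hv₀, hv₁ j (by omega), LinearMap.zero_comp]
      exact LinearMap.ext fun c => hj j (by omega) (f c)
    · rw [hv₁ i hi, LinearMap.comp_zero]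
      obtain rfl | hj := eq_or_ne j 0
      · rw [hv₀, LinearMap.comp_assoc, hf, LinearMap.comp_zero]
      · rw [hv₁ j hj, LinearMap.zero_comp])
  let p := (LinearMap.range (B.d 1 0).hom).mkQ
  refine ⟨ρ ∘ₗ p ∘ₗ t 0, ?_⟩
  have h₁ : p ∘ₗ S.j ∘ₗ f = p ∘ₗ t 0 ∘ₗ d := by
    rw [← hv₀, ht 1 0 rfl, LinearMap.comp_add, ← LinearMap.comp_assoc,
      LinearMap.range_mkQ_comp, LinearMap.zero_comp, zero_add]
  calc f = (ρ ∘ₗ S.i) ∘ₗ f := by rw [hρ, LinearMap.id_comp]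
    _ = ρ ∘ₗ p ∘ₗ S.j ∘ₗ f := rfl
    _ = _ := by rw [h₁]; rfl

end

theorem PGF.ta [IsNoetherianRing R] (hVG : VG R) {C : Type u} [AddCommGroup C] [Module R C]
    {d : C →ₗ[R] C} (hd : PGF d) : TA d where
  projective := hd.projective
  exact := hd.exact
  he P _ _ _ := CharAcyclic.HE hVG (fun _ _ _ _ hd => hd.he_projective P) hd

theorem W_iff_smallPGF [IsNoetherianRing R] (hVG : VG R) (M : Type u) [AddCommGroup M]
    [Module R M] :
    W (R := R) M ↔ ∀ s : SmallPGF R, HE (R := R) s.1.2 (CharacterModule M) :=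
  ⟨fun h s => h.he_character hVG s.2, fun h _ _ _ _ hd =>
    CharAcyclic.HE hVG (fun _ _ _ d hd => HE_of_smallPGF h d hd) (hd.pgf hVG)⟩

/-- Every module embeds in a module of `W` with Gorenstein projective cokernel. -/
theorem exists_W_embedding [IsNoetherianRing R] (hVG : VG R) (M : Type u) [AddCommGroup M]
    [Module R M] : ∃ (V Z : ModuleCat.{u} R) (i : M →ₗ[R] V) (q : V →ₗ[R] Z),
      Injective i ∧ Exact i q ∧ Surjective q ∧ W (R := R) V ∧ IsGorensteinProjective Z ∧
      ∀ (P : Type u) [AddCommGroup P] [Module R P] [Module.Projective R P],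
        E1 (R := R) Z P := by
  obtain ⟨B, L, S, hP, hL, hB⟩ := exists_pgf_extension (R := R) M
  have hta := hL.ta hVG
  have hex := exact_of_exact_totD hL.exact
  refine ⟨ModuleCat.of R S.V, ModuleCat.of R S.Z, S.i, S.q, S.i_injective hex, S.exact_i_q,
    S.q_surjective, S.W_V hVG hP hL hB, ?_, fun P _ _ _ =>
    (HE_totD_iff_coker hL.exact hP P).1 (hta.he P) 1 0 rfl⟩
  refine isGorensteinProjective_of_totD L
    (fun i => (IsProjective.iff_projective (P := L.X i)).1 (hP i))
    (fun i => (exactAt_iff L i).2 (hex _ _ _ (by omega) (by omega))) (fun P _ _ _ => hta.he P) _ ?_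
  exact (ModuleCat.cokernelIsoRangeQuotient (L.d 1 0)).symm

end GorensteinPure

namespace GorensteinPure

open Function Cardinal TensorProduct

theorem range_lTensor_span_subtype (N : Type*) {M : Type*} [AddCommGroup N] [Module R N]
    [AddCommGroup M] [Module R M] (X : Set M) :
    LinearMap.range ((Submodule.span R X).subtype.lTensor N) =
      Submodule.span R (Set.image2 (fun (m : M) (n : N) => n ⊗ₜ[R] m) X Set.univ) := by
  apply le_antisymm
  · rintro _ ⟨z, rfl⟩
    induction z with
    | zero => simp
    | add x y hx hy => rw [map_add]; exact add_mem hx hy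
    | tmul n m =>
      obtain ⟨m, hm⟩ := m
      rw [LinearMap.lTensor_tmul, Submodule.subtype_apply]
      induction hm using Submodule.span_induction with
      | mem m hm => exact Submodule.subset_span ⟨m, hm, n, trivial, rfl⟩
      | zero => simp
      | add x y _ _ hx hy => rw [tmul_add]; exact add_mem hx hy
      | smul r x _ hx => rw [tmul_smul]; exact Submodule.smul_mem _ _ hx
  · rw [Submodule.span_le]
    rintro _ ⟨m, hm, n, -, rfl⟩
    exact ⟨n ⊗ₜ ⟨m, Submodule.subset_span hm⟩, rfl⟩

theorem HE_character_span_admitsClosure {κ : Cardinal.{u}} (hκ : ℵ₀ ≤ κ) (hR : #R ≤ κ)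
    {C M : Type u} [AddCommGroup C] [Module R C] [Module.Flat R C] [AddCommGroup M] [Module R M]
    (d : C →ₗ[R] C) (hd : d ∘ₗ d = 0) (hC : #C ≤ κ) (h : HE d (CharacterModule M)) :
    AdmitsClosure κ fun X : Set M => HE d (CharacterModule (Submodule.span R X)) := by
  rw [HE_character_iff d hd] at h
  have h' : ∀ z, ∃ w, d.rTensor M z = 0 → d.rTensor M w = z := fun z => by
    by_cases hz : d.rTensor M z = 0
    · obtain ⟨w, hw⟩ := (h z).1 hz
      exact ⟨w, fun _ => hw⟩
    · exact ⟨0, fun h => absurd h hz⟩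
  choose w hw using h'
  have htop : Submodule.span R (Set.image2 (fun (m : M) (n : C) => n ⊗ₜ[R] m)
      Set.univ Set.univ) = ⊤ := by
    rw [← range_lTensor_span_subtype, LinearMap.range_eq_top]
    exact LinearMap.lTensor_surjective C fun m => ⟨⟨m, by simp⟩, rfl⟩
  refine (AdmitsClosure.span_image2 hκ hR hC _ htop w).mono fun X hX => ?_
  let i := (Submodule.span R X).subtype
  refine (HE_character_iff d hd _).2 fun z => ⟨fun hz => ?_, ?_⟩
  · have h1 := hw (i.lTensor C z) (by rw [rTensor_lTensor_comm, hz, map_zero])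
    have h2 := hX (i.lTensor C z) (by rw [← range_lTensor_span_subtype]; exact ⟨z, rfl⟩)
    rw [← range_lTensor_span_subtype] at h2
    obtain ⟨y, hy⟩ := h2
    refine ⟨y, Module.Flat.lTensor_preserves_injective_linearMap (M := C) i
      Subtype.val_injective ?_⟩
    rw [← rTensor_lTensor_comm, hy, h1]
  · rintro ⟨y, rfl⟩
    rw [← LinearMap.rTensor_comp_apply, hd, LinearMap.rTensor_zero]
    rfl

variable (R) in
/-- A bound on the size of the modules of a filtration witnessing that the class `W` is
deconstructible. -/
noncomputable def deconstructionCardinal : Cardinal.{u} :=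
  max (testCardinal R) #(SmallPGF R)

theorem mk_smallPGF_le (s : SmallPGF R) : #(s.1.1 →₀ R) ≤ testCardinal R :=
  mk_finsupp_le (aleph0_le_testCardinal R)
    ((mk_set_le s.1.1).trans_eq (mk_out _)) (mk_le_testCardinal R)

variable [IsNoetherianRing R] (hVG : VG R)
include hVG

theorem W.admitsClosure_span {M : Type u} [AddCommGroup M] [Module R M] (hM : W (R := R) M) :
    AdmitsClosure (deconstructionCardinal R) fun X : Set M =>
      W (R := R) (Submodule.span R X) := by
  have h := (W_iff_smallPGF hVG M).1 hM
  have hκ := (aleph0_le_testCardinal R).trans (le_max_left _ #(SmallPGF R))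
  have hX (s : SmallPGF R) : Module.Projective R (s.1.1 →₀ R) := s.2.projective
  refine (AdmitsClosure.forall hκ (le_max_right _ _) fun s : SmallPGF R =>
    HE_character_span_admitsClosure hκ ((mk_le_testCardinal R).trans (le_max_left _ _)) s.1.2
      s.2.sq ((mk_smallPGF_le s).trans (le_max_left _ _)) (h s)).mono fun X hX => ?_
  exact (W_iff_smallPGF hVG _).2 hX

theorem E1_of_small_W {E : Type u} [AddCommGroup E] [Module R E]
    (hE : ∀ (A : Type u) [AddCommGroup A] [Module R A], #A ≤ deconstructionCardinal R →
      W (R := R) A → E1 (R := R) A E)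
    (A : Type u) [AddCommGroup A] [Module R A] (hA : W (R := R) A) : E1 (R := R) A E := by
  induction hμ : #A using WellFoundedLT.induction generalizing A with
  | ind μ ih =>
    subst hμ
    rcases le_or_gt #A (deconstructionCardinal R) with hB | hB
    · exact hE A hB hA
    · have hκ := (aleph0_le_testCardinal R).trans (le_max_left _ #(SmallPGF R))
      have hR := (mk_le_testCardinal R).trans (le_max_left _ #(SmallPGF R))
      obtain ⟨c, hc, h⟩ := hA.admitsClosure_span hVG
      have hlt (X : Set A) (hX : #X < #A) : #(Submodule.span R X) < #A :=
        (mk_span_le (κ := max #X (deconstructionCardinal R)) (hκ.trans (le_max_right _ _))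
          (hR.trans (le_max_right _ _)) X (le_max_left _ _)).trans_lt (max_lt hX hB)
      refine E1.of_filtration hκ hB c hc (fun X => Submodule.span R X)
        (fun X Y => Submodule.span_mono) Submodule.span_univ ?_
        (fun X hX hXA => ih _ (hlt X hXA) _ (h X hX) rfl)
        (fun X X' hX hX' hXX' hXA => ih _ ((mk_le_of_surjective
          (Submodule.mkQ_surjective _)).trans_lt (hlt X' hXA)) _
          (W.quotient (Submodule.span_mono hXX') (h X' hX') (h X hX)) rfl)
      intro S hS hdir x hx
      have : Nonempty S := hS.to_subtype
      rw [Set.sUnion_eq_iUnion, Submodule.span_iUnion,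
        Submodule.mem_iSup_of_directed _ (fun X Y => by
          obtain ⟨Z, hZ, h₁, h₂⟩ := hdir X X.2 Y Y.2
          exact ⟨⟨Z, hZ⟩, Submodule.span_mono h₁, Submodule.span_mono h₂⟩)] at hx
      obtain ⟨X, hX⟩ := hx
      exact ⟨X, X.2, hX⟩

theorem exists_W_preenvelope (M : ModuleCat.{u} R) :
    ∃ (E L : ModuleCat.{u} R) (j : M →ₗ[R] E) (p : E →ₗ[R] L),
      Injective j ∧ Exact j p ∧ Surjective p ∧
      (∀ (A : Type u) [AddCommGroup A] [Module R A], W (R := R) A → E1 (R := R) A E) ∧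
      W (R := R) L := by
  let F := (deconstructionCardinal R).out →₀ R
  obtain ⟨E, L, j, p, hj, hjp, hp, h, h'⟩ := exists_preenvelope
    (fun K : {K : Submodule R F // W (R := R) (F ⧸ K)} => ModuleCat.of R (F ⧸ K.1)) M
  refine ⟨E, L, j, p, hj, hjp, hp, fun A _ _ hA => E1_of_small_W hVG (fun A _ _ hAκ hA => ?_) A hA,
    (hVG.W_iff L).2 fun E' hE' => h' E' fun K => (hVG.W_iff _).1 K.2 E' hE'⟩
  obtain ⟨f⟩ : Nonempty (A ↪ (deconstructionCardinal R).out) := by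
    rwa [← Cardinal.le_def, mk_out]
  let v : (deconstructionCardinal R).out → A := invFun f
  have hq : Surjective (Finsupp.linearCombination R v) :=
    Finsupp.linearCombination_surjective R (invFun_surjective f.injective)
  let e := (Finsupp.linearCombination R v).quotKerEquivOfSurjective hq
  exact E1.congr_left (h ⟨_, hA.congr e⟩) e

end GorensteinPure

namespace GorensteinPure

open Function

theorem exists_injective_embedding (E : Type u) [AddCommGroup E] [Module R E] :
    ∃ (I Z : ModuleCat.{u} R) (i : E →ₗ[R] I) (p : I →ₗ[R] Z), Injective i ∧ Exact i p ∧
      Surjective p ∧ Module.Injective R I := by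
  let J : ModuleCat.{u} R := Injective.under (ModuleCat.of R E)
  let i : E →ₗ[R] J := (Injective.ι (ModuleCat.of R E)).hom
  have : CategoryTheory.Injective (ModuleCat.of R J) :=
    inferInstanceAs (CategoryTheory.Injective (Injective.under (ModuleCat.of R E)))
  exact ⟨J, ModuleCat.of R (J ⧸ LinearMap.range i), i, (LinearMap.range i).mkQ,
    (ModuleCat.mono_iff_injective (Injective.ι (ModuleCat.of R E))).1 inferInstance,
    LinearMap.exact_map_mkQ_range _, Submodule.mkQ_surjective _,
    Module.injective_module_of_injective_object (R := R) (M := J)⟩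

section Pushout

variable {N F C V Z : Type u} [AddCommGroup N] [Module R N] [AddCommGroup F] [Module R F]
  [AddCommGroup C] [Module R C] [AddCommGroup V] [Module R V] [AddCommGroup Z] [Module R Z]

/-- The pushout of two short exact sequences starting in the same module. -/
theorem exists_pushout (i : N →ₗ[R] F) (p : F →ₗ[R] C) (hi : Injective i) (hip : Exact i p)
    (hp : Surjective p) (j : N →ₗ[R] V) (q : V →ₗ[R] Z) (hj : Injective j) (hjq : Exact j q)
    (hq : Surjective q) :
    ∃ (G : ModuleCat.{u} R) (a : F →ₗ[R] G) (b : V →ₗ[R] G) (p' : G →ₗ[R] C) (q' : G →ₗ[R] Z),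
      Injective a ∧ Exact a q' ∧ Surjective q' ∧ Injective b ∧ Exact b p' ∧ Surjective p' := by
  let K := LinearMap.range (i.prod (-j))
  have hpi : ∀ n, p (i n) = 0 := fun n => (hip _).2 ⟨n, rfl⟩
  have hqj : ∀ n, q (j n) = 0 := fun n => (hjq _).2 ⟨n, rfl⟩
  have hK : ∀ x y, (x, y) ∈ K ↔ ∃ n, i n = x ∧ -j n = y := fun x y => by
    simp [K, LinearMap.mem_range, Prod.ext_iff]
  let a : F →ₗ[R] (F × V) ⧸ K := K.mkQ ∘ₗ LinearMap.inl R F V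
  let b : V →ₗ[R] (F × V) ⧸ K := K.mkQ ∘ₗ LinearMap.inr R F V
  have hab : ∀ n, a (i n) = b (j n) := fun n => by
    refine (Submodule.Quotient.eq K).2 ((hK _ _).2 ⟨n, ?_, ?_⟩) <;> simp
  let p' : (F × V) ⧸ K →ₗ[R] C := K.liftQ (p.coprod 0) (by
    rintro _ ⟨n, rfl⟩
    simp [hpi])
  let q' : (F × V) ⧸ K →ₗ[R] Z := K.liftQ ((0 : F →ₗ[R] Z).coprod q) (by
    rintro _ ⟨n, rfl⟩
    simp [hqj])
  have hp' : ∀ x y, p' (a x + b y) = p x := fun x y => by simp [p', a, b]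
  have hq' : ∀ x y, q' (a x + b y) = q y := fun x y => by simp [q', a, b]
  have hG : ∀ g, ∃ x y, g = a x + b y := fun g => by
    obtain ⟨⟨x, y⟩, rfl⟩ := K.mkQ_surjective g
    refine ⟨x, y, ?_⟩
    simp only [a, b, LinearMap.comp_apply, ← map_add]
    simp
  refine ⟨ModuleCat.of R ((F × V) ⧸ K), a, b, p', q', ?_, ?_, fun z => ?_, ?_, ?_, fun c => ?_⟩
  · refine (injective_iff_map_eq_zero a).2 fun x hx => ?_
    obtain ⟨n, rfl, hn⟩ := (hK _ _).1 ((Submodule.Quotient.mk_eq_zero K).1 hx)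
    rw [(injective_iff_map_eq_zero j).1 hj n (neg_eq_zero.1 hn), map_zero]
  · intro g
    constructor
    · obtain ⟨x, y, rfl⟩ := hG g
      intro h
      obtain ⟨n, rfl⟩ := (hjq y).1 ((hq' x y).symm.trans h)
      exact ⟨x + i n, by rw [map_add, hab]⟩
    · rintro ⟨x, rfl⟩
      simpa using hq' x 0
  · obtain ⟨y, rfl⟩ := hq z
    exact ⟨a 0 + b y, hq' _ _⟩
  · refine (injective_iff_map_eq_zero b).2 fun x hx => ?_
    obtain ⟨n, hn, rfl⟩ := (hK _ _).1 ((Submodule.Quotient.mk_eq_zero K).1 hx)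
    rw [(injective_iff_map_eq_zero i).1 hi n hn, map_zero, neg_zero]
  · intro g
    constructor
    · obtain ⟨x, y, rfl⟩ := hG g
      intro h
      obtain ⟨n, rfl⟩ := (hip x).1 ((hp' x y).symm.trans h)
      exact ⟨j n + y, by rw [map_add, hab]⟩
    · rintro ⟨x, rfl⟩
      simpa using hp' 0 x
  · obtain ⟨x, rfl⟩ := hp c
    exact ⟨a x + b 0, hp' _ _⟩

end Pushout

theorem E1.mid {A X Y Z : Type u} [AddCommGroup A] [Module R A] [AddCommGroup X] [Module R X]
    [AddCommGroup Y] [Module R Y] [AddCommGroup Z] [Module R Z] (i : X →ₗ[R] Y) (p : Y →ₗ[R] Z)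
    (hi : Injective i) (hip : Exact i p) (hp : Surjective p) (hX : E1 (R := R) A X)
    (hZ : E1 (R := R) A Z) : E1 (R := R) A Y := by
  let q := Finsupp.linearCombination R (id : A → A)
  have hq : Surjective q := Finsupp.linearCombination_id_surjective R A
  refine E1.of_presentation q hq fun f => ?_
  obtain ⟨g, hg⟩ := hZ _ q hq (p ∘ₗ f)
  obtain ⟨g', hg'⟩ := Module.projective_lifting_property p g hp
  let φ : LinearMap.ker q →ₗ[R] Y := f - g' ∘ₗ (LinearMap.ker q).subtype
  have hφ (x : LinearMap.ker q) : ∃ a, i a = φ x := by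
    refine (hip _).1 ?_
    rw [LinearMap.sub_apply, map_sub, sub_eq_zero]
    exact (LinearMap.congr_fun hg x).symm.trans (LinearMap.congr_fun hg' x).symm
  obtain ⟨s, hs⟩ := exists_comp_eq_of_injective (X := LinearMap.ker q) i hi φ hφ
  obtain ⟨s', hs'⟩ := hX _ q hq s
  refine ⟨g' + i ∘ₗ s', ?_⟩
  rw [LinearMap.add_comp, LinearMap.comp_assoc, hs', hs, add_sub_cancel]

/-- The right orthogonal of the class `W`. -/
def WPerp (E : Type u) [AddCommGroup E] [Module R E] : Prop :=
  ∀ (A : Type u) [AddCommGroup A] [Module R A], W (R := R) A → E1 (R := R) A E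

theorem WPerp.right {X Y Z : Type u} [AddCommGroup X] [Module R X]
    [AddCommGroup Y] [Module R Y] [AddCommGroup Z] [Module R Z] (hX : WPerp (R := R) X)
    [Module.Injective R Y] (i : X →ₗ[R] Y) (p : Y →ₗ[R] Z)
    (hi : Injective i) (hip : Exact i p) (hp : Surjective p) : WPerp (R := R) Z := by
  intro A _ _ hA
  let q := Finsupp.linearCombination R (id : A → A)
  have hq : Surjective q := Finsupp.linearCombination_id_surjective R A
  refine E1.of_presentation q hq fun f => ?_
  have hK : W (R := R) (LinearMap.ker q) := W.left (LinearMap.ker q).subtype q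
    Subtype.val_injective q.exact_subtype_ker_map hq W.of_projective hA
  obtain ⟨g, hg⟩ := (hX _ hK).lift i p hi hip hp f
  obtain ⟨g', hg'⟩ := Module.Injective.out (X := LinearMap.ker q) (LinearMap.ker q).subtype
    Subtype.val_injective g
  exact ⟨p ∘ₗ g', LinearMap.ext fun x => by
    rw [← hg]
    exact congrArg p (hg' x)⟩

variable (R) in
/-- A short exact sequence with injective middle term and outer terms in the right orthogonal of
`W`. -/
structure PerpSequence where
  /-- the left-hand term -/
  left : ModuleCat.{u} R
  /-- the injective middle term -/
  mid : ModuleCat.{u} R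
  /-- the right-hand term -/
  right : ModuleCat.{u} R
  /-- the inclusion -/
  i : left →ₗ[R] mid
  /-- the projection -/
  p : mid →ₗ[R] right
  hi : Injective i
  hip : Exact i p
  hp : Surjective p
  injective : Module.Injective R mid
  perp_left : WPerp (R := R) left
  perp_right : WPerp (R := R) right

theorem exists_perpSequence_left (E : ModuleCat.{u} R) (hE : WPerp (R := R) E) :
    ∃ S : PerpSequence R, S.left = E := by
  obtain ⟨I, Z, i, p, hi, hip, hp, hI⟩ := exists_injective_embedding (R := R) E
  exact ⟨⟨E, I, Z, i, p, hi, hip, hp, hI, hE, hE.right i p hi hip hp⟩, rfl⟩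

theorem exists_perpSequence_right [IsNoetherianRing R] (hVG : VG R) (E : ModuleCat.{u} R)
    (hE : WPerp (R := R) E) : ∃ S : PerpSequence R, S.right = E := by
  let t := Finsupp.linearCombination R (id : E → E)
  have ht : Surjective t := Finsupp.linearCombination_id_surjective R E
  obtain ⟨E', L, j, q, hj, hjq, hq, hE', hL⟩ :=
    exists_W_preenvelope hVG (ModuleCat.of R (LinearMap.ker t))
  obtain ⟨G, a, b, p', q', ha, haq, hq', hb, hbp, hp'⟩ := exists_pushout (LinearMap.ker t).subtype t
    Subtype.val_injective t.exact_subtype_ker_map ht j q hj hjq hq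
  have hG : W (R := R) G := W.mid a q' ha haq hq' W.of_projective hL
  obtain ⟨J, Z, i, p, hi, hip, hp, hJ⟩ := exists_injective_embedding (R := R) G
  have hZ : W (R := R) Z := W.right i p hi hip hp W.of_injective hG
  obtain ⟨r, hr⟩ := ((hE' Z hZ).mid b p' hb hbp hp' (hE Z hZ)).extend i p hi hip hp LinearMap.id
  have hGI : Module.Injective R G := ⟨fun X Y _ _ _ _ f hf g => by
    obtain ⟨h, hh⟩ := hJ.out f hf (i ∘ₗ g)
    exact ⟨r ∘ₗ h, fun x => by
      rw [LinearMap.comp_apply, hh]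
      exact LinearMap.congr_fun hr (g x)⟩⟩
  exact ⟨⟨E', G, E, b, p', hb, hbp, hp', hGI, hE', hE⟩, rfl⟩

theorem WPerp.isGorensteinInjective [IsNoetherianRing R] (hVG : VG R) {E : ModuleCat.{u} R}
    (hE : WPerp (R := R) E) : IsGorensteinInjective E := by
  have up (S : PerpSequence R) : ∃ T : PerpSequence R, Nonempty (S.right ≃ₗ[R] T.left) := by
    obtain ⟨T, hT⟩ := exists_perpSequence_left _ S.perp_right
    exact ⟨T, hT ▸ ⟨LinearEquiv.refl _ _⟩⟩
  have down (S : PerpSequence R) : ∃ T : PerpSequence R, Nonempty (T.right ≃ₗ[R] S.left) := by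
    obtain ⟨T, hT⟩ := exists_perpSequence_right hVG _ S.perp_left
    exact ⟨T, hT ▸ ⟨LinearEquiv.refl _ _⟩⟩
  obtain ⟨S, rfl⟩ := exists_perpSequence_left E hE
  obtain ⟨f, hf0, hf⟩ := exists_int_family (α := fun _ => PerpSequence R)
    (fun _ _ T S => Nonempty (S.right ≃ₗ[R] T.left)) S (up S) (down S)
    (fun _ _ _ _ _ _ _ y _ => up y)
    (fun _ _ _ _ _ _ _ y _ => down y)
  let e (n : ℤ) : (f n).right ≃ₗ[R] (f (n + 1)).left := (hf (n + 1) n rfl).some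
  let δ (n : ℤ) : (f n).mid →ₗ[R] (f (n + 1)).mid := (f (n + 1)).i ∘ₗ (e n).toLinearMap ∘ₗ (f n).p
  have hδ (n : ℤ) (x : (f n).mid) : δ n x = 0 ↔ (f n).p x = 0 := by
    change (f (n + 1)).i (e n ((f n).p x)) = 0 ↔ _
    rw [map_eq_zero_iff _ (f (n + 1)).hi, LinearEquiv.map_eq_zero_iff]
  obtain ⟨ε, hε, hε'⟩ : ∃ ε : S.left →ₗ[R] (f 0).mid, Injective ε ∧ Exact ε (f 0).p := by
    rw [hf0]
    exact ⟨S.i, S.hi, S.hip⟩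
  refine isGorensteinInjective_of_seq (fun n => (f n).mid) (fun n => (f n).injective) δ
    (fun n x => ?_) (fun J _ _ _ n g hg => ?_) S.left ε hε (fun x => (hδ 0 x).trans (hε' x))
  · rw [hδ, (f (n + 1)).hip x]
    constructor
    · rintro ⟨y, rfl⟩
      obtain ⟨z, hz⟩ := (f n).hp ((e n).symm y)
      exact ⟨z, by simp [δ, hz]⟩
    · rintro ⟨z, rfl⟩
      exact ⟨_, rfl⟩
  · obtain ⟨g', hg'⟩ := exists_comp_eq_of_injective (f (n + 1)).i (f (n + 1)).hi g
      (fun x => ((f (n + 1)).hip _).1 ((hδ (n + 1) _).1 (LinearMap.congr_fun hg x)))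
    obtain ⟨k, hk⟩ := ((f n).perp_left J W.of_injective).lift (f n).i (f n).p (f n).hi (f n).hip
      (f n).hp ((e n).symm.toLinearMap ∘ₗ g')
    refine ⟨k, LinearMap.ext fun x => ?_⟩
    have := LinearMap.congr_fun hk x
    rw [LinearMap.comp_apply] at this
    simp [δ, this, ← hg']

theorem WPerp_iff_isGorensteinInjective [IsNoetherianRing R] (hVG : VG R) (E : ModuleCat.{u} R) :
    WPerp (R := R) E ↔ IsGorensteinInjective E :=
  ⟨fun h => h.isGorensteinInjective hVG, fun h A _ _ hA => (hVG.W_iff A).1 hA E h⟩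

end GorensteinPure

namespace GorensteinPure

open Function

theorem W.exists_lift {Q : ModuleCat.{u} R} (hQ : IsGorensteinProjective Q) {E L : Type u}
    [AddCommGroup E] [Module R E] [AddCommGroup L] [Module R L] (hL : W (R := R) L)
    (p : E →ₗ[R] L) (hp : Surjective p) (φ : Q →ₗ[R] L) : ∃ ψ : Q →ₗ[R] E, p ∘ₗ ψ = φ := by
  obtain ⟨K, hK, t, ht, hdt, hproj, -⟩ := exists_totD_of_isGorensteinProjective hQ
  have hφ : (φ ∘ₗ t) ∘ₗ (K.d (0 + 1) 0).hom = 0 :=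
    LinearMap.ext fun x => (congrArg φ ((hdt _).2 ⟨x, rfl⟩)).trans (map_zero φ)
  obtain ⟨g, hg⟩ := (hL _ _ hK).graded 0 (-1) (by norm_num) _ hφ
  have := hproj (-1)
  obtain ⟨g', hg'⟩ := Module.projective_lifting_property p g hp
  obtain ⟨ψ, hψ⟩ := exists_comp_eq_of_surjective t ht (g' ∘ₗ (K.d 0 (-1)).hom) (fun x hx => by
    obtain ⟨y, rfl⟩ := (hdt x).1 hx
    rw [LinearMap.comp_apply, d_apply_d_apply, map_zero])
  refine ⟨ψ, LinearMap.cancel_right ht |>.1 ?_⟩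
  rw [LinearMap.comp_assoc, hψ, ← LinearMap.comp_assoc, hg', hg]

theorem isGorensteinInjective_of_gpPureInjective [IsNoetherianRing R] (hVG : VG R)
    {M : ModuleCat.{u} R} (hM : GPPureInjective M) : IsGorensteinInjective M := by
  obtain ⟨E, L, j, p, hj, hjp, hp, hE, hL⟩ := exists_W_preenvelope hVG M
  let S : ShortComplex (ModuleCat.{u} R) := ShortComplex.mk (ModuleCat.ofHom j) (ModuleCat.ofHom p)
    (ModuleCat.hom_ext hjp.linearMap_comp_eq_zero)
  have hS : S.ShortExact :=
    { exact := (ShortComplex.ShortExact.moduleCat_exact_iff_function_exact S).2 hjp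
      mono_f := (ModuleCat.mono_iff_injective _).2 hj
      epi_g := (ModuleCat.epi_iff_surjective _).2 hp }
  obtain ⟨r, hr⟩ := hM S hS (fun Q hQ φ => by
    obtain ⟨ψ, hψ⟩ := hL.exists_lift hQ p hp φ.hom
    exact ⟨ModuleCat.ofHom ψ, ModuleCat.hom_ext hψ⟩) (𝟙 M)
  have hM' : WPerp (R := R) M := fun A _ _ hA =>
    (hE A hA).of_retract_right j r.hom (congrArg ModuleCat.Hom.hom hr)
  exact hM'.isGorensteinInjective hVG

/-- Every short exact sequence which is pure for Gorenstein projective modules admits, on its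
third term, a presentation by a module mapping to its middle term whose kernel lies in `W`. -/
theorem exists_W_presentation [IsNoetherianRing R] (hVG : VG R) {B C : Type u} [AddCommGroup B]
    [Module R B] [AddCommGroup C] [Module R C] (g : B →ₗ[R] C) (hg : Surjective g)
    (h : ∀ Q : ModuleCat.{u} R, IsGorensteinProjective Q →
      ∀ φ : Q →ₗ[R] C, ∃ ψ : Q →ₗ[R] B, g ∘ₗ ψ = φ) :
    ∃ (V G : ModuleCat.{u} R) (b : V →ₗ[R] G) (p : G →ₗ[R] C) (l : G →ₗ[R] B),
      W (R := R) V ∧ Injective b ∧ Exact b p ∧ Surjective p ∧ g ∘ₗ l = p := by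
  let t := Finsupp.linearCombination R (id : C → C)
  have ht : Surjective t := Finsupp.linearCombination_id_surjective R C
  obtain ⟨V, Z, j, q, hj, hjq, hq, hV, hZ, hZF⟩ :=
    exists_W_embedding hVG (LinearMap.ker t)
  obtain ⟨G, a, b, p', q', ha, haq, hq', hb, hbp, hp'⟩ := exists_pushout (N := LinearMap.ker t)
    (LinearMap.ker t).subtype t Subtype.val_injective t.exact_subtype_ker_map ht j q hj hjq hq
  obtain ⟨s, hs⟩ := (hZF (C →₀ R)).lift a q' ha haq hq' LinearMap.id
  have hs' (z : Z) : q' (s z) = z := LinearMap.congr_fun hs z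
  obtain ⟨r, hr⟩ := exists_comp_eq_of_injective a ha (LinearMap.id - s ∘ₗ q')
    (fun x => (haq _).1 (by simp [hs']))
  obtain ⟨l₁, hl₁⟩ := Module.projective_lifting_property g (p' ∘ₗ a) hg
  obtain ⟨l₂, hl₂⟩ := h Z hZ (p' ∘ₗ s)
  refine ⟨V, G, b, p', l₁ ∘ₗ r + l₂ ∘ₗ q', hV, hb, hbp, hp', ?_⟩
  rw [LinearMap.comp_add, ← LinearMap.comp_assoc, ← LinearMap.comp_assoc, hl₁, hl₂,
    LinearMap.comp_assoc, LinearMap.comp_assoc, hr, ← LinearMap.comp_add, sub_add_cancel,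
    LinearMap.comp_id]

theorem gpPureInjective_of_isGorensteinInjective [IsNoetherianRing R] (hVG : VG R)
    {E : ModuleCat.{u} R} (hE : IsGorensteinInjective E) : GPPureInjective E := by
  intro S hS hpure φ
  have hg := hS.moduleCat_surjective_g
  have hfg : Exact S.f.hom S.g.hom :=
    (ShortComplex.ShortExact.moduleCat_exact_iff_function_exact S).1 hS.exact
  obtain ⟨V, G, b, p, l, hV, hb, hbp, hp, hl⟩ := exists_W_presentation hVG S.g.hom hg
    (fun Q hQ ψ => by
      obtain ⟨χ, hχ⟩ := hpure Q hQ (ModuleCat.ofHom ψ)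
      exact ⟨χ.hom, congrArg ModuleCat.Hom.hom hχ⟩)
  obtain ⟨T, rfl⟩ := exists_perpSequence_right hVG E ((WPerp_iff_isGorensteinInjective hVG E).2 hE)
  obtain ⟨v, hv⟩ := exists_comp_eq_of_injective S.f.hom hS.moduleCat_injective_f (l ∘ₗ b)
    (fun x => (hfg _).1 (by
      rw [← LinearMap.comp_apply, ← LinearMap.comp_assoc, hl]
      exact (hbp _).2 ⟨x, rfl⟩))
  obtain ⟨w, hw⟩ := (T.perp_left V hV).lift T.i T.p T.hi T.hip T.hp (φ.hom ∘ₗ v)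
  obtain ⟨γ, hγ⟩ := T.injective.out b hb w
  obtain ⟨f, hf⟩ := exists_comp_eq_of_injective (X := LinearMap.ker S.g.hom) S.f.hom
    hS.moduleCat_injective_f (LinearMap.ker S.g.hom).subtype (fun x => (hfg x).1 x.2)
  have hf' (x : LinearMap.ker S.g.hom) : S.f.hom (f x) = x := LinearMap.congr_fun hf x
  obtain ⟨ψ, hψ, -⟩ := exists_glue p hp S.g.hom l hl (φ.hom ∘ₗ f) (T.p ∘ₗ γ) (fun k hk => by
    obtain ⟨x, rfl⟩ := (hbp k).1 hk
    rw [LinearMap.comp_apply, hγ, ← LinearMap.comp_apply, hw]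
    refine congrArg φ.hom (hS.moduleCat_injective_f ?_)
    exact (LinearMap.congr_fun hv x).trans (hf' ⟨l (b x), _⟩).symm)
  refine ⟨ModuleCat.ofHom ψ, ModuleCat.hom_ext (LinearMap.ext fun x => ?_)⟩
  have hx : S.g.hom (S.f.hom x) = 0 := (hfg _).2 ⟨x, rfl⟩
  have h₁ : ψ (S.f.hom x) = φ.hom (f ⟨S.f.hom x, hx⟩) := LinearMap.congr_fun hψ ⟨_, hx⟩
  have h₂ : f ⟨S.f.hom x, hx⟩ = x :=
    hS.moduleCat_injective_f (hf' ⟨S.f.hom x, hx⟩)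
  exact h₁.trans (congrArg φ.hom h₂)

end GorensteinPure

/-- Over a virtually Gorenstein Noetherian ring of finite Krull dimension,
the `GP`-pure injective modules are exactly the Gorenstein injective modules. -/
theorem stmt18 {R : Type u} [CommRing R] (hNoeth : IsNoetherianRing R)
    (hdim : ringKrullDim R < ⊤)
    (hVG : ∀ M : ModuleCat.{u} R, MemGPperp M ↔ MemPerpGI M) :
    ∀ M : ModuleCat.{u} R, GPPureInjective M ↔ IsGorensteinInjective M := by
  exact fun _ => ⟨GorensteinPure.isGorensteinInjective_of_gpPureInjective hVG,
    GorensteinPure.gpPureInjective_of_isGorensteinInjective hVG⟩
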